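/- Let m ∈ (m_s, 1), let u be a radial energy solution of the fast diffusion equation with exponent m and extinction time T > 0, and let V be a stationary profile for the same m and T. Then lim_{t → T⁻} sup_{r ≥ 0} | u(r,t) / ( (1 − t/T)^{1/(1−m)} V(r)^{1/m} ) − 1 | = 0 (uniform convergence in relative error). -/

import Mathlib

open MeasureTheory Set Filter Topology

/-- Membership in the radial energy space `H¹_rad` on hyperbolic space `ℍ^N`:
`v` is locally absolutely continuous on `(0,∞)` (expressed via the fundamental theorem
of calculus for its a.e. derivative) and both `v` and `v'` are square-integrable with
respect to the weight `(sinh s)^(N-1)`. -/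
def MemH1rad (N : ℕ) (v : ℝ → ℝ) : Prop :=
  (∀ a b : ℝ, 0 < a → a ≤ b → v b - v a = ∫ s in a..b, deriv v s) ∧
  MeasureTheory.IntegrableOn (fun s => (v s) ^ 2 * Real.sinh s ^ (N - 1)) (Set.Ioi 0) ∧
  MeasureTheory.IntegrableOn (fun s => (deriv v s) ^ 2 * Real.sinh s ^ (N - 1)) (Set.Ioi 0)

/-- The squared `H¹` norm `‖v‖_2² + ‖v'‖_2²` with weight `(sinh s)^(N-1)`. -/
noncomputable def H1normSq (N : ℕ) (v : ℝ → ℝ) : ℝ :=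
  (∫ s in Set.Ioi (0:ℝ), (v s) ^ 2 * Real.sinh s ^ (N - 1)) +
  (∫ s in Set.Ioi (0:ℝ), (deriv v s) ^ 2 * Real.sinh s ^ (N - 1))

/-- A radial energy solution of the fast diffusion equation `u_t = Δ(u^m)` on `ℍ^N`,
with exponent `m`, extinction time `T` (initial datum `u(·,0)`). -/
structure IsRadialEnergySolution (N : ℕ) (m T : ℝ) (u : ℝ → ℝ → ℝ) : Prop where
  continuousOn : ContinuousOn (fun p : ℝ × ℝ => u p.1 p.2) (Set.Ici 0 ×ˢ Set.Icc 0 T)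
  nonneg : ∀ r ∈ Set.Ici (0:ℝ), ∀ t ∈ Set.Icc (0:ℝ) T, 0 ≤ u r t
  smooth : ContDiffOn ℝ (⊤ : ℕ∞) (fun p : ℝ × ℝ => u p.1 p.2) (Set.Ici 0 ×ˢ Set.Ioo 0 T)
  pos : ∀ r ∈ Set.Ici (0:ℝ), ∀ t ∈ Set.Ioo (0:ℝ) T, 0 < u r t
  pde : ∀ r > (0:ℝ), ∀ t ∈ Set.Ioo (0:ℝ) T,
    deriv (fun τ => u r τ) t
      = deriv (deriv (fun ρ => u ρ t ^ m)) r
        + ((N : ℝ) - 1) * (Real.cosh r / Real.sinh r) * deriv (fun ρ => u ρ t ^ m) r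
  neumann : ∀ t ∈ Set.Ioo (0:ℝ) T, deriv (fun ρ => u ρ t ^ m) 0 = 0
  extinction : ∀ r ∈ Set.Ici (0:ℝ), u r T = 0
  energy : ∀ t ∈ Set.Ioo (0:ℝ) T, MemH1rad N (fun ρ => u ρ t ^ m)
  energy_bdd : ∀ ε ∈ Set.Ioo (0:ℝ) T, ∃ C : ℝ, ∀ t ∈ Set.Ico ε T,
    H1normSq N (fun ρ => u ρ t ^ m) ≤ C
  init_bdd : ∃ M : ℝ, ∀ r ∈ Set.Ici (0:ℝ), u r 0 ≤ M
  init_nonzero : ∃ r ∈ Set.Ici (0:ℝ), u r 0 ≠ 0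
  init_energy : MemH1rad N (fun ρ => u ρ 0 ^ m)

/-- A stationary profile for the fast diffusion equation: a smooth positive radial
energy solution of `-ΔV = V^(1/m)/((1-m)T)` on `ℍ^N`, decaying like `e^{-(N-1)r}`
together with all of its derivatives. -/
structure IsStationaryProfile (N : ℕ) (m T : ℝ) (V : ℝ → ℝ) : Prop where
  smooth : ContDiffOn ℝ (⊤ : ℕ∞) V (Set.Ici 0)
  pos : ∀ r ∈ Set.Ici (0:ℝ), 0 < V r
  deriv_zero : deriv V 0 = 0
  mem : MemH1rad N V
  ode : ∀ r > (0:ℝ),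
    deriv (deriv V) r + ((N : ℝ) - 1) * (Real.cosh r / Real.sinh r) * deriv V r
      + V r ^ (1 / m) / ((1 - m) * T) = 0
  asymp : ∃ l > (0:ℝ), ∀ k : ℕ,
    Filter.Tendsto (fun r => Real.exp (((N : ℝ) - 1) * r) * iteratedDeriv k V r)
      Filter.atTop (nhds ((-1 : ℝ) ^ k * ((N : ℝ) - 1) ^ k * l))

namespace FDE
open Real
set_option linter.all false
noncomputable def S (n : ℕ) (r : ℝ) : ℝ := sinh r ^ n
noncomputable def Mf (n : ℕ) (f : ℝ → ℝ) (r : ℝ) : ℝ := ∫ ρ in (0:ℝ)..r, S n ρ * f ρ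
lemma S_pos (n : ℕ) {r : ℝ} (hr : 0 < r) : 0 < S n r := pow_pos (sinh_pos_iff.2 hr) n
lemma S_nonneg (n : ℕ) {r : ℝ} (hr : 0 ≤ r) : 0 ≤ S n r := pow_nonneg (sinh_nonneg_iff.2 hr) n
lemma S_cont (n : ℕ) : Continuous (S n) := by unfold S; fun_prop
lemma S_zero {n : ℕ} (hn : 1 ≤ n) : S n 0 = 0 := by
  simp [S]; omega
lemma S_mono (n : ℕ) {r s : ℝ} (hr : 0 ≤ r) (hrs : r ≤ s) : S n r ≤ S n s :=
  pow_le_pow_left₀ (sinh_nonneg_iff.2 hr) (sinh_le_sinh.2 hrs) n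
lemma S_le_exp (n : ℕ) {r : ℝ} (hr : 0 ≤ r) : S n r ≤ exp (n * r) := by
  have h : sinh r ≤ exp r := by
    rw [sinh_eq]; have := exp_pos r; have := exp_pos (-r); linarith
  calc S n r ≤ exp r ^ n := pow_le_pow_left₀ (sinh_nonneg_iff.2 hr) h n
    _ = _ := by rw [← exp_nat_mul]
lemma exp_le_S (n : ℕ) {r : ℝ} (hr : 1 ≤ r) : exp (n * r) ≤ 4 ^ n * S n r := by
  have h : exp r ≤ 4 * sinh r := by
    rw [sinh_eq]
    have h1 : exp (-r) ≤ 1 := by rw [exp_le_one_iff]; linarith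
    have h2 : r + 1 ≤ exp r := add_one_le_exp r
    linarith
  calc exp (n * r) = exp r ^ n := by rw [← exp_nat_mul]
    _ ≤ (4 * sinh r) ^ n := pow_le_pow_left₀ (exp_pos r).le h n
    _ = _ := by rw [mul_pow]; rfl
lemma Mf_cont_int {n : ℕ} {f : ℝ → ℝ} (hf : Continuous f) : Continuous (fun ρ => S n ρ * f ρ) :=
  (S_cont n).mul hf
lemma Mf_hasDerivAt {n : ℕ} {f : ℝ → ℝ} (hf : Continuous f) (r : ℝ) :
    HasDerivAt (Mf n f) (S n r * f r) r :=
  intervalIntegral.integral_hasDerivAt_right ((Mf_cont_int hf).intervalIntegrable _ _)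
    ((Mf_cont_int hf).stronglyMeasurableAtFilter _ _) (Mf_cont_int hf).continuousAt
lemma Mf_cont {n : ℕ} {f : ℝ → ℝ} (hf : Continuous f) : Continuous (Mf n f) :=
  continuous_iff_continuousAt.2 fun r => (Mf_hasDerivAt hf r).continuousAt
@[simp] lemma Mf_zero (n : ℕ) (f : ℝ → ℝ) : Mf n f 0 = 0 := by simp [Mf]
lemma Mf_sub {n : ℕ} {f h : ℝ → ℝ} (hf : Continuous f) (hh : Continuous h) (r : ℝ) :
    Mf n f r - Mf n h r = Mf n (fun x => f x - h x) r := by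
  unfold Mf
  rw [← intervalIntegral.integral_sub ((Mf_cont_int hf).intervalIntegrable _ _)
    ((Mf_cont_int hh).intervalIntegrable _ _)]
  congr 1; ext x; ring
lemma Mf_const_mul (n : ℕ) (f : ℝ → ℝ) (c r : ℝ) :
    Mf n (fun x => c * f x) r = c * Mf n f r := by
  unfold Mf
  rw [← intervalIntegral.integral_const_mul]
  congr 1; ext x; ring
lemma Mf_abs_le {n : ℕ} {f : ℝ → ℝ} (hf : Continuous f) {r : ℝ} (hr : 0 ≤ r) :
    |Mf n f r| ≤ S n r * ∫ ρ in (0:ℝ)..r, |f ρ| := by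
  unfold Mf
  rw [← intervalIntegral.integral_const_mul]
  refine (intervalIntegral.abs_integral_le_integral_abs hr).trans ?_
  refine intervalIntegral.integral_mono_on hr ((Mf_cont_int hf).abs.intervalIntegrable _ _)
    ((continuous_const.mul hf.abs).intervalIntegrable _ _) fun x hx => ?_
  rw [abs_mul, abs_of_nonneg (S_nonneg n hx.1)]
  exact mul_le_mul_of_nonneg_right (S_mono n hx.1 hx.2) (abs_nonneg _)
lemma Mf_abs_le' {n : ℕ} {f : ℝ → ℝ} (hf : Continuous f) {r C : ℝ} (hr : 0 ≤ r)
    (hC : ∀ x ∈ Icc 0 r, |f x| ≤ C) : |Mf n f r| ≤ C * r * S n r := by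
  refine (Mf_abs_le hf hr).trans ?_
  have : ∫ ρ in (0:ℝ)..r, |f ρ| ≤ ∫ ρ in (0:ℝ)..r, C :=
    intervalIntegral.integral_mono_on hr (hf.abs.intervalIntegrable _ _)
      (continuous_const.intervalIntegrable _ _) hC
  simp at this
  nlinarith [S_nonneg n hr]
lemma Mf_mono_fun {n : ℕ} {f h : ℝ → ℝ} (hf : Continuous f) (hh : Continuous h) {r : ℝ}
    (hr : 0 ≤ r) (H : ∀ x ∈ Icc 0 r, f x ≤ h x) : Mf n f r ≤ Mf n h r :=
  intervalIntegral.integral_mono_on hr ((Mf_cont_int hf).intervalIntegrable _ _)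
    ((Mf_cont_int hh).intervalIntegrable _ _)
    fun x hx => mul_le_mul_of_nonneg_left (H x hx) (S_nonneg n hx.1)
lemma Mf_nonneg {n : ℕ} {f : ℝ → ℝ} {r : ℝ} (hr : 0 ≤ r) (H : ∀ x ∈ Icc 0 r, 0 ≤ f x) :
    0 ≤ Mf n f r :=
  intervalIntegral.integral_nonneg hr fun x hx => mul_nonneg (S_nonneg n hx.1) (H x hx)
lemma Mf_add {n : ℕ} {f : ℝ → ℝ} (hf : Continuous f) (r s : ℝ) :
    Mf n f s = Mf n f r + ∫ ρ in r..s, S n ρ * f ρ := by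
  unfold Mf
  rw [intervalIntegral.integral_add_adjacent_intervals] <;>
    exact (Mf_cont_int hf).intervalIntegrable _ _
lemma Mf_mono {n : ℕ} {f : ℝ → ℝ} (hf : Continuous f) {r s : ℝ} (hr : 0 ≤ r) (hrs : r ≤ s)
    (H : ∀ x ∈ Icc r s, 0 ≤ f x) : Mf n f r ≤ Mf n f s := by
  rw [Mf_add hf r s]
  have := intervalIntegral.integral_nonneg (f := fun ρ => S n ρ * f ρ) (μ := volume) hrs
    fun x hx => mul_nonneg (S_nonneg n (hr.trans hx.1)) (H x hx)
  linarith
lemma Mf_pos {n : ℕ} {f : ℝ → ℝ} (hf : Continuous f) {r : ℝ} (hr : 0 < r)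
    (H : ∀ x ∈ Icc 0 r, 0 < f x) : 0 < Mf n f r :=
  intervalIntegral.intervalIntegral_pos_of_pos_on ((Mf_cont_int hf).intervalIntegrable _ _)
    (fun x hx => mul_pos (S_pos n hx.1) (H x ⟨hx.1.le, hx.2.le⟩)) hr
lemma Mf_div_contOn {n : ℕ} (hn : 1 ≤ n) {f : ℝ → ℝ} (hf : Continuous f) :
    ContinuousOn (fun r => Mf n f r / S n r) (Ici 0) := by
  intro r hr
  rcases eq_or_lt_of_le (show (0:ℝ) ≤ r from hr) with h | h
  · subst h
    obtain ⟨C, hC⟩ := isCompact_Icc.exists_bound_of_continuousOn (s := Icc (0:ℝ) 1) hf.continuousOn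
    have hC0 : 0 ≤ C := (norm_nonneg _).trans (hC 0 (by simp))
    have : Tendsto (fun r => Mf n f r / S n r) (𝓝[Ici 0] 0) (𝓝 0) := by
      refine squeeze_zero_norm' (a := fun r => C * r) ?_ ?_
      · have : Icc (0:ℝ) 1 ∈ 𝓝[Ici 0] (0:ℝ) := by
          rw [← Ici_inter_Iic]; exact inter_mem self_mem_nhdsWithin
            (mem_nhdsWithin_of_mem_nhds (Iic_mem_nhds one_pos))
        filter_upwards [this] with x hx
        rcases eq_or_lt_of_le hx.1 with h | h
        · subst h; simp
        · rw [norm_eq_abs, abs_div, abs_of_pos (S_pos n h), div_le_iff₀ (S_pos n h)]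
          exact Mf_abs_le' hf hx.1 fun y hy => hC y ⟨hy.1, hy.2.trans hx.2⟩
      · have : Tendsto (fun r : ℝ => C * r) (𝓝 0) (𝓝 (C * 0)) := by
          apply Continuous.tendsto; fun_prop
        rw [mul_zero] at this
        exact this.mono_left nhdsWithin_le_nhds
    show Tendsto _ _ _
    simpa using this
  · exact (((Mf_cont hf).continuousAt).div (S_cont n).continuousAt (S_pos n h).ne').continuousWithinAt
lemma Mf_div_int {n : ℕ} (hn : 1 ≤ n) {f : ℝ → ℝ} (hf : Continuous f) {x y : ℝ} (hx : 0 ≤ x)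
    (hy : 0 ≤ y) : IntervalIntegrable (fun r => Mf n f r / S n r) volume x y :=
  ((Mf_div_contOn hn hf).mono (by
    intro z hz; have := (le_inf hx hy).trans hz.1; exact this)).intervalIntegrable
noncomputable def PE (n : ℕ) (p c : ℝ) (v d : ℝ → ℝ) (r : ℝ) : ℝ :=
  sinh r ^ (2 * n * (p + 1) / (p + 3) - 2) *
    (sinh r ^ 2 * (d r ^ 2 / 2 + c * (v r ^ p * v r) / (p + 1))
      + 2 * n / (p + 3) * sinh r * cosh r * v r * d r
      + 2 * n / (p + 3) / 2 * ((n - 2 * n * (p + 1) / (p + 3)) * sinh r ^ 2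
        + (n + 1 - 2 * n * (p + 1) / (p + 3))) * v r ^ 2)
noncomputable def ph (n : ℕ) (p : ℝ) (r : ℝ) : ℝ :=
  (n - 2 * n * (p + 1) / (p + 3)) * (2 * n * (p + 1) / (p + 3)) * sinh r ^ 2
   + (n + 1 - 2 * n * (p + 1) / (p + 3)) * (2 * n * (p + 1) / (p + 3) - 2)
lemma PE_deriv {n : ℕ} {p c : ℝ} (hp : 1 < p) {v d : ℝ → ℝ} {r : ℝ} (hr : 0 < r)
    (hv : HasDerivAt v (d r) r) (hvp : 0 < v r)
    (hd : HasDerivAt d (-(n * (cosh r / sinh r) * d r) - c * v r ^ p) r) :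
    HasDerivAt (PE n p c v d)
      (n / (p + 3) * sinh r ^ (2 * n * (p + 1) / (p + 3) - 2) *
        (cosh r / sinh r) * ph n p r * v r ^ 2) r := by
  have hs : 0 < sinh r := sinh_pos_iff.2 hr
  have hS := hasDerivAt_sinh r
  have hK := hasDerivAt_cosh r
  set σ := 2 * n * (p + 1) / (p + 3) with hσ
  have hx := hS.rpow_const (p := σ - 2) (Or.inl hs.ne')
  have hvp' := hv.rpow_const (p := p) (Or.inl hvp.ne')
  have e1 : sinh r ^ (σ - 2 - 1) = sinh r ^ (σ - 2) / sinh r := by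
    rw [rpow_sub_one hs.ne']
  have e2 : v r ^ (p - 1) = v r ^ p / v r := by rw [rpow_sub_one hvp.ne']
  rw [e1] at hx
  rw [e2] at hvp'
  have hk : cosh r ^ 2 = sinh r ^ 2 + 1 := cosh_sq r
  have H := hx.mul ((((hS.pow 2).mul (((hd.pow 2).div_const 2).add
    (((hvp'.mul hv).const_mul c).div_const (p + 1)))).add
    (((((hS.const_mul (2 * n / (p + 3))).mul hK).mul hv).mul hd))).add
    ((((((hS.pow 2).const_mul (n - σ)).add_const (n + 1 - σ)).const_mul
      (2 * n / (p + 3) / 2)).mul (hv.pow 2))))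
  refine (H.congr_deriv ?_).congr_of_eventuallyEq ?_
  · have hp3 : p + 3 ≠ 0 := by linarith
    have hp1 : p + 1 ≠ 0 := by linarith
    simp only [ph, ← hσ, Pi.mul_apply, Pi.pow_apply, Pi.add_apply]
    generalize sinh r ^ (σ - 2) = x
    generalize v r ^ p = y
    rw [hσ]
    generalize sinh r = s at *
    generalize cosh r = k at *
    generalize v r = V at *
    generalize d r = D at *
    have hs0 := hs.ne'
    have hV0 := hvp.ne'
    field_simp
    have h3 : k ^ 3 = k * (s ^ 2 + 1) := by rw [← hk]; ring
    ring_nf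
    simp only [hk, h3]
    ring
  · filter_upwards with x
    simp only [PE, ← hσ, Pi.mul_apply, Pi.pow_apply, Pi.add_apply]
structure Prof (n : ℕ) (p c : ℝ) (v d : ℝ → ℝ) : Prop where
  hv : ∀ r > 0, HasDerivAt v (d r) r
  hd : ∀ r > 0, HasDerivAt d (-(n * (cosh r / sinh r) * d r) - c * v r ^ p) r
  pos : ∀ r ≥ 0, 0 < v r
  cont : ContinuousOn v (Ici 0)
  near : ∃ C, ∀ r ∈ Ioc (0:ℝ) 1, |d r| ≤ C * r
  inf : ∃ C, ∀ r ≥ 1, v r ≤ C * exp (-(n * r)) ∧ |d r| ≤ C * exp (-(n * r))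
lemma Prof.near2 {n : ℕ} {p c : ℝ} {v d : ℝ → ℝ} (h : Prof n p c v d) :
    ∃ C, 0 ≤ C ∧ ∀ r ∈ Ioc (0:ℝ) 1, |d r| ≤ C * r ∧ |v r - v 0| ≤ C * r ^ 2 ∧ v r ≤ C ∧ v 0 ≤ C := by
  obtain ⟨C, hC⟩ := h.near
  obtain ⟨K, hK⟩ := isCompact_Icc.exists_bound_of_continuousOn (s := Icc (0:ℝ) 1)
    (h.cont.mono Icc_subset_Ici_self)
  have hC0 : 0 ≤ C := by
    have := hC 1 (by simp); have := abs_nonneg (d 1); linarith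
  refine ⟨max C K, le_max_of_le_left hC0, fun r hr => ?_⟩
  have hb : ∀ x ∈ Icc (0:ℝ) 1, v x ≤ max C K := fun x hx =>
    (le_abs_self _).trans ((hK x hx).trans (le_max_right _ _))
  refine ⟨(hC r hr).trans (mul_le_mul_of_nonneg_right (le_max_left _ _) hr.1.le), ?_,
    hb r ⟨hr.1.le, hr.2⟩, hb 0 (by simp)⟩
  obtain ⟨x, hx, hxe⟩ := exists_hasDerivAt_eq_slope v d hr.1
    (h.cont.mono Icc_subset_Ici_self) (fun x hx => h.hv x hx.1)
  have h1 : v r - v 0 = d x * r := by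
    rw [hxe]; field_simp [hr.1.ne']; rw [sub_zero]
  rw [h1, abs_mul, abs_of_pos hr.1]
  have := hC x ⟨hx.1, hx.2.le.trans hr.2⟩
  have hr0 := hr.1
  calc |d x| * r ≤ (C * x) * r := by gcongr
    _ ≤ (max C K * r) * r := by
      have := hx.2.le
      have : C ≤ max C K := le_max_left _ _
      have := hx.1.le
      gcongr
    _ = _ := by ring
lemma PE_near {n : ℕ} {p c : ℝ} (hp : 1 < p) (hc : 0 < c) {v d : ℝ → ℝ} (h : Prof n p c v d) :
    ∃ C, ∀ r ∈ Ioc (0:ℝ) 1, |PE n p c v d r - sinh r ^ (2 * n * (p + 1) / (p + 3) - 2) *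
      (2 * n / (p + 3) / 2 * ((n - 2 * n * (p + 1) / (p + 3)) * sinh r ^ 2
        + (n + 1 - 2 * n * (p + 1) / (p + 3))) * v r ^ 2)| ≤
      C * sinh r ^ (2 * n * (p + 1) / (p + 3)) := by
  obtain ⟨C, hC0, hC⟩ := h.near2
  refine ⟨C ^ 2 / 2 + c * (C ^ p * C) / (p + 1) + 2 * n / (p + 3) * cosh 1 * C * C, fun r hr => ?_⟩
  have hs : 0 < sinh r := sinh_pos_iff.2 hr.1
  have hsr : r ≤ sinh r := self_le_sinh_iff.2 hr.1.le
  set σ := 2 * n * (p + 1) / (p + 3) with hσ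
  have hx : sinh r ^ σ = sinh r ^ (σ - 2) * sinh r ^ 2 := by
    rw [← rpow_natCast, ← rpow_add hs]; norm_num
  have hx0 : 0 < sinh r ^ (σ - 2) := rpow_pos_of_pos hs _
  have hk : cosh r ≤ cosh 1 := cosh_le_cosh.2 (by
    rw [abs_of_pos hr.1, abs_one]; exact hr.2)
  have hk0 := cosh_pos r
  have e : PE n p c v d r - sinh r ^ (σ - 2) *
      (2 * n / (p + 3) / 2 * ((n - σ) * sinh r ^ 2
        + (n + 1 - σ)) * v r ^ 2) = sinh r ^ (σ - 2) *
    (sinh r ^ 2 * (d r ^ 2 / 2 + c * (v r ^ p * v r) / (p + 1))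
      + 2 * n / (p + 3) * sinh r * cosh r * v r * d r) := by
    simp only [PE, ← hσ]; ring
  rw [e, hx, abs_mul, abs_of_pos hx0]
  obtain ⟨h1, -, h3, -⟩ := hC r hr
  have hv0 := h.pos r hr.1.le
  have hd' : |d r| ≤ C * sinh r := h1.trans (by gcongr)
  have hd1 : |d r| ≤ C := h1.trans (mul_le_of_le_one_right (by assumption) hr.2)
  have hvp : v r ^ p ≤ C ^ p := rpow_le_rpow hv0.le h3 (by linarith)
  have hvp0 : 0 ≤ v r ^ p := (rpow_pos_of_pos hv0 _).le
  have hp1 : 0 < p + 1 := by linarith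
  have hp3 : 0 < p + 3 := by linarith
  have t1 : d r ^ 2 / 2 ≤ C ^ 2 / 2 := by
    have := sq_le_sq' (by linarith [(abs_le.1 hd1).1]) (abs_le.1 hd1).2; linarith
  have t2 : c * (v r ^ p * v r) / (p + 1) ≤ c * (C ^ p * C) / (p + 1) := by gcongr
  have t20 : 0 ≤ c * (v r ^ p * v r) / (p + 1) := by positivity
  have t3 : |2 * n / (p + 3) * sinh r * cosh r * v r * d r| ≤
     2 * n / (p + 3) * sinh r * cosh 1 * C * (C * sinh r) := by
    rw [abs_mul, abs_of_nonneg (show 0 ≤ 2 * n / (p + 3) * sinh r * cosh r * v r by positivity)]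
    gcongr
  calc _ ≤ sinh r ^ (σ - 2) * (sinh r ^ 2 * (C ^ 2 / 2 + c * (C ^ p * C) / (p + 1)) +
      2 * n / (p + 3) * sinh r * cosh 1 * C * (C * sinh r)) := by
        gcongr
        refine (abs_add_le _ _).trans (add_le_add ?_ t3)
        rw [abs_of_nonneg (by positivity)]
        gcongr
    _ = _ := by ring
lemma PE_inf {n : ℕ} {p c : ℝ} (hn : 1 ≤ n) (hp : 1 < p) (hc : 0 < c) {v d : ℝ → ℝ} (h : Prof n p c v d) :
    Tendsto (PE n p c v d) atTop (𝓝 0) := by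
  obtain ⟨C, hC⟩ := h.inf
  have hC0 : 0 < C := by
    have h1 := (hC 1 le_rfl).1
    have h2 := h.pos 1 (by norm_num)
    have := exp_pos (-(n * 1 : ℝ))
    by_contra hcon
    linarith [mul_nonpos_of_nonpos_of_nonneg (not_lt.1 hcon) this.le]
  set σ := 2 * n * (p + 1) / (p + 3) with hσ
  have hp3 : 0 < p + 3 := by linarith
  have hn' : (1:ℝ) ≤ n := by exact_mod_cast hn
  have hσn : σ < 2 * n := by
    rw [hσ, div_lt_iff₀ hp3]; nlinarith
  have hσ0 : 0 < σ := by rw [hσ]; positivity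
  set K := C ^ 2 / 2 + c * (C ^ (p - 1) * C ^ 2) / (p + 1) + 2 * n / (p + 3) * 2 * C * C
    + 2 * n / (p + 3) / 2 * (|n - σ| + |n + 1 - σ|) * C ^ 2 with hK
  have hb : ∀ᶠ r in atTop, ‖PE n p c v d r‖ ≤ K * exp ((σ - 2 * n) * r) := by
    filter_upwards [eventually_ge_atTop 1] with r hr
    have hr0 : 0 < r := by linarith
    have hs : 0 < sinh r := sinh_pos_iff.2 hr0
    have hsr : r ≤ sinh r := self_le_sinh_iff.2 hr0.le
    have hs1 : 1 ≤ sinh r := hr.trans hsr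
    have hx : sinh r ^ σ = sinh r ^ (σ - 2) * sinh r ^ 2 := by
      rw [← rpow_natCast, ← rpow_add hs]; norm_num
    have hx0 : 0 < sinh r ^ (σ - 2) := rpow_pos_of_pos hs _
    have hk0 := cosh_pos r
    have hk : cosh r ≤ 2 * sinh r := by
      have := exp_le_one_iff.2 (by linarith : -r ≤ 0)
      linarith [cosh_sub_sinh r]
    have hse : sinh r ^ σ ≤ exp (σ * r) := by
      have : sinh r ≤ exp r := by
        have := S_le_exp 1 hr0.le
        simpa [S] using this
      calc _ ≤ exp r ^ σ := rpow_le_rpow hs.le this hσ0.le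
        _ = _ := by rw [← exp_mul, mul_comm]
    obtain ⟨h1, h2⟩ := hC r hr
    set e := exp (-(n * r)) with he
    have he0 : 0 < e := exp_pos _
    have he1 : e ≤ 1 := by rw [he, exp_le_one_iff, neg_nonpos]; positivity
    have hv0 := h.pos r hr0.le
    have hvC : v r ≤ C := h1.trans (mul_le_of_le_one_right hC0.le he1)
    have hvp : v r ^ p * v r ≤ C ^ (p - 1) * (C * e) ^ 2 := by
      have : v r ^ p * v r = v r ^ (p - 1) * v r ^ 2 := by
        rw [rpow_sub_one hv0.ne']; field_simp
      rw [this]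
      have : v r ^ (p - 1) ≤ C ^ (p - 1) := rpow_le_rpow hv0.le hvC (by linarith)
      gcongr
    have hvp0 : 0 ≤ v r ^ p := (rpow_pos_of_pos hv0 _).le
    have hp1 : 0 < p + 1 := by linarith
    have t1 : d r ^ 2 / 2 ≤ (C * e) ^ 2 / 2 := by
      have := sq_le_sq' (by linarith [(abs_le.1 h2).1]) (abs_le.1 h2).2; linarith
    have t2 : c * (v r ^ p * v r) / (p + 1) ≤ c * (C ^ (p - 1) * (C * e) ^ 2) / (p + 1) := by gcongr
    have t20 : 0 ≤ c * (v r ^ p * v r) / (p + 1) := by positivity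
    have t3 : |2 * n / (p + 3) * sinh r * cosh r * v r * d r| ≤
       2 * n / (p + 3) * sinh r * (2 * sinh r) * (C * e) * (C * e) := by
      rw [abs_mul, abs_of_nonneg (show 0 ≤ 2 * n / (p + 3) * sinh r * cosh r * v r by positivity)]
      gcongr
    have t4 : |2 * n / (p + 3) / 2 * ((n - σ) * sinh r ^ 2 + (n + 1 - σ)) * v r ^ 2| ≤
       2 * n / (p + 3) / 2 * ((|n - σ| + |n + 1 - σ|) * sinh r ^ 2) * (C * e) ^ 2 := by
      rw [abs_mul, abs_mul, abs_of_nonneg (show 0 ≤ 2 * n / (p + 3) / 2 by positivity), abs_of_nonneg (sq_nonneg (v r))]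
      have : |(n - σ) * sinh r ^ 2 + (n + 1 - σ)| ≤ (|n - σ| + |n + 1 - σ|) * sinh r ^ 2 := by
        refine (abs_add_le _ _).trans ?_
        rw [abs_mul, abs_of_nonneg (sq_nonneg (sinh r))]
        have h1s : 1 ≤ sinh r ^ 2 := one_le_pow₀ hs1
        linarith [mul_le_mul_of_nonneg_left h1s (abs_nonneg (n + 1 - σ))]
      gcongr
    have hKn : 0 ≤ K := by rw [hK]; positivity
    calc ‖PE n p c v d r‖ ≤ sinh r ^ (σ - 2) * (sinh r ^ 2 * ((C * e) ^ 2 / 2 + c * (C ^ (p - 1) * (C * e) ^ 2) / (p + 1)) +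
        2 * n / (p + 3) * sinh r * (2 * sinh r) * (C * e) * (C * e) +
        2 * n / (p + 3) / 2 * ((|n - σ| + |n + 1 - σ|) * sinh r ^ 2) * (C * e) ^ 2) := by
          rw [norm_eq_abs, PE, ← hσ, abs_mul, abs_of_pos hx0]
          gcongr
          refine (abs_add_le _ _).trans (add_le_add ((abs_add_le _ _).trans (add_le_add ?_ t3)) t4)
          rw [abs_of_nonneg (by positivity)]
          gcongr
      _ = K * (sinh r ^ σ * e ^ 2) := by rw [hx, hK]; ring
      _ ≤ K * (exp (σ * r) * e ^ 2) := by gcongr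
      _ = _ := by
        rw [he, ← exp_nat_mul, ← exp_add]; congr 2; push_cast; ring
  refine squeeze_zero_norm' hb ?_
  have : Tendsto (fun r : ℝ => exp ((σ - 2 * n) * r)) atTop (𝓝 0) :=
    tendsto_exp_atBot.comp (tendsto_id.const_mul_atTop_of_neg (by linarith))
  simpa using this.const_mul K
lemma PE_zero {n : ℕ} {p c : ℝ} (hn : 1 ≤ n) (hp : 1 < p) (hc : 0 < c) {v d v' d' : ℝ → ℝ}
    (h : Prof n p c v d) (h' : Prof n p c v' d') {γ : ℝ}
    (hγ : 2 < 2 * n * (p + 1) / (p + 3) ∨ γ = v' 0 / v 0) :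
    Tendsto (fun r => PE n p c v' d' r - γ ^ 2 * PE n p c v d r) (𝓝[>] 0) (𝓝 0) := by
  obtain ⟨C, hC⟩ := PE_near hp hc h
  obtain ⟨C', hC'⟩ := PE_near hp hc h'
  obtain ⟨B, hB0, hB⟩ := h.near2
  obtain ⟨B', hB0', hB'⟩ := h'.near2
  have hp3 : 0 < p + 3 := by linarith
  have hn' : (1:ℝ) ≤ n := by exact_mod_cast hn
  set σ := 2 * n * (p + 1) / (p + 3) with hσ
  have hσ0 : 0 < σ := by rw [hσ]; positivity
  have hsinh : Tendsto sinh (𝓝[>] 0) (𝓝 0) := by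
    have := continuous_sinh.tendsto 0
    rw [sinh_zero] at this
    exact this.mono_left nhdsWithin_le_nhds
  have hpow : ∀ τ : ℝ, 0 < τ → Tendsto (fun r => sinh r ^ τ) (𝓝[>] 0) (𝓝 0) := fun τ hτ => by
    have := hsinh.rpow_const (p := τ) (Or.inr hτ.le)
    rwa [zero_rpow hτ.ne'] at this
  have hmem : Ioc (0:ℝ) 1 ∈ 𝓝[>] (0:ℝ) := Ioc_mem_nhdsGT one_pos
  set q : ℝ → ℝ := fun r => 2 * n / (p + 3) / 2 * ((n - σ) * sinh r ^ 2 + (n + 1 - σ)) with hq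
  have hqb : ∀ r ∈ Ioc (0:ℝ) 1, |q r| ≤ 2 * n / (p + 3) / 2 * (|n - σ| * sinh 1 ^ 2 + |n + 1 - σ|) := by
    intro r hr
    have hs : 0 < sinh r := sinh_pos_iff.2 hr.1
    have : sinh r ≤ sinh 1 := sinh_le_sinh.2 hr.2
    rw [hq, abs_mul, abs_of_nonneg (show 0 ≤ 2 * n / (p + 3) / 2 by positivity)]
    gcongr
    refine (abs_add_le _ _).trans ?_
    rw [abs_mul, abs_of_nonneg (sq_nonneg (sinh r))]
    gcongr
  set Q := 2 * n / (p + 3) / 2 * (|n - σ| * sinh 1 ^ 2 + |n + 1 - σ|) with hQ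
  have hQ0 : 0 ≤ Q := by rw [hQ]; positivity
  have hmain : ∃ D τ : ℝ, 0 < τ ∧ ∀ r ∈ Ioc (0:ℝ) 1,
      |sinh r ^ (σ - 2) * (q r * (v' r ^ 2 - γ ^ 2 * v r ^ 2))| ≤ D * sinh r ^ τ := by
    rcases hγ with hγ | hγ
    · refine ⟨Q * (B' ^ 2 + γ ^ 2 * B ^ 2), σ - 2, by linarith, fun r hr => ?_⟩
      have hs : 0 < sinh r := sinh_pos_iff.2 hr.1
      have hx0 : 0 < sinh r ^ (σ - 2) := rpow_pos_of_pos hs _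
      rw [abs_mul, abs_of_pos hx0, mul_comm, abs_mul]
      have := h.pos r hr.1.le
      have := h'.pos r hr.1.le
      have h1 := (hB r hr).2.2.1
      have h2 := (hB' r hr).2.2.1
      have : |v' r ^ 2 - γ ^ 2 * v r ^ 2| ≤ B' ^ 2 + γ ^ 2 * B ^ 2 := by
        refine (abs_sub _ _).trans ?_
        rw [abs_of_nonneg (by positivity), abs_of_nonneg (by positivity)]
        gcongr
      have := hqb r hr
      gcongr
    · have hv0 := h.pos 0 le_rfl
      have hv0' := h'.pos 0 le_rfl
      have hγ0 : 0 ≤ γ := by rw [hγ]; positivity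
      refine ⟨Q * ((B' + γ * B) * (B' + γ * B)), σ, hσ0, fun r hr => ?_⟩
      have hs : 0 < sinh r := sinh_pos_iff.2 hr.1
      have hsr : r ≤ sinh r := self_le_sinh_iff.2 hr.1.le
      have hx0 : 0 < sinh r ^ (σ - 2) := rpow_pos_of_pos hs _
      have hx : sinh r ^ σ = sinh r ^ (σ - 2) * sinh r ^ 2 := by
        rw [← rpow_natCast, ← rpow_add hs]; norm_num
      rw [abs_mul, abs_of_pos hx0, hx, abs_mul]
      obtain ⟨-, a1, a2, -⟩ := hB r hr
      obtain ⟨-, b1, b2, -⟩ := hB' r hr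
      have := h.pos r hr.1.le
      have := h'.pos r hr.1.le
      have e : v' r ^ 2 - γ ^ 2 * v r ^ 2 = ((v' r - v' 0) - γ * (v r - v 0)) * (v' r + γ * v r) := by
        have : γ * v 0 = v' 0 := by rw [hγ]; field_simp
        linear_combination (-(v' r + γ * v r)) * this
      have h1 : |v' r ^ 2 - γ ^ 2 * v r ^ 2| ≤ (B' + γ * B) * sinh r ^ 2 * (B' + γ * B) := by
        rw [e, abs_mul, abs_of_pos (show 0 < v' r + γ * v r by positivity)]
        have : |v' r - v' 0 - γ * (v r - v 0)| ≤ (B' + γ * B) * sinh r ^ 2 := by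
          refine (abs_sub _ _).trans ?_
          rw [abs_mul, abs_of_nonneg hγ0]
          have : r ^ 2 ≤ sinh r ^ 2 := pow_le_pow_left₀ hr.1.le hsr 2
          calc _ ≤ B' * r ^ 2 + γ * (B * r ^ 2) := by gcongr
            _ = (B' + γ * B) * r ^ 2 := by ring
            _ ≤ _ := by gcongr
        gcongr
      have := hqb r hr
      calc _ ≤ sinh r ^ (σ - 2) * (Q * ((B' + γ * B) * sinh r ^ 2 * (B' + γ * B))) := by gcongr
        _ = _ := by ring
  obtain ⟨D, τ, hτ, hD⟩ := hmain
  refine squeeze_zero_norm' (a := fun r => C' * sinh r ^ σ + γ ^ 2 * (C * sinh r ^ σ) + D * sinh r ^ τ) ?_ ?_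
  · filter_upwards [hmem] with r hr
    have e : PE n p c v' d' r - γ ^ 2 * PE n p c v d r =
      (PE n p c v' d' r - sinh r ^ (σ - 2) * (q r * v' r ^ 2)) -
      γ ^ 2 * (PE n p c v d r - sinh r ^ (σ - 2) * (q r * v r ^ 2)) +
      sinh r ^ (σ - 2) * (q r * (v' r ^ 2 - γ ^ 2 * v r ^ 2)) := by ring
    rw [e, norm_eq_abs]
    refine (abs_add_le _ _).trans (add_le_add ((abs_sub _ _).trans (add_le_add (hC' r hr) ?_)) (hD r hr))
    rw [abs_mul, abs_of_nonneg (sq_nonneg γ)]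
    exact mul_le_mul_of_nonneg_left (hC r hr) (sq_nonneg _)
  · have := (((hpow σ hσ0).const_mul C').add (((hpow σ hσ0).const_mul C).const_mul (γ ^ 2))).add
      ((hpow τ hτ).const_mul D)
    simpa using this
lemma Prof.dPE {n : ℕ} {p c : ℝ} (hp : 1 < p) {v d : ℝ → ℝ} (h : Prof n p c v d) {r : ℝ} (hr : 0 < r) :
    HasDerivAt (PE n p c v d)
      (n / (p + 3) * sinh r ^ (2 * n * (p + 1) / (p + 3) - 2) *
        (cosh r / sinh r) * ph n p r * v r ^ 2) r :=
  PE_deriv (n := n) (c := c) hp hr (h.hv r hr) (h.pos r hr.le) (h.hd r hr)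
lemma ph_struct {n : ℕ} {p : ℝ} (hn : 1 ≤ n) (hp : 1 < p) (hsub : ((n:ℝ) - 1) * p < n + 3) :
    ∃ s : ℝ, 0 ≤ s ∧ (∀ r, 0 < r → r < s → 0 ≤ ph n p r) ∧ (∀ r, s < r → ph n p r < 0) ∧
      (2 < 2 * n * (p + 1) / (p + 3) ∨ s = 0) := by
  have hn' : (1:ℝ) ≤ n := by exact_mod_cast hn
  have hp3 : 0 < p + 3 := by linarith
  have h1 : n - 2 * n * (p + 1) / (p + 3) < 0 := by
    rw [sub_neg, lt_div_iff₀ hp3]; nlinarith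
  have h2 : 0 < n + 1 - 2 * n * (p + 1) / (p + 3) := by
    rw [sub_pos, div_lt_iff₀ hp3]; nlinarith
  have h3 : 0 < 2 * n * (p + 1) / (p + 3) := by positivity
  unfold ph
  set σ := 2 * n * (p + 1) / (p + 3) with hσ
  rcases le_or_gt σ 2 with h | h
  · refine ⟨0, le_rfl, fun r h1 h2 => by linarith, fun r hr => ?_, Or.inr rfl⟩
    have hs : 0 < sinh r := sinh_pos_iff.2 hr
    have e1 : (n - σ) * σ * sinh r ^ 2 < 0 :=
      mul_neg_of_neg_of_pos (mul_neg_of_neg_of_pos h1 h3) (by positivity)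
    have e2 : (n + 1 - σ) * (σ - 2) ≤ 0 := mul_nonpos_of_nonneg_of_nonpos h2.le (by linarith)
    linarith
  · set q := (n + 1 - σ) * (σ - 2) / ((σ - n) * σ) with hq
    have hq0 : 0 < q := by
      apply div_pos (mul_pos h2 (by linarith)) (mul_pos (by linarith) h3)
    have e : ∀ x, (n - σ) * σ * x ^ 2 + (n + 1 - σ) * (σ - 2) = ((σ - n) * σ) * (q - x ^ 2) := by
      intro x
      have : (σ - n) * σ ≠ 0 := (mul_pos (by linarith) h3).ne'
      have : ((σ - n) * σ) * q = (n + 1 - σ) * (σ - 2) := by rw [hq]; exact mul_div_cancel₀ _ this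
      linear_combination -this
    have hc : 0 < (σ - n) * σ := mul_pos (by linarith) h3
    refine ⟨arsinh (√q), arsinh_nonneg_iff.2 (sqrt_nonneg _), fun r h1 h2 => ?_, fun r hr => ?_, Or.inl h⟩
    · rw [e]
      have : sinh r < √q := by
        rw [← sinh_arsinh (√q)]; exact sinh_lt_sinh.2 h2
      have h0 := sinh_pos_iff.2 h1
      have h5 := pow_le_pow_left₀ h0.le this.le 2
      rw [sq_sqrt hq0.le] at h5
      exact mul_nonneg hc.le (by linarith)
    · rw [e]
      have h4 : √q < sinh r := by
        rw [← sinh_arsinh (√q)]; exact sinh_lt_sinh.2 hr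
      have h5 := pow_lt_pow_left₀ h4 (sqrt_nonneg q) two_ne_zero
      rw [sq_sqrt hq0.le] at h5
      exact mul_neg_of_pos_of_neg hc (by linarith)
noncomputable def Wr (n : ℕ) (v d v' d' : ℝ → ℝ) (r : ℝ) : ℝ := S n r * (d' r * v r - v' r * d r)
lemma Wr_deriv {n : ℕ} {p c : ℝ} {v d v' d' : ℝ → ℝ} (h : Prof n p c v d) (h' : Prof n p c v' d')
    {r : ℝ} (hr : 0 < r) :
    HasDerivAt (Wr n v d v' d') (S n r * (c * (v r ^ p * v' r - v' r ^ p * v r))) r := by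
  have hs : 0 < sinh r := sinh_pos_iff.2 hr
  have hS : HasDerivAt (S n) (n * (cosh r / sinh r) * S n r) r := by
    have := (hasDerivAt_sinh r).pow n
    refine this.congr_deriv ?_
    unfold S
    rcases n with _ | k
    · simp
    · rw [pow_succ]; simp only [Nat.add_sub_cancel]; field_simp
  have := hS.mul (((h'.hd r hr).mul (h.hv r hr)).sub ((h'.hv r hr).mul (h.hd r hr)))
  refine this.congr_deriv ?_
  simp only [Pi.sub_apply, Pi.mul_apply]
  ring
lemma Wr_zero {n : ℕ} {p c : ℝ} (hn : 1 ≤ n) {v d v' d' : ℝ → ℝ} (h : Prof n p c v d) (h' : Prof n p c v' d') :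
    Tendsto (Wr n v d v' d') (𝓝[>] 0) (𝓝 0) := by
  obtain ⟨B, hB0, hB⟩ := h.near2
  obtain ⟨B', hB0', hB'⟩ := h'.near2
  have : Tendsto (fun r => S n r * (2 * B * B')) (𝓝[>] 0) (𝓝 0) := by
    have : Tendsto (fun r => S n r * (2 * B * B')) (𝓝 0) (𝓝 (S n 0 * (2 * B * B'))) :=
      ((S_cont n).mul continuous_const).tendsto 0
    rw [S_zero hn, zero_mul] at this
    exact this.mono_left nhdsWithin_le_nhds
  refine squeeze_zero_norm' ?_ this
  filter_upwards [Ioc_mem_nhdsGT (show (0:ℝ) < 1 by norm_num)] with r hr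
  obtain ⟨a1, -, a2, -⟩ := hB r hr
  obtain ⟨b1, -, b2, -⟩ := hB' r hr
  have p1 := h.pos r hr.1.le
  have p2 := h'.pos r hr.1.le
  have hr1 := hr.2
  have hr0 := hr.1
  unfold Wr
  rw [norm_mul, norm_of_nonneg (S_nonneg n hr0.le), norm_eq_abs]
  refine mul_le_mul_of_nonneg_left ?_ (S_nonneg n hr0.le)
  refine (abs_sub _ _).trans ?_
  rw [abs_mul, abs_mul, abs_of_pos p1, abs_of_pos p2]
  have q1 : |d r| ≤ B := a1.trans (by nlinarith)
  have q2 : |d' r| ≤ B' := b1.trans (by nlinarith)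
  calc |d' r| * v r + v' r * |d r| ≤ B' * B + B' * B := by gcongr
    _ = _ := by ring
lemma rho_deriv {n : ℕ} {p c : ℝ} {v d v' d' : ℝ → ℝ} (h : Prof n p c v d) (h' : Prof n p c v' d')
    {r : ℝ} (hr : 0 < r) :
    HasDerivAt (fun r => v' r / v r) (Wr n v d v' d' r / (S n r * v r ^ 2)) r := by
  refine ((h'.hv r hr).div (h.hv r hr) (h.pos r hr.le).ne').congr_deriv ?_
  have := h.pos r hr.le
  have := S_pos n hr
  unfold Wr
  field_simp
lemma rho_mono {n : ℕ} {p c : ℝ} {v d v' d' : ℝ → ℝ} (h : Prof n p c v d) (h' : Prof n p c v' d')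
    {R : ℝ} (hW : ∀ r, 0 < r → r < R → 0 < Wr n v d v' d' r) :
    StrictMonoOn (fun r => v' r / v r) (Icc 0 R) := by
  apply strictMonoOn_of_deriv_pos (convex_Icc 0 R)
  · exact (h'.cont.div h.cont (fun x hx => (h.pos x hx).ne')).mono Icc_subset_Ici_self
  · intro x hx
    rw [interior_Icc] at hx
    rw [(rho_deriv h h' hx.1).deriv]
    have := h.pos x hx.1.le
    have := S_pos n hx.1
    have := hW x hx.1 hx.2
    positivity
lemma F_deriv {n : ℕ} {p c : ℝ} (hp : 1 < p) {v d v' d' : ℝ → ℝ} (h : Prof n p c v d) (h' : Prof n p c v' d')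
    (γ : ℝ) {r : ℝ} (hr : 0 < r) :
    HasDerivAt (fun r => PE n p c v' d' r - γ ^ 2 * PE n p c v d r)
      (n / (p + 3) * sinh r ^ (2 * n * (p + 1) / (p + 3) - 2) *
        (cosh r / sinh r) * v r ^ 2 * (ph n p r * ((v' r / v r) ^ 2 - γ ^ 2))) r := by
  refine ((h'.dPE hp hr).sub ((h.dPE hp hr).const_mul (γ ^ 2))).congr_deriv ?_
  have := h.pos r hr.le
  field_simp
lemma Kpos {n : ℕ} {p c : ℝ} (hn : 1 ≤ n) (hp : 1 < p) {v d : ℝ → ℝ} (h : Prof n p c v d)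
    {r : ℝ} (hr : 0 < r) : 0 < n / (p + 3) * sinh r ^ (2 * n * (p + 1) / (p + 3) - 2) *
        (cosh r / sinh r) * v r ^ 2 := by
  have hs : 0 < sinh r := sinh_pos_iff.2 hr
  have := h.pos r hr.le
  have hn' : (1:ℝ) ≤ n := by exact_mod_cast hn
  have := cosh_pos r
  positivity
lemma F_anti {n : ℕ} {p c : ℝ} (hn : 1 ≤ n) (hp : 1 < p) {v d v' d' : ℝ → ℝ}
    (h : Prof n p c v d) (h' : Prof n p c v' d') {γ R : ℝ}
    (hs : ∀ r, 0 < r → r < R → ph n p r * ((v' r / v r) ^ 2 - γ ^ 2) ≤ 0) :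
    AntitoneOn (fun r => PE n p c v' d' r - γ ^ 2 * PE n p c v d r) (Ioc 0 R) := by
  apply antitoneOn_of_deriv_nonpos (convex_Ioc 0 R)
  · exact fun x hx => (F_deriv hp h h' γ hx.1).continuousAt.continuousWithinAt
  · intro x hx
    rw [interior_Ioc] at hx
    exact (F_deriv hp h h' γ hx.1).differentiableAt.differentiableWithinAt
  · intro x hx
    rw [interior_Ioc] at hx
    rw [(F_deriv hp h h' γ hx.1).deriv]
    exact mul_nonpos_of_nonneg_of_nonpos (Kpos hn hp h hx.1).le (hs x hx.1 hx.2)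
lemma F_nonpos {n : ℕ} {p c : ℝ} (hn : 1 ≤ n) (hp : 1 < p) (hc : 0 < c) {v d v' d' : ℝ → ℝ}
    (h : Prof n p c v d) (h' : Prof n p c v' d') {γ R : ℝ} (hR : 0 < R)
    (hγ : 2 < 2 * n * (p + 1) / (p + 3) ∨ γ = v' 0 / v 0)
    (hs : ∀ r, 0 < r → r < R → ph n p r * ((v' r / v r) ^ 2 - γ ^ 2) ≤ 0) :
    PE n p c v' d' R - γ ^ 2 * PE n p c v d R ≤ 0 := by
  refine ge_of_tendsto (PE_zero hn hp hc h h' hγ) ?_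
  filter_upwards [Ioc_mem_nhdsGT hR] with r hr
  exact F_anti hn hp h h' hs hr ⟨hR, le_rfl⟩ hr.2
lemma PE_nonneg {n : ℕ} {p c : ℝ} (hn : 1 ≤ n) (hp : 1 < p) (hc : 0 < c) {v d : ℝ → ℝ}
    (h : Prof n p c v d) {R : ℝ} (hR : 0 < R) (hs : ∀ r, R < r → ph n p r < 0) :
    0 ≤ PE n p c v d R := by
  have : AntitoneOn (PE n p c v d) (Ici R) := by
    apply antitoneOn_of_deriv_nonpos (convex_Ici R)
    · exact fun x hx => (h.dPE hp (hR.trans_le hx)).continuousAt.continuousWithinAt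
    · intro x hx
      rw [interior_Ici] at hx
      exact (h.dPE hp (hR.trans hx)).differentiableAt.differentiableWithinAt
    · intro x hx
      rw [interior_Ici] at hx
      rw [(h.dPE hp (hR.trans hx)).deriv]
      have k := Kpos hn hp h (hR.trans hx)
      have := hs x hx
      rw [mul_right_comm]
      exact mul_nonpos_of_nonneg_of_nonpos k.le this.le
  refine le_of_tendsto (PE_inf hn hp hc h) ?_
  filter_upwards [eventually_ge_atTop R] with r hr
  exact this (mem_Ici.2 le_rfl) hr hr
lemma uniq_lt {n : ℕ} {p c : ℝ} (hn : 1 ≤ n) (hp : 1 < p) (hsub : ((n:ℝ) - 1) * p < n + 3) (hc : 0 < c)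
    {v d v' d' : ℝ → ℝ} (h : Prof n p c v d) (h' : Prof n p c v' d') (hlt : v' 0 < v 0) : False := by
  obtain ⟨s, hs0, hs1, hs2, hs3⟩ := ph_struct hn hp hsub
  have hWp : ∀ r, 0 < r → v' r / v r < 1 → 0 < S n r * (c * (v r ^ p * v' r - v' r ^ p * v r)) := by
    intro r hr hlt
    have p1 := h.pos r hr.le
    have p2 := h'.pos r hr.le
    rw [div_lt_one p1] at hlt
    refine mul_pos (S_pos n hr) (mul_pos hc ?_)
    have e : ∀ x : ℝ, 0 < x → x ^ p = x ^ (p - 1) * x := fun x hx => by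
      rw [rpow_sub_one hx.ne']; field_simp
    rw [e _ p1, e _ p2]
    have : v' r ^ (p - 1) < v r ^ (p - 1) := rpow_lt_rpow p2.le hlt (by linarith)
    nlinarith [mul_pos p1 p2]
  have hcρ : ContinuousOn (fun r => v' r / v r) (Ici 0) :=
    h'.cont.div h.cont (fun x hx => (h.pos x hx).ne')
  have hWcont : ContinuousOn (Wr n v d v' d') (Ioi 0) := fun x hx =>
    (Wr_deriv h h' hx).continuousAt.continuousWithinAt
  have hWm : ∀ R, (∀ r, 0 < r → r < R → v' r / v r < 1) → ∀ r ∈ Ioc 0 R, 0 < Wr n v d v' d' r := by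
    intro R hR
    have hm : StrictMonoOn (Wr n v d v' d') (Ioc 0 R) := by
      apply strictMonoOn_of_deriv_pos (convex_Ioc 0 R) (hWcont.mono fun x hx => hx.1)
      intro x hx
      rw [interior_Ioc] at hx
      rw [(Wr_deriv h h' hx.1).deriv]
      exact hWp x hx.1 (hR x hx.1 hx.2)
    intro r hr
    have h2 : 0 ≤ Wr n v d v' d' (r / 2) := by
      refine le_of_tendsto (Wr_zero hn h h') ?_
      filter_upwards [Ioc_mem_nhdsGT (show 0 < r / 2 by linarith [hr.1])] with x hx
      exact hm.monotoneOn ⟨hx.1, by linarith [hx.2, hr.1, hr.2]⟩ ⟨by linarith [hr.1], by linarith [hr.1, hr.2]⟩ hx.2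
    exact h2.trans_lt (hm ⟨by linarith [hr.1], by linarith [hr.1, hr.2]⟩ hr (by linarith [hr.1]))
  have hρ0 : v' 0 / v 0 < 1 := (div_lt_one (h.pos 0 le_rfl)).2 hlt
  obtain ⟨δ, hδ, hδ1⟩ : ∃ δ > 0, ∀ r, 0 < r → r < δ → v' r / v r < 1 := by
    have := (hcρ 0 (mem_Ici.2 le_rfl)).eventually (eventually_lt_nhds hρ0)
    rw [eventually_nhdsWithin_iff, Metric.eventually_nhds_iff] at this
    obtain ⟨δ, hδ, h⟩ := this
    exact ⟨δ, hδ, fun r h1 h2 => h (by rwa [dist_eq, sub_zero, abs_of_pos h1]) h1.le⟩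
  have hWδ := hWm δ hδ1
  by_cases hz : ∃ r > 0, Wr n v d v' d' r ≤ 0
  · obtain ⟨R, hR0, hR⟩ := hz
    have hδR : δ ≤ R := by
      by_contra hcon
      exact absurd (hWδ R ⟨hR0, (not_le.1 hcon).le⟩) (not_lt.2 hR)
    have hcl : IsCompact {r ∈ Icc δ R | Wr n v d v' d' r ≤ 0} := by
      have := (hWcont.mono (show Icc δ R ⊆ Ioi 0 from fun x hx => hδ.trans_le hx.1)).preimage_isClosed_of_isClosed isClosed_Icc isClosed_Iic (t := Iic 0)
      exact isCompact_Icc.of_isClosed_subset this inter_subset_left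
    obtain ⟨r1, ⟨hr1, hr1W⟩, hmin⟩ := hcl.exists_isLeast ⟨R, ⟨hδR, le_rfl⟩, hR⟩
    have h0r1 : 0 < r1 := hδ.trans_le hr1.1
    have hW : ∀ r, 0 < r → r < r1 → 0 < Wr n v d v' d' r := by
      intro r hr hrr
      rcases le_or_gt r δ with hx | hx
      · exact hWδ r ⟨hr, hx⟩
      · by_contra hcon
        exact absurd (hmin ⟨⟨hx.le, hrr.le.trans hr1.2⟩, not_lt.1 hcon⟩) (not_le.2 hrr)
    have hr1z : Wr n v d v' d' r1 = 0 := by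
      refine le_antisymm hr1W ?_
      have hc1 := ((Wr_deriv h h' h0r1).continuousAt.tendsto).mono_left (nhdsWithin_le_nhds (s := Iio r1))
      refine ge_of_tendsto hc1 ?_
      filter_upwards [Ioo_mem_nhdsLT h0r1] with x hx using (hW x hx.1 hx.2).le
    have hmono := rho_mono h h' hW
    set γ := v' r1 / v r1 with hγ
    have hγ1 : 1 < γ := by
      by_contra hcon
      have := hWm r1 (fun r hr hrr => (hmono ⟨hr.le, hrr.le⟩ ⟨h0r1.le, le_rfl⟩ hrr).trans_le (not_lt.1 hcon)) r1 ⟨h0r1, le_rfl⟩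
      linarith
    have hm0 : 0 ≤ min s r1 := le_min hs0 h0r1.le
    have hmr : min s r1 ≤ r1 := min_le_right _ _
    set γs := v' (min s r1) / v (min s r1) with hγs
    have hγs0 : 0 < γs := div_pos (h'.pos _ hm0) (h.pos _ hm0)
    have hle : γs ≤ γ := hmono.monotoneOn ⟨hm0, hmr⟩ ⟨h0r1.le, le_rfl⟩ hmr
    have hsgn : ∀ r, 0 < r → r < r1 → ph n p r * ((v' r / v r) ^ 2 - γs ^ 2) ≤ 0 := by
      intro r hr hrr
      have hρp : 0 < v' r / v r := div_pos (h'.pos _ hr.le) (h.pos _ hr.le)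
      rcases lt_trichotomy r (min s r1) with hx | hx | hx
      · have a1 := hs1 r hr (hx.trans_le (min_le_left _ _))
        have : v' r / v r < γs := hmono ⟨hr.le, hrr.le⟩ ⟨hm0, hmr⟩ hx
        exact mul_nonpos_of_nonneg_of_nonpos a1 (sub_nonpos.2 (pow_le_pow_left₀ hρp.le this.le 2))
      · rw [hγs, ← hx]; simp
      · have hsr : s < r := by
          rcases min_lt_iff.1 hx with q | q
          · exact q
          · linarith
        have a1 := hs2 r hsr
        have : γs < v' r / v r := hmono ⟨hm0, hmr⟩ ⟨hr.le, hrr.le⟩ hx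
        exact mul_nonpos_of_nonpos_of_nonneg a1.le (sub_nonneg.2 (pow_le_pow_left₀ hγs0.le this.le 2))
    have hF := F_nonpos hn hp hc h h' h0r1 (γ := γs) (hs3.imp id (fun hh => by
      rw [hγs, hh, min_eq_left h0r1.le])) hsgn
    have hv1 := h.pos r1 h0r1.le
    have ev : v' r1 = γ * v r1 := by rw [hγ]; field_simp
    have ed : d' r1 = γ * d r1 := by
      have : d' r1 * v r1 - v' r1 * d r1 = 0 := by
        have := hr1z; unfold Wr at this
        exact (mul_eq_zero.1 this).resolve_left (S_pos n h0r1).ne'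
      rw [ev] at this
      have : v r1 * (d' r1 - γ * d r1) = 0 := by linear_combination this
      have := (mul_eq_zero.1 this).resolve_left hv1.ne'
      linarith
    have hs : 0 < sinh r1 := sinh_pos_iff.2 h0r1
    have hk : PE n p c v' d' r1 = γ ^ 2 * PE n p c v d r1 + (γ ^ p * γ - γ ^ 2) *
        (sinh r1 ^ (2 * n * (p + 1) / (p + 3) - 2) * sinh r1 ^ 2 * c * (v r1 ^ p * v r1) / (p + 1)) := by
      unfold PE
      rw [ev, ed, mul_rpow (by linarith) hv1.le]
      ring
    have h1 : 0 < (γ ^ p * γ - γ ^ 2) *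
        (sinh r1 ^ (2 * n * (p + 1) / (p + 3) - 2) * sinh r1 ^ 2 * c * (v r1 ^ p * v r1) / (p + 1)) := by
      have : γ < γ ^ p := by
        conv_lhs => rw [← rpow_one γ]
        exact rpow_lt_rpow_of_exponent_lt hγ1 hp
      have : 0 < γ ^ p * γ - γ ^ 2 := by linarith [mul_lt_mul_of_pos_right this (by linarith : 0 < γ)]
      positivity
    have h2 : 0 ≤ (γ ^ 2 - γs ^ 2) * PE n p c v d r1 := by
      rcases le_or_gt r1 s with hx | hx
      · rw [hγs, min_eq_right hx]; simp [hγ]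
      · exact mul_nonneg (sub_nonneg.2 (pow_le_pow_left₀ hγs0.le hle 2)) (PE_nonneg hn hp hc h h0r1 fun r hr => hs2 r (hx.trans hr))
    linarith
  · push Not at hz
    have hmono : StrictMonoOn (fun r => v' r / v r) (Ici 0) := by
      intro x hx y hy hxy
      exact rho_mono h h' (R := y) (fun r hr _ => hz r hr) ⟨hx, hxy.le⟩ ⟨hy, le_rfl⟩ hxy
    set γs := v' s / v s with hγs
    have hγs0 : 0 < γs := div_pos (h'.pos _ hs0) (h.pos _ hs0)
    have hsgn : ∀ r, 0 < r → ph n p r * ((v' r / v r) ^ 2 - γs ^ 2) ≤ 0 := by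
      intro r hr
      have hρp : 0 < v' r / v r := div_pos (h'.pos _ hr.le) (h.pos _ hr.le)
      rcases lt_trichotomy r s with hx | hx | hx
      · have a1 := hs1 r hr hx
        have : v' r / v r < γs := hmono hr.le hs0 hx
        exact mul_nonpos_of_nonneg_of_nonpos a1 (sub_nonpos.2 (pow_le_pow_left₀ hρp.le this.le 2))
      · rw [hγs, ← hx]; simp
      · have a1 := hs2 r hx
        have : γs < v' r / v r := hmono hs0 hr.le hx
        exact mul_nonpos_of_nonpos_of_nonneg a1.le (sub_nonneg.2 (pow_le_pow_left₀ hγs0.le this.le 2))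
    have hz0 : ∀ R > 0, PE n p c v' d' R - γs ^ 2 * PE n p c v d R = 0 := by
      intro R hR
      refine le_antisymm (F_nonpos hn hp hc h h' hR (γ := γs) (hs3.imp id (fun hh => by
        rw [hγs, hh])) fun r hr _ => hsgn r hr) ?_
      have ht : Tendsto (fun r => PE n p c v' d' r - γs ^ 2 * PE n p c v d r) atTop (𝓝 0) := by
        simpa using (PE_inf hn hp hc h').sub ((PE_inf hn hp hc h).const_mul (γs ^ 2))
      refine le_of_tendsto ht ?_
      filter_upwards [eventually_ge_atTop R] with r hr
      exact F_anti hn hp h h' (R := r) (fun r hr _ => hsgn r hr) ⟨hR, hr⟩ ⟨hR.trans_le hr, le_rfl⟩ hr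
    have hr : 0 < s + 1 := by linarith
    have d1 := F_deriv hp h h' γs hr
    have d2 : HasDerivAt (fun r => PE n p c v' d' r - γs ^ 2 * PE n p c v d r) 0 (s + 1) := by
      refine (hasDerivAt_const (s + 1) (0:ℝ)).congr_of_eventuallyEq ?_
      filter_upwards [lt_mem_nhds hr] with x hx using hz0 x hx
    have e := d1.unique d2
    have k := Kpos hn hp h hr
    have a1 := hs2 (s + 1) (by linarith)
    have : γs < v' (s + 1) / v (s + 1) := hmono hs0 hr.le (by linarith)
    have : ph n p (s + 1) * ((v' (s + 1) / v (s + 1)) ^ 2 - γs ^ 2) < 0 :=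
      mul_neg_of_neg_of_pos a1 (sub_pos.2 (pow_lt_pow_left₀ this hγs0.le two_ne_zero))
    linarith [mul_neg_of_pos_of_neg k this]
lemma S_deriv (n : ℕ) {r : ℝ} (hr : 0 < r) :
    HasDerivAt (S n) (n * (cosh r / sinh r) * S n r) r := by
  have hs : 0 < sinh r := sinh_pos_iff.2 hr
  refine ((hasDerivAt_sinh r).pow n).congr_deriv ?_
  unfold S
  rcases n with _ | k
  · simp
  · rw [pow_succ]; simp only [Nat.add_sub_cancel]; field_simp
lemma flux {n : ℕ} (hn : 1 ≤ n) {d q : ℝ → ℝ} (hq : Continuous q)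
    (hd : ∀ r > 0, HasDerivAt d (q r - n * (cosh r / sinh r) * d r) r)
    {C : ℝ} (hC : ∀ r ∈ Ioc (0:ℝ) 1, |d r| ≤ C) {r : ℝ} (hr : 0 < r) :
    d r = Mf n q r / S n r := by
  have h1 : ∀ r > 0, HasDerivAt (fun r => S n r * d r - Mf n q r) 0 r := by
    intro r hr
    refine (((S_deriv n hr).mul (hd r hr)).sub (Mf_hasDerivAt hq r)).congr_deriv ?_
    ring
  have h2 : ∀ x > 0, ∀ y > 0, S n x * d x - Mf n q x = S n y * d y - Mf n q y := by
    intro x hx y hy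
    exact isOpen_Ioi.is_const_of_deriv_eq_zero isPreconnected_Ioi
      (fun z hz => (h1 z hz).differentiableAt.differentiableWithinAt) (fun z hz => (h1 z hz).deriv) hx hy
  have h3 : Tendsto (fun r => S n r * d r - Mf n q r) (𝓝[>] 0) (𝓝 0) := by
    have a1 : Tendsto (fun r => S n r * d r) (𝓝[>] 0) (𝓝 0) := by
      have : Tendsto (fun r => S n r * C) (𝓝[>] 0) (𝓝 0) := by
        have : Tendsto (fun r => S n r * C) (𝓝 0) (𝓝 (S n 0 * C)) :=
          ((S_cont n).mul continuous_const).tendsto 0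
        rw [S_zero hn, zero_mul] at this
        exact this.mono_left nhdsWithin_le_nhds
      refine squeeze_zero_norm' ?_ this
      filter_upwards [Ioc_mem_nhdsGT (show (0:ℝ) < 1 by norm_num)] with r hr
      rw [norm_mul, norm_of_nonneg (S_nonneg n hr.1.le), norm_eq_abs]
      exact mul_le_mul_of_nonneg_left (hC r hr) (S_nonneg n hr.1.le)
    have a2 : Tendsto (Mf n q) (𝓝[>] 0) (𝓝 0) := by
      have := (Mf_cont (n := n) hq).tendsto 0
      rw [Mf_zero] at this
      exact this.mono_left nhdsWithin_le_nhds
    simpa using a1.sub a2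
  have h4 : Tendsto (fun _ : ℝ => S n r * d r - Mf n q r) (𝓝[>] (0:ℝ)) (𝓝 0) := by
    refine h3.congr' ?_
    filter_upwards [self_mem_nhdsWithin] with x hx using h2 x hx r hr
  have h5 := tendsto_nhds_unique h4 tendsto_const_nhds
  rw [eq_div_iff (S_pos n hr).ne']
  linarith
lemma bdd_deriv {f : ℝ → ℝ} (hf : ContDiffOn ℝ (⊤ : ℕ∞) f (Ici 0)) :
    ∃ C, ∀ r ∈ Ioc (0:ℝ) 1, |deriv f r| ≤ C := by
  have h1 : ContinuousOn (derivWithin f (Ici 0)) (Ici 0) :=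
    hf.continuousOn_derivWithin (uniqueDiffOn_Ici 0) (by simp)
  obtain ⟨C, hC⟩ := isCompact_Icc.exists_bound_of_continuousOn (h1.mono (Icc_subset_Ici_self : Icc (0:ℝ) 1 ⊆ Ici 0))
  refine ⟨C, fun r hr => ?_⟩
  have := hC r ⟨hr.1.le, hr.2⟩
  rwa [derivWithin_of_mem_nhds (Ici_mem_nhds hr.1)] at this
lemma smooth_derivs {f : ℝ → ℝ} (hf : ContDiffOn ℝ (⊤ : ℕ∞) f (Ici 0)) {r : ℝ} (hr : 0 < r) :
    HasDerivAt f (deriv f r) r ∧ HasDerivAt (deriv f) (deriv (deriv f) r) r := by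
  have h1 : ContDiffOn ℝ (⊤ : ℕ∞) f (Ioi 0) := hf.mono Ioi_subset_Ici_self
  have h2 : ContDiffOn ℝ 1 (deriv f) (Ioi 0) :=
    h1.deriv_of_isOpen isOpen_Ioi (m := 1) (WithTop.coe_le_coe.2 le_top)
  exact ⟨((h1.differentiableOn (by simp)).differentiableAt (Ioi_mem_nhds hr)).hasDerivAt,
    ((h2.differentiableOn (by simp)).differentiableAt (Ioi_mem_nhds hr)).hasDerivAt⟩
lemma prof_of_stationary {N : ℕ} (hN : 2 ≤ N) {m T : ℝ} (hm0 : 0 < m)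
    {V : ℝ → ℝ} (hV : IsStationaryProfile N m T V) :
    Prof (N - 1) (1 / m) (1 / ((1 - m) * T)) V (deriv V) := by
  have hn : 1 ≤ N - 1 := by omega
  have hc : ((N - 1 : ℕ) : ℝ) = (N:ℝ) - 1 := by
    rw [Nat.cast_sub (by omega)]; simp
  have hd : ∀ r > 0, HasDerivAt (deriv V) (-((N - 1 : ℕ) * (cosh r / sinh r) * deriv V r) - 1 / ((1 - m) * T) * V r ^ (1 / m)) r := by
    intro r hr
    refine (smooth_derivs hV.smooth hr).2.congr_deriv ?_
    have := hV.ode r hr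
    rw [hc]
    linear_combination this
  obtain ⟨C, hC⟩ := bdd_deriv hV.smooth
  have hcV : Continuous (fun r => V |r|) :=
    hV.smooth.continuousOn.comp_continuous continuous_abs (fun x => abs_nonneg x)
  have hq : Continuous (fun r => -(1 / ((1 - m) * T)) * V |r| ^ (1 / m)) :=
    continuous_const.mul (hcV.rpow_const (fun x => Or.inr (by positivity)))
  have hfl := fun r (hr : 0 < r) => flux (n := N - 1) hn (d := deriv V) hq (fun r hr => by
    refine (hd r hr).congr_deriv ?_
    rw [abs_of_pos hr]; ring) hC hr
  refine ⟨fun r hr => (smooth_derivs hV.smooth hr).1, hd, hV.pos, hV.smooth.continuousOn, ?_, ?_⟩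
  · obtain ⟨K, hK⟩ := isCompact_Icc.exists_bound_of_continuousOn (hq.continuousOn (s := Icc 0 1))
    refine ⟨K, fun r hr => ?_⟩
    rw [hfl r hr.1, abs_div, abs_of_pos (S_pos _ hr.1), div_le_iff₀ (S_pos _ hr.1)]
    exact Mf_abs_le' hq hr.1.le fun x hx => hK x ⟨hx.1, hx.2.trans hr.2⟩
  · obtain ⟨l, hl, hk⟩ := hV.asymp
    have key : ∀ f : ℝ → ℝ, ContinuousOn f (Ioi 0) → ∀ L, Tendsto (fun r => exp (((N : ℝ) - 1) * r) * f r) atTop (𝓝 L) →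
        ∃ C, ∀ r ≥ 1, |f r| ≤ C * exp (-(((N - 1 : ℕ) : ℝ) * r)) := by
      intro f hf L hL
      have h1 := hL.abs.eventually (eventually_lt_nhds (show |L| < |L| + 1 by linarith))
      obtain ⟨R, hR⟩ := eventually_atTop.1 h1
      have hcf : ContinuousOn (fun r => exp (((N : ℝ) - 1) * r) * f r) (Icc 1 R) :=
        (by fun_prop : Continuous fun r => exp (((N : ℝ) - 1) * r)).continuousOn.mul
          (hf.mono fun x hx => lt_of_lt_of_le one_pos hx.1)
      obtain ⟨K, hK⟩ := isCompact_Icc.exists_bound_of_continuousOn hcf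
      refine ⟨max K (|L| + 1), fun r hr => ?_⟩
      have : |exp (((N : ℝ) - 1) * r) * f r| ≤ max K (|L| + 1) := by
        rcases le_total r R with h | h
        · exact (hK r ⟨hr, h⟩).trans (le_max_left _ _)
        · exact (hR r h).le.trans (le_max_right _ _)
      rw [abs_mul, abs_of_pos (exp_pos _)] at this
      rw [exp_neg, hc, ← div_eq_mul_inv, le_div_iff₀ (exp_pos _)]
      linarith
    have k0 := hk 0
    have k1 := hk 1
    simp only [iteratedDeriv_zero, iteratedDeriv_one] at k0 k1
    obtain ⟨C1, h1⟩ := key V (hV.smooth.continuousOn.mono Ioi_subset_Ici_self) _ k0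
    obtain ⟨C2, h2⟩ := key (deriv V) (fun x hx => (hd x hx).continuousAt.continuousWithinAt) _ k1
    refine ⟨max C1 C2, fun r hr => ⟨?_, ?_⟩⟩
    · exact (le_abs_self _).trans ((h1 r hr).trans (mul_le_mul_of_nonneg_right (le_max_left _ _) (exp_pos _).le))
    · exact (h2 r hr).trans (mul_le_mul_of_nonneg_right (le_max_right _ _) (exp_pos _).le)
structure Core (n : ℕ) (m T : ℝ) (U Ut : ℝ → ℝ → ℝ) : Prop where
  hn : 1 ≤ n
  hm0 : 0 < m
  hm1 : m < 1
  hsub : ((n:ℝ) - 1) < m * (n + 3)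
  hT : 0 < T
  cont : Continuous (fun q : ℝ × ℝ => U q.1 q.2)
  nonneg : ∀ r t, 0 ≤ U r t
  pos : ∀ r, ∀ t ∈ Ioo 0 T, 0 < U r t
  ext : ∀ r t, T ≤ t → U r t = 0
  dt : ∀ r, ∀ t ∈ Ioo 0 T, HasDerivAt (fun s => U r s) (Ut r t) t
  Utc : ContinuousOn (fun q : ℝ × ℝ => Ut q.1 q.2) (univ ×ˢ Ioo 0 T)
  dr : ∀ r > 0, ∀ t ∈ Ioo 0 T, HasDerivAt (fun ρ => U ρ t ^ m) (Mf n (fun ρ => Ut ρ t) r / S n r) r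
  decay : ∃ C, ∀ r ≥ 0, ∀ t ≥ T / 2, U r t ^ m ≤ C * exp (-(n * r / 2))
lemma h1_decay {n : ℕ} {f f' : ℝ → ℝ} (hf : ContinuousOn f (Ioi 0)) (hf' : ContinuousOn f' (Ioi 0))
    (hd : ∀ r > 0, HasDerivAt f (f' r) r)
    (h1 : IntegrableOn (fun s => f s ^ 2 * S n s) (Ioi 0))
    (h2 : IntegrableOn (fun s => f' s ^ 2 * S n s) (Ioi 0))
    {H : ℝ} (hH : (∫ s in Ioi 0, f s ^ 2 * S n s) + (∫ s in Ioi 0, f' s ^ 2 * S n s) ≤ H) {r : ℝ} (hr : 0 < r) :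
    S n r * f r ^ 2 ≤ 2 * H := by
  have hadd : ∫ s in Ioi 0, (f s ^ 2 + f' s ^ 2) * S n s ≤ H := by
    simp_rw [add_mul]; rw [integral_add h1 h2]; exact hH
  have hi : IntegrableOn (fun s => (f s ^ 2 + f' s ^ 2) * S n s) (Ioi 0) := by
    simp_rw [add_mul]; exact h1.add h2
  have hle : ∀ x y, 0 < x → x ≤ y → ∫ s in x..y, (f s ^ 2 + f' s ^ 2) * S n s ≤ H := by
    intro x y hx hxy
    rw [intervalIntegral.integral_of_le hxy]
    refine le_trans (setIntegral_mono_set hi ?_ (LE.le.eventuallyLE fun z hz => hx.trans hz.1)) hadd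
    filter_upwards [ae_restrict_mem measurableSet_Ioi] with z hz
    have := S_nonneg n (le_of_lt hz); positivity
  obtain ⟨R, hR, hRv⟩ : ∃ R ∈ Icc r (r + 1), S n R * f R ^ 2 ≤ H := by
    by_contra hcon
    push Not at hcon
    have hc : ContinuousOn (fun s => (f s ^ 2 + f' s ^ 2) * S n s) (Icc r (r + 1)) :=
      ((((hf.pow 2).add (hf'.pow 2)).mul (S_cont n).continuousOn)).mono fun x hx => hr.trans_le hx.1
    have := intervalIntegral.integral_lt_integral_of_continuousOn_of_le_of_exists_lt (f := fun _ => H)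
      (show r < r + 1 by linarith) continuousOn_const hc (fun x hx => by
        have := hcon x ⟨hx.1.le, hx.2⟩
        have := S_nonneg n (hr.trans hx.1).le
        nlinarith [mul_nonneg this (sq_nonneg (f' x))])
      ⟨r, ⟨le_rfl, by linarith⟩, by
        have := hcon r ⟨le_rfl, by linarith⟩
        have := S_nonneg n hr.le
        nlinarith [mul_nonneg this (sq_nonneg (f' r))]⟩
    simp at this
    linarith [hle r (r + 1) hr (by linarith)]
  have hsub : Icc r R ⊆ Ioi 0 := fun x hx => hr.trans_le hx.1
  have hft : ∫ s in r..R, 2 * f s * f' s = f R ^ 2 - f r ^ 2 := by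
    apply intervalIntegral.integral_eq_sub_of_hasDerivAt_of_le hR.1 ((hf.pow 2).mono hsub)
    · intro x hx
      simpa using (hd x (hr.trans hx.1)).pow 2
    · apply ContinuousOn.intervalIntegrable
      rw [uIcc_of_le hR.1]
      exact ((continuousOn_const.mul hf).mul hf').mono hsub
  have hcomp : ∫ s in r..R, -(2 * f s * f' s) * S n r ≤ ∫ s in r..R, (f s ^ 2 + f' s ^ 2) * S n s := by
    apply intervalIntegral.integral_mono_on hR.1
    · apply ContinuousOn.intervalIntegrable
      rw [uIcc_of_le hR.1]
      exact (((continuousOn_const.mul hf).mul hf').neg.mul continuousOn_const).mono hsub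
    · apply ContinuousOn.intervalIntegrable
      rw [uIcc_of_le hR.1]
      exact ((((hf.pow 2).add (hf'.pow 2)).mul (S_cont n).continuousOn)).mono hsub
    · intro x hx
      have a1 := S_mono n hr.le hx.1
      have a2 := S_nonneg n hr.le
      calc -(2 * f x * f' x) * S n r ≤ (f x ^ 2 + f' x ^ 2) * S n r :=
            mul_le_mul_of_nonneg_right (by nlinarith [sq_nonneg (f x + f' x)]) a2
        _ ≤ _ := mul_le_mul_of_nonneg_left a1 (by positivity)
  rw [intervalIntegral.integral_mul_const, intervalIntegral.integral_neg, hft] at hcomp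
  have a1 := S_mono n hr.le hR.1
  have := hle r R hr hR.1
  nlinarith [mul_le_mul_of_nonneg_right a1 (sq_nonneg (f R))]
lemma core_of_solution {N : ℕ} (hN : 2 ≤ N) {m T : ℝ}
    (hm : m ∈ Set.Ioo (((N : ℝ) - 2) / ((N : ℝ) + 2)) 1) (hT : 0 < T)
    {u : ℝ → ℝ → ℝ} (hu : IsRadialEnergySolution N m T u) :
    ∃ U Ut, Core (N - 1) m T U Ut ∧ ∀ r ≥ 0, ∀ t ∈ Ioo 0 T, U r t = u r t := by
  have hn : 1 ≤ N - 1 := by omega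
  have hc : ((N - 1 : ℕ) : ℝ) = (N:ℝ) - 1 := by
    rw [Nat.cast_sub (by omega)]; simp
  have hN' : (2:ℝ) ≤ N := by exact_mod_cast hN
  have hm0 : 0 < m := lt_of_le_of_lt (div_nonneg (by linarith) (by linarith)) hm.1
  set D : Set (ℝ × ℝ) := Ici 0 ×ˢ Ioo 0 T with hD
  set f : ℝ × ℝ → ℝ := fun p => u p.1 p.2 with hf
  have hud : UniqueDiffOn ℝ D := (uniqueDiffOn_Ici 0).prod isOpen_Ioo.uniqueDiffOn
  have hfd : ContinuousOn (fderivWithin ℝ f D) D := hu.smooth.continuousOn_fderivWithin hud (by simp)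
  have hdiff : ∀ q ∈ D, HasFDerivWithinAt f (fderivWithin ℝ f D q) D q := fun q hq =>
    ((hu.smooth.differentiableOn (by simp)) q hq).hasFDerivWithinAt
  have ht : ∀ r ≥ 0, ∀ t ∈ Ioo 0 T, HasDerivAt (fun s => u r s) (fderivWithin ℝ f D (r, t) (0, 1)) t := by
    intro r hr t ht
    have h1 := (hdiff (r, t) ⟨hr, ht⟩).comp_hasDerivWithinAt (s := Ioo 0 T) t
      ((hasDerivWithinAt_const t (Ioo 0 T) r).prodMk (hasDerivWithinAt_id t (Ioo 0 T))) (fun s hs => ⟨hr, hs⟩)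
    exact h1.hasDerivAt (Ioo_mem_nhds ht.1 ht.2)
  have hsm : ∀ t ∈ Ioo 0 T, ContDiffOn ℝ (⊤ : ℕ∞) (fun r => u r t ^ m) (Ici 0) := by
    intro t ht
    have h1 : ContDiffOn ℝ (⊤ : ℕ∞) (fun r => u r t) (Ici 0) :=
      hu.smooth.comp (contDiff_id.prodMk contDiff_const).contDiffOn (fun r hr => ⟨hr, ht⟩)
    exact h1.rpow_const_of_ne (fun r hr => (hu.pos r hr t ht).ne')
  set U : ℝ → ℝ → ℝ := fun r t => u |r| (max 0 (min t T)) with hU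
  set Ut : ℝ → ℝ → ℝ := fun r t => fderivWithin ℝ f D (|r|, t) (0, 1) with hUt
  have hcl : ∀ t, max 0 (min t T) ∈ Icc 0 T := fun t => ⟨le_max_left _ _, max_le hT.le (min_le_right _ _)⟩
  have hclI : ∀ t ∈ Ioo 0 T, max 0 (min t T) = t := fun t ht => by
    rw [min_eq_left ht.2.le, max_eq_right ht.1.le]
  have hUu : ∀ r, ∀ t ∈ Ioo 0 T, U r t = u |r| t := fun r t ht => by simp only [hU]; rw [hclI t ht]
  have hcont : Continuous (fun q : ℝ × ℝ => U q.1 q.2) := by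
    have : Continuous (fun q : ℝ × ℝ => ((|q.1|, max 0 (min q.2 T)) : ℝ × ℝ)) := by fun_prop
    exact hu.continuousOn.comp_continuous this (fun q => ⟨mem_Ici.2 (abs_nonneg _), hcl _⟩)
  have hUtc : ContinuousOn (fun q : ℝ × ℝ => Ut q.1 q.2) (univ ×ˢ Ioo 0 T) := by
    have h1 : ContinuousOn (fun q : ℝ × ℝ => fderivWithin ℝ f D (|q.1|, q.2)) (univ ×ˢ Ioo 0 T) :=
      hfd.comp (by fun_prop : Continuous (fun q : ℝ × ℝ => ((|q.1|, q.2) : ℝ × ℝ))).continuousOn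
        (fun q hq => ⟨mem_Ici.2 (abs_nonneg _), hq.2⟩)
    exact h1.clm_apply continuousOn_const
  have hUts : ∀ t ∈ Ioo 0 T, Continuous (fun ρ => Ut ρ t) := fun t ht =>
    hUtc.comp_continuous (by fun_prop : Continuous fun ρ : ℝ => ((ρ, t) : ℝ × ℝ)) (fun ρ => ⟨mem_univ _, ht⟩)
  have hfl : ∀ r > 0, ∀ t ∈ Ioo 0 T, deriv (fun ρ => u ρ t ^ m) r = Mf (N - 1) (fun ρ => Ut ρ t) r / S (N - 1) r := by
    intro r hr t ht'
    obtain ⟨C, hC⟩ := bdd_deriv (hsm t ht')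
    refine flux hn (d := deriv (fun ρ => u ρ t ^ m)) (hUts t ht') (fun x hx => ?_) hC hr
    refine (smooth_derivs (hsm t ht') hx).2.congr_deriv ?_
    have h1 := hu.pde x hx t ht'
    have h2 := (ht x hx.le t ht').deriv
    simp only [hUt, abs_of_pos hx]
    rw [← h2, h1, hc]; ring
  refine ⟨U, Ut, ⟨hn, hm0, hm.2, ?_, hT, hcont, fun r t => hu.nonneg _ (mem_Ici.2 (abs_nonneg _)) _ (hcl _), ?_, ?_, ?_, hUtc, ?_, ?_⟩, ?_⟩
  · have := hm.1
    rw [div_lt_iff₀ (by linarith)] at this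
    rw [hc]; linarith
  · intro r t ht'
    rw [hUu r t ht']; exact hu.pos _ (mem_Ici.2 (abs_nonneg _)) t ht'
  · intro r t ht'
    simp only [hU]
    rw [min_eq_right ht', max_eq_right hT.le]
    exact hu.extinction _ (mem_Ici.2 (abs_nonneg _))
  · intro r t ht'
    refine (ht |r| (abs_nonneg _) t ht').congr_of_eventuallyEq ?_
    filter_upwards [Ioo_mem_nhds ht'.1 ht'.2] with s hs using hUu r s hs
  · intro r hr t ht'
    rw [← hfl r hr t ht']
    refine (smooth_derivs (hsm t ht') hr).1.congr_of_eventuallyEq ?_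
    filter_upwards [lt_mem_nhds hr] with x hx
    rw [hUu x t ht', abs_of_pos hx]
  · obtain ⟨H, hH⟩ := hu.energy_bdd (T / 2) ⟨by linarith, by linarith⟩
    have hwc : Continuous (fun q : ℝ × ℝ => U q.1 q.2 ^ m) := hcont.rpow_const (fun _ => Or.inr hm0.le)
    obtain ⟨K, hK⟩ := (isCompact_Icc.prod isCompact_Icc).exists_bound_of_continuousOn
      (hwc.continuousOn (s := Icc (0:ℝ) 1 ×ˢ Icc (T / 2) T))
    have hK0 : 0 ≤ K := (norm_nonneg _).trans (hK (0, T) ⟨by simp, by simp; linarith⟩)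
    set n := N - 1 with hnn
    refine ⟨K * exp (n / 2) + √(2 * |H| * 4 ^ n), fun r hr t ht' => ?_⟩
    have hw0 : 0 ≤ U r t ^ m := rpow_nonneg (hu.nonneg _ (mem_Ici.2 (abs_nonneg _)) _ (hcl _)) _
    rcases le_or_gt T t with h | h
    · have : U r t = 0 := by
        simp only [hU]
        rw [min_eq_right h, max_eq_right hT.le]
        exact hu.extinction _ (mem_Ici.2 (abs_nonneg _))
      rw [this, zero_rpow hm0.ne']; positivity
    have htt : t ∈ Ioo 0 T := ⟨by linarith, h⟩
    rcases le_or_gt r 1 with h1 | h1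
    · have h2 := (le_abs_self _).trans (hK (r, t) ⟨⟨hr, h1⟩, ht', h.le⟩)
      refine h2.trans ?_
      rw [add_mul, mul_assoc, ← exp_add]
      have : 1 ≤ exp (n / 2 + -(n * r / 2)) := by
        apply one_le_exp
        have : (0:ℝ) ≤ n := Nat.cast_nonneg n
        nlinarith
      have : 0 ≤ √(2 * |H| * 4 ^ n) * exp (-(n * r / 2)) := by positivity
      nlinarith
    · have hr0 : 0 < r := by linarith
      obtain ⟨-, e1, e2⟩ := hu.energy t htt
      have hcd := fun x (hx : 0 < x) => smooth_derivs (hsm t htt) hx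
      have := h1_decay (n := n) (f := fun ρ => u ρ t ^ m) (f' := deriv (fun ρ => u ρ t ^ m))
        (fun x hx => (hcd x hx).1.continuousAt.continuousWithinAt)
        (fun x hx => (hcd x hx).2.continuousAt.continuousWithinAt) (fun x hx => (hcd x hx).1)
        e1 e2 (hH t ⟨ht', h⟩) hr0
      rw [hUu r t htt, abs_of_pos hr0] at hw0 ⊢
      have h4 := exp_le_S n h1.le
      have h5 : exp (n * r) * (u r t ^ m) ^ 2 ≤ 2 * |H| * 4 ^ n := by
        calc _ ≤ 4 ^ n * S n r * (u r t ^ m) ^ 2 := by gcongr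
          _ = 4 ^ n * (S n r * (u r t ^ m) ^ 2) := by ring
          _ ≤ 4 ^ n * (2 * |H|) := by
            refine mul_le_mul_of_nonneg_left (this.trans ?_) (by positivity)
            linarith [le_abs_self H]
          _ = _ := by ring
      have h6 : u r t ^ m * exp (n * r / 2) ≤ √(2 * |H| * 4 ^ n) := by
        apply le_sqrt_of_sq_le
        rw [mul_pow, ← exp_nat_mul]
        convert h5 using 1
        rw [mul_comm]; congr 2; push_cast; ring
      rw [exp_neg, ← div_eq_mul_inv, le_div_iff₀ (exp_pos _)]
      have : 0 ≤ K * exp (n / 2) := by positivity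
      linarith
  · intro r hr t ht'
    rw [hUu r t ht', abs_of_nonneg hr]
lemma hasDerivAt_param {F F' : ℝ → ℝ → ℝ} {a b c d x0 : ℝ} (hab : a ≤ b) (hx0 : x0 ∈ Ioo c d)
    (hF : ContinuousOn (fun q : ℝ × ℝ => F q.1 q.2) (Ioo c d ×ˢ Icc a b))
    (hF' : ContinuousOn (fun q : ℝ × ℝ => F' q.1 q.2) (Ioo c d ×ˢ Icc a b))
    (h : ∀ x ∈ Ioo c d, ∀ y ∈ Icc a b, HasDerivAt (fun x => F x y) (F' x y) x) :
    HasDerivAt (fun x => ∫ y in a..b, F x y) (∫ y in a..b, F' x0 y) x0 := by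
  obtain ⟨ε, hε, hball⟩ : ∃ ε > 0, Icc (x0 - ε) (x0 + ε) ⊆ Ioo c d := by
    refine ⟨min (x0 - c) (d - x0) / 2, ?_, fun y hy => ?_⟩
    · have := lt_min (sub_pos.2 hx0.1) (sub_pos.2 hx0.2); linarith
    · have h1 := min_le_left (x0 - c) (d - x0)
      have h2 := min_le_right (x0 - c) (d - x0)
      have h3 := lt_min (sub_pos.2 hx0.1) (sub_pos.2 hx0.2)
      exact ⟨by linarith [hy.1], by linarith [hy.2]⟩
  obtain ⟨K, hK⟩ := (isCompact_Icc.prod isCompact_Icc).exists_bound_of_continuousOn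
    (hF'.mono (prod_mono_left hball (t := Icc a b)))
  have slice : ∀ G : ℝ → ℝ → ℝ, ContinuousOn (fun q : ℝ × ℝ => G q.1 q.2) (Ioo c d ×ˢ Icc a b) →
      ∀ x ∈ Ioo c d, ContinuousOn (G x) (Icc a b) := fun G hG x hx =>
    hG.comp (by fun_prop : Continuous fun y : ℝ => ((x, y) : ℝ × ℝ)).continuousOn (fun y hy => ⟨hx, hy⟩)
  have sint : ∀ G : ℝ → ℝ → ℝ, ContinuousOn (fun q : ℝ × ℝ => G q.1 q.2) (Ioo c d ×ˢ Icc a b) →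
      ∀ x ∈ Ioo c d, IntervalIntegrable (G x) volume a b := fun G hG x hx =>
    ContinuousOn.intervalIntegrable (by rw [uIcc_of_le hab]; exact slice G hG x hx)
  refine (intervalIntegral.hasDerivAt_integral_of_dominated_loc_of_deriv_le (F' := F')
    (s := Icc (x0 - ε) (x0 + ε)) (bound := fun _ => K)
    (Icc_mem_nhds (by linarith) (by linarith)) ?_ (sint F hF x0 hx0) (sint F' hF' x0 hx0).def'.aestronglyMeasurable ?_ (by simp) ?_).2
  · filter_upwards [Ioo_mem_nhds hx0.1 hx0.2] with x hx using (sint F hF x hx).def'.aestronglyMeasurable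
  · refine Eventually.of_forall fun y hy x hx => ?_
    rw [uIoc_of_le hab] at hy
    exact hK (x, y) ⟨hx, hy.1.le, hy.2⟩
  · refine Eventually.of_forall fun y hy x hx => ?_
    rw [uIoc_of_le hab] at hy
    exact h x (hball hx) y ⟨hy.1.le, hy.2⟩
noncomputable def wf (m : ℝ) (U : ℝ → ℝ → ℝ) (r t : ℝ) : ℝ := U r t ^ m
noncomputable def Mu (n : ℕ) (U : ℝ → ℝ → ℝ) (r t : ℝ) : ℝ := Mf n (fun ρ => U ρ t) r
noncomputable def gf (m T : ℝ) (U : ℝ → ℝ → ℝ) (r t : ℝ) : ℝ := ∫ τ in t..T, wf m U r τ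
namespace Core
variable {n : ℕ} {m T : ℝ} {U Ut : ℝ → ℝ → ℝ} (h : Core n m T U Ut)
include h
local notation "wU" => wf m U
local notation "gU" => gf m T U
local notation "MU" => Mu n U
local notation "Mt" => Mu n Ut
lemma wc : Continuous (fun q : ℝ × ℝ => wU q.1 q.2) :=
  h.cont.rpow_const (fun _ => Or.inr h.hm0.le)
lemma w_nonneg (r t : ℝ) : 0 ≤ wU r t := rpow_nonneg (h.nonneg r t) _
lemma w_pos (r : ℝ) {t : ℝ} (ht : t ∈ Ioo 0 T) : 0 < wU r t :=
  rpow_pos_of_pos (h.pos r t ht) _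
lemma w_ext (r : ℝ) {t : ℝ} (ht : T ≤ t) : wU r t = 0 := by
  unfold wf; rw [h.ext r t ht, zero_rpow h.hm0.ne']
lemma u_eq (r t : ℝ) : U r t = wU r t ^ (1 / m) := by
  unfold wf
  rw [← rpow_mul (h.nonneg r t), mul_one_div_cancel h.hm0.ne', rpow_one]
lemma cr (t : ℝ) : Continuous (fun ρ => U ρ t) :=
  h.cont.comp (by fun_prop : Continuous fun ρ : ℝ => ((ρ, t) : ℝ × ℝ))
lemma wcr (t : ℝ) : Continuous (fun ρ => wU ρ t) :=
  h.wc.comp (by fun_prop : Continuous fun ρ : ℝ => ((ρ, t) : ℝ × ℝ))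
lemma wct (r : ℝ) : Continuous (fun t => wU r t) :=
  h.wc.comp (by fun_prop : Continuous fun t : ℝ => ((r, t) : ℝ × ℝ))
lemma Utr {t : ℝ} (ht : t ∈ Ioo 0 T) : Continuous (fun ρ => Ut ρ t) :=
  h.Utc.comp_continuous (by fun_prop : Continuous fun ρ : ℝ => ((ρ, t) : ℝ × ℝ)) (fun ρ => ⟨mem_univ _, ht⟩)
lemma Mc : Continuous (fun q : ℝ × ℝ => MU q.1 q.2) := by
  unfold Mu Mf
  apply intervalIntegral.continuous_parametric_intervalIntegral_of_continuous _ continuous_fst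
  exact ((S_cont n).comp continuous_snd).mul
    (h.cont.comp (by fun_prop : Continuous fun q : (ℝ × ℝ) × ℝ => ((q.2, q.1.2) : ℝ × ℝ)))
lemma Mcr (t : ℝ) : Continuous (fun r => MU r t) :=
  h.Mc.comp (by fun_prop : Continuous fun ρ : ℝ => ((ρ, t) : ℝ × ℝ))
lemma Mct (r : ℝ) : Continuous (fun t => MU r t) :=
  h.Mc.comp (by fun_prop : Continuous fun t : ℝ => ((r, t) : ℝ × ℝ))
lemma M_nonneg {r : ℝ} (hr : 0 ≤ r) (t : ℝ) : 0 ≤ MU r t :=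
  Mf_nonneg hr fun _ _ => h.nonneg _ t
lemma gc : Continuous (fun q : ℝ × ℝ => gU q.1 q.2) := by
  have : (fun q : ℝ × ℝ => gU q.1 q.2) = fun q : ℝ × ℝ => -∫ τ in T..q.2, wU q.1 τ := by
    ext q; unfold gf; rw [intervalIntegral.integral_symm]
  rw [this]
  apply Continuous.neg
  apply intervalIntegral.continuous_parametric_intervalIntegral_of_continuous _ continuous_snd
  exact h.wc.comp (by fun_prop : Continuous fun q : (ℝ × ℝ) × ℝ => ((q.1.1, q.2) : ℝ × ℝ))
lemma gcr (t : ℝ) : Continuous (fun r => gU r t) :=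
  h.gc.comp (by fun_prop : Continuous fun ρ : ℝ => ((ρ, t) : ℝ × ℝ))
lemma g_dt (r t : ℝ) : HasDerivAt (fun t => gU r t) (-wU r t) t :=
  intervalIntegral.integral_hasDerivAt_left ((h.wct r).intervalIntegrable _ _)
    ((h.wct r).stronglyMeasurableAtFilter _ _) (h.wct r).continuousAt
lemma g_anti (r : ℝ) : Antitone (fun t => gU r t) :=
  antitone_of_deriv_nonpos (fun t => (h.g_dt r t).differentiableAt) fun t => by
    rw [(h.g_dt r t).deriv]; linarith [h.w_nonneg r t]
lemma g_nonneg (r : ℝ) {t : ℝ} (ht : t ≤ T) : 0 ≤ gU r t := by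
  have := h.g_anti r ht
  simpa [gf] using this
lemma Pc : ContinuousOn (fun q : ℝ × ℝ => Mt q.1 q.2) (univ ×ˢ Ioo 0 T) := by
  intro q hq
  obtain ⟨a, ha0, haq⟩ := exists_between hq.2.1
  obtain ⟨b, hbq, hbT⟩ := exists_between hq.2.2
  have hab : a ≤ b := (haq.trans hbq).le
  have hcl : ∀ t, max a (min t b) ∈ Ioo 0 T := fun t =>
    ⟨ha0.trans_le (le_max_left _ _), max_lt (haq.trans hq.2.2) ((min_le_right _ _).trans_lt hbT)⟩
  have h1 : Continuous (fun q : ℝ × ℝ => Ut q.1 (max a (min q.2 b))) :=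
    h.Utc.comp_continuous (by fun_prop : Continuous fun q : ℝ × ℝ => ((q.1, max a (min q.2 b)) : ℝ × ℝ))
      (fun q => ⟨mem_univ _, hcl _⟩)
  have h2 : Continuous (fun q : ℝ × ℝ => Mu n (fun r t => Ut r (max a (min t b))) q.1 q.2) := by
    unfold Mu Mf
    apply intervalIntegral.continuous_parametric_intervalIntegral_of_continuous _ continuous_fst
    exact ((S_cont n).comp continuous_snd).mul
      (h1.comp (by fun_prop : Continuous fun q : (ℝ × ℝ) × ℝ => ((q.2, q.1.2) : ℝ × ℝ)))
  refine (h2.continuousAt.congr ?_).continuousWithinAt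
  have : univ ×ˢ Ioo a b ∈ 𝓝 q := (isOpen_univ.prod isOpen_Ioo).mem_nhds ⟨mem_univ _, haq, hbq⟩
  filter_upwards [this] with z hz
  unfold Mu
  simp only [min_eq_left hz.2.2.le, max_eq_right hz.2.1.le]
lemma M_dt {r : ℝ} (hr : 0 ≤ r) {t : ℝ} (ht : t ∈ Ioo 0 T) :
    HasDerivAt (fun t => MU r t) (Mt r t) t := by
  unfold Mu Mf
  refine hasDerivAt_param (F := fun t ρ => S n ρ * U ρ t) (F' := fun t ρ => S n ρ * Ut ρ t) hr ht ?_ ?_ ?_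
  · exact (((S_cont n).comp continuous_snd).mul
      (h.cont.comp (by fun_prop : Continuous fun q : ℝ × ℝ => ((q.2, q.1) : ℝ × ℝ)))).continuousOn
  · exact ((S_cont n).comp continuous_snd).continuousOn.mul
      (h.Utc.comp (by fun_prop : Continuous fun q : ℝ × ℝ => ((q.2, q.1) : ℝ × ℝ)).continuousOn
        fun q hq => ⟨mem_univ _, hq.1⟩)
  · exact fun x hx y _ => (h.dt y x hx).const_mul _
lemma Mbound (y a b : ℝ) : ∃ K, 0 ≤ K ∧ ∀ r ∈ Icc 0 y, ∀ t ∈ Icc a b, |MU r t| ≤ K * r * S n r := by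
  obtain ⟨K, hK⟩ := (isCompact_Icc.prod isCompact_Icc).exists_bound_of_continuousOn
    (h.cont.continuousOn (s := Icc (0:ℝ) y ×ˢ Icc a b))
  refine ⟨|K|, abs_nonneg _, fun r hr t ht => Mf_abs_le' (h.cr t) hr.1 fun x hx => ?_⟩
  exact (hK (x, t) ⟨⟨hx.1, hx.2.trans hr.2⟩, ht⟩).trans (le_abs_self _)
lemma MS_int {x y : ℝ} (hx : 0 ≤ x) (hy : 0 ≤ y) (t : ℝ) :
    IntervalIntegrable (fun r => MU r t / S n r) volume x y := Mf_div_int h.hn (h.cr t) hx hy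
lemma MS_int_cont {x y : ℝ} (hx : 0 ≤ x) (hxy : x ≤ y) :
    Continuous (fun t => ∫ r in x..y, MU r t / S n r) := by
  rw [continuous_iff_continuousAt]
  intro t
  obtain ⟨K, hK0, hK⟩ := h.Mbound y (t - 1) (t + 1)
  refine intervalIntegral.continuousAt_of_dominated_interval (bound := fun _ => K * y) ?_ ?_ (by simp) ?_
  · exact Eventually.of_forall fun s => (h.MS_int hx (hx.trans hxy) s).def'.aestronglyMeasurable
  · filter_upwards [Icc_mem_nhds (show t - 1 < t by linarith) (show t < t + 1 by linarith)] with s hs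
    refine Eventually.of_forall fun r hr => ?_
    rw [uIoc_of_le hxy] at hr
    have hr0 : 0 < r := hx.trans_lt hr.1
    rw [norm_div, norm_of_nonneg (S_pos n hr0).le, div_le_iff₀ (S_pos n hr0)]
    refine (hK r ⟨hr0.le, hr.2⟩ s hs).trans ?_
    have := S_pos n hr0
    have := hr.2
    gcongr
  · refine Eventually.of_forall fun r hr => ?_
    exact ((h.Mct r).div_const _).continuousAt
lemma g_diff {x y : ℝ} (hx : 0 ≤ x) (hxy : x ≤ y) {t : ℝ} (ht : t ∈ Ioo 0 T) :
    gU x t - gU y t = ∫ r in x..y, MU r t / S n r := by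
  have key : ∀ t2 ∈ Ioo t T, (∫ τ in t..t2, wU y τ) - (∫ τ in t..t2, wU x τ) =
      (∫ r in x..y, MU r t2 / S n r) - ∫ r in x..y, MU r t / S n r := by
    intro t2 ht2
    have hsub : ∀ τ ∈ Icc t t2, τ ∈ Ioo 0 T := fun τ hτ => ⟨ht.1.trans_le hτ.1, hτ.2.trans_lt ht2.2⟩
    rw [← intervalIntegral.integral_sub (h.MS_int hx (hx.trans hxy) t2) (h.MS_int hx (hx.trans hxy) t)]
    symm
    apply intervalIntegral.integral_eq_sub_of_hasDerivAt_of_le hxy (f := fun r => ∫ τ in t..t2, wU r τ)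
    · apply Continuous.continuousOn
      exact intervalIntegral.continuous_parametric_intervalIntegral_of_continuous
        (by exact h.wc) continuous_const
    · intro r hr
      have hr0 : 0 < r := hx.trans_lt hr.1
      have h1 : HasDerivAt (fun r => ∫ τ in t..t2, wU r τ) (∫ τ in t..t2, Mt r τ / S n r) r := by
        refine hasDerivAt_param (F := fun r τ => wU r τ) (F' := fun r τ => Mt r τ / S n r) ht2.1.le
          (c := 0) (d := y) ⟨hr0, hr.2⟩ h.wc.continuousOn ?_ ?_
        · refine (h.Pc.mono fun q hq => ⟨mem_univ _, hsub _ hq.2⟩).div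
            ((S_cont n).comp continuous_fst).continuousOn fun q hq => (S_pos n hq.1.1).ne'
        · exact fun ρ hρ τ hτ => h.dr ρ hρ.1 τ (hsub τ hτ)
      refine h1.congr_deriv ?_
      rw [intervalIntegral.integral_div, ← sub_div]
      congr 1
      apply intervalIntegral.integral_eq_sub_of_hasDerivAt_of_le ht2.1.le
      · exact (h.Mct r).continuousOn
      · exact fun τ hτ => h.M_dt hr0.le (hsub τ ⟨hτ.1.le, hτ.2.le⟩)
      · apply ContinuousOn.intervalIntegrable
        rw [uIcc_of_le ht2.1.le]
        exact h.Pc.comp (by fun_prop : Continuous fun t : ℝ => ((r, t) : ℝ × ℝ)).continuousOn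
          fun τ hτ => ⟨mem_univ _, hsub τ hτ⟩
    · exact (h.MS_int hx (hx.trans hxy) t2).sub (h.MS_int hx (hx.trans hxy) t)
  have hl : Tendsto (fun t2 => (∫ τ in t..t2, wU y τ) - (∫ τ in t..t2, wU x τ)) (𝓝[<] T)
      (𝓝 (gU y t - gU x t)) := by
    have : Continuous (fun t2 => (∫ τ in t..t2, wU y τ) - (∫ τ in t..t2, wU x τ)) :=
      (intervalIntegral.continuous_primitive (fun a b => (h.wct y).intervalIntegrable a b) t).sub
        (intervalIntegral.continuous_primitive (fun a b => (h.wct x).intervalIntegrable a b) t)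
    exact (this.tendsto T).mono_left nhdsWithin_le_nhds
  have hr : Tendsto (fun t2 => (∫ r in x..y, MU r t2 / S n r) - ∫ r in x..y, MU r t / S n r) (𝓝[<] T)
      (𝓝 ((∫ r in x..y, MU r T / S n r) - ∫ r in x..y, MU r t / S n r)) :=
    (((h.MS_int_cont hx hxy).sub continuous_const).tendsto T).mono_left nhdsWithin_le_nhds
  have hz : ∫ r in x..y, MU r T / S n r = 0 := by
    have : ∀ r, MU r T = 0 := fun r => by
      unfold Mu Mf
      simp [h.ext _ T le_rfl]
    simp [this]
  have := tendsto_nhds_unique (hl.congr' (by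
    filter_upwards [Ioo_mem_nhdsLT ht.2] with s hs using key s hs)) hr
  rw [hz] at this
  linarith
lemma g_dr {r t : ℝ} (hr : 0 < r) (ht : t ∈ Ioo 0 T) :
    HasDerivAt (fun r => gU r t) (-(MU r t / S n r)) r := by
  have hc : ∀ x > 0, ContinuousAt (fun r => MU r t / S n r) x := fun x hx =>
    (h.Mcr t).continuousAt.div (S_cont n).continuousAt (S_pos n hx).ne'
  have h1 : HasDerivAt (fun x => ∫ ρ in 0..x, MU ρ t / S n ρ) (MU r t / S n r) r := by
    refine intervalIntegral.integral_hasDerivAt_right (h.MS_int le_rfl hr.le t) ?_ (hc r hr)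
    exact ContinuousAt.stronglyMeasurableAtFilter isOpen_Ioi (fun x hx => hc x hx) r hr
  refine (h1.neg.add_const (gU 0 t)).congr_of_eventuallyEq ?_
  filter_upwards [lt_mem_nhds hr] with x hx
  have := h.g_diff le_rfl hx.le ht
  simp only [Pi.neg_apply]
  linarith
lemma g_antir {t x y : ℝ} (ht : t ∈ Ioo 0 T) (hx : 0 ≤ x) (hxy : x ≤ y) :
    gU y t ≤ gU x t := by
  have := h.g_diff hx hxy ht
  have : 0 ≤ ∫ r in x..y, MU r t / S n r := intervalIntegral.integral_nonneg hxy fun r hr =>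
    div_nonneg (h.M_nonneg (hx.trans hr.1) t) (S_nonneg n (hx.trans hr.1))
  linarith
lemma g_decay : ∃ C, 0 ≤ C ∧ ∀ r ≥ 0, ∀ t ∈ Icc (T / 2) T,
    gU r t ≤ C * (T - t) * exp (-(n * r / 2)) := by
  obtain ⟨C, hC⟩ := h.decay
  have hC0 : 0 ≤ C := by
    have h1 := hC 0 le_rfl T (by linarith [h.hT])
    have := h.w_nonneg 0 T
    simp at h1
    exact this.trans h1
  refine ⟨C, hC0, fun r hr t ht => ?_⟩
  have := intervalIntegral.integral_mono_on (μ := volume) ht.2 ((h.wct r).intervalIntegrable t T)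
    ((continuous_const (y := C * exp (-(n * r / 2)))).intervalIntegrable t T)
    (fun τ hτ => hC r hr τ (ht.1.trans hτ.1))
  simp only [intervalIntegral.integral_const, smul_eq_mul] at this
  unfold gf
  linarith
end Core
noncomputable def ex (m : ℝ) : ℝ := 1 / (1 - m)
lemma ex_gt {m : ℝ} (h0 : 0 < m) (h1 : m < 1) : 1 < ex m := by
  unfold ex; rw [lt_div_iff₀ (by linarith)]; linarith
lemma ex_mul {m : ℝ} (h1 : m < 1) : ex m * m = ex m - 1 := by
  unfold ex; have : 1 - m ≠ 0 := by linarith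
  field_simp; ring
lemma spat_max {n : ℕ} (hn : 1 ≤ n) {f hh : ℝ → ℝ} (hf : Continuous f)
    (hd : ∀ x y, 0 ≤ x → x ≤ y → hh x - hh y = ∫ r in x..y, Mf n f r / S n r) {b R : ℝ} (hb : 0 ≤ b)
    (hbR : b < R) (hmax : ∀ r ∈ Icc 0 R, hh r ≤ hh b) : 0 ≤ f b := by
  by_contra hneg
  push Not at hneg
  have hMb : Mf n f b ≤ 0 := by
    by_contra hcon
    push Not at hcon
    have hb0 : 0 < b := by
      rcases hb.eq_or_lt with h | h
      · rw [← h, Mf_zero] at hcon; exact absurd hcon (lt_irrefl _)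
      · exact h
    obtain ⟨δ, hδ, hδ2⟩ := Metric.eventually_nhds_iff.1 (((Mf_cont (n := n) hf).continuousAt (x := b)).eventually (lt_mem_nhds hcon))
    set x := max (b / 2) (b - δ / 2) with hx
    have hx0 : 0 < x := lt_max_of_lt_left (by linarith)
    have hxb : x < b := max_lt (by linarith) (by linarith)
    have hxδ : b - δ / 2 ≤ x := le_max_right _ _
    have h1 := hd x b hx0.le hxb.le
    have h2 : 0 < ∫ r in x..b, Mf n f r / S n r := by
      apply intervalIntegral.intervalIntegral_pos_of_pos_on (Mf_div_int hn hf hx0.le hb) _ hxb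
      intro r hr
      refine div_pos (hδ2 ?_) (S_pos n (hx0.trans hr.1))
      rw [dist_eq, abs_lt]; constructor <;> linarith [hr.1, hr.2]
    have := hmax x ⟨hx0.le, by linarith⟩
    linarith
  obtain ⟨δ, hδ, hδ2⟩ := Metric.eventually_nhds_iff.1 ((hf.continuousAt (x := b)).eventually (gt_mem_nhds hneg))
  set y := min R (b + δ / 2) with hy
  have hby : b < y := lt_min hbR (by linarith)
  have hyR : y ≤ R := min_le_left _ _
  have hyδ : y ≤ b + δ / 2 := min_le_right _ _
  have hMneg : ∀ r ∈ Ioo b y, Mf n f r < 0 := by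
    intro r hr
    have h1 := Mf_add (n := n) hf b r
    have h2 : 0 < ∫ ρ in b..r, -(S n ρ * f ρ) := by
      apply intervalIntegral.intervalIntegral_pos_of_pos_on _ _ hr.1
      · exact (Mf_cont_int hf).neg.intervalIntegrable _ _
      · intro ρ hρ
        have : f ρ < 0 := hδ2 (by rw [dist_eq, abs_lt]; constructor <;> linarith [hρ.1, hρ.2, hr.2])
        have := S_pos n (hb.trans_lt hρ.1)
        nlinarith
    rw [intervalIntegral.integral_neg] at h2
    linarith
  have h1 := hd b y hb hby.le
  have h2 : 0 < ∫ r in b..y, -(Mf n f r / S n r) := by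
    apply intervalIntegral.intervalIntegral_pos_of_pos_on (Mf_div_int hn hf hb (hb.trans hby.le)).neg _ hby
    intro r hr
    have := div_neg_of_neg_of_pos (hMneg r hr) (S_pos n (hb.trans_lt hr.1))
    simp only [Pi.neg_apply]
    linarith
  rw [intervalIntegral.integral_neg] at h2
  have := hmax y ⟨hb.trans hby.le, hyR⟩
  linarith
lemma half_conc {m A B : ℝ} (h0 : 0 < m) (h1 : m < 1) (hA : 0 ≤ A) (hB : 0 ≤ B) :
    (A ^ m + B ^ m) / 2 ≤ ((A + B) / 2) ^ m := by
  have := (concaveOn_rpow h0.le h1.le).2 (show A ∈ Ici 0 from hA) (show B ∈ Ici 0 from hB)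
    (show (0:ℝ) ≤ 1 / 2 by norm_num) (show (0:ℝ) ≤ 1 / 2 by norm_num) (by norm_num)
  simp only [smul_eq_mul] at this
  rw [show (A + B) / 2 = 1 / 2 * A + 1 / 2 * B by ring]
  linarith
namespace Core
variable {n : ℕ} {m T : ℝ} {U Ut : ℝ → ℝ → ℝ} (h : Core n m T U Ut)
include h
local notation "wU" => wf m U
local notation "gU" => gf m T U
local notation "MU" => Mu n U
local notation "Mt" => Mu n Ut
lemma maxpr {l r s : ℝ} (hl : 1 < l) (hr : 0 ≤ r) (hs : 0 ≤ s) (hls : l * s < T / 2) :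
    gU r (T / 2 + s) ≤ (l ^ (-ex m) * gU r (T / 2 + l * s) + l ^ (ex m) * gU r (T / 2 + s / l)) / 2 := by
  have hT := h.hT
  have hl0 : 0 < l := by linarith
  set a := ex m with ha
  have hla : 0 < l ^ a := rpow_pos_of_pos hl0 _
  have hla' : 0 < l ^ (-a) := rpow_pos_of_pos hl0 _
  have hlinv : l ^ (-a) * l ^ a = 1 := by rw [← rpow_add hl0]; simp
  set H : ℝ → ℝ → ℝ := fun r τ => gU r (T / 2 + τ) - (l ^ (-a) * gU r (T / 2 + l * τ) + l ^ a * gU r (T / 2 + τ / l)) / 2 with hH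
  by_contra hcon
  have hpos : 0 < H r s := by simp only [hH]; linarith
  obtain ⟨C, hC0, hC⟩ := h.g_decay
  obtain ⟨R, hRr, hR⟩ : ∃ R > r, C * T * exp (-(n * R / 2)) < H r s / 2 := by
    have hn' : (0:ℝ) < n := by exact_mod_cast h.hn
    have : Tendsto (fun R : ℝ => C * T * exp (-(n * R / 2))) atTop (𝓝 (C * T * 0)) := by
      apply Tendsto.const_mul
      apply tendsto_exp_neg_atTop_nhds_zero.comp
      apply Tendsto.atTop_div_const (by norm_num)
      exact tendsto_id.const_mul_atTop hn'
    rw [mul_zero] at this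
    obtain ⟨R, h1, h2⟩ := ((eventually_gt_atTop r).and (this.eventually (gt_mem_nhds (show 0 < H r s / 2 by linarith)))).exists
    exact ⟨R, h1, h2⟩
  have htime : ∀ τ ∈ Icc 0 s, T / 2 + τ ∈ Ico (T/2) T ∧ T / 2 + l * τ ∈ Ico (T/2) T ∧ T / 2 + τ / l ∈ Ico (T/2) T := by
    intro τ hτ
    have a1 : l * τ ≤ l * s := by nlinarith [hτ.2]
    have a2 : τ ≤ l * τ := by nlinarith [hτ.1]
    have a3 : τ / l ≤ τ := div_le_self hτ.1 hl.le
    have a4 : 0 ≤ τ / l := div_nonneg hτ.1 hl0.le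
    refine ⟨⟨?_, ?_⟩, ⟨?_, ?_⟩, ?_, ?_⟩ <;> linarith [hτ.1]
  set η := H r s / (2 * T) with hη
  have hη0 : 0 < η := by positivity
  have hcont : Continuous (fun q : ℝ × ℝ => H q.1 q.2 - η * q.2) := by
    have c1 := h.gc.comp (by fun_prop : Continuous fun q : ℝ × ℝ => ((q.1, T / 2 + q.2) : ℝ × ℝ))
    have c2 := h.gc.comp (by fun_prop : Continuous fun q : ℝ × ℝ => ((q.1, T / 2 + l * q.2) : ℝ × ℝ))
    have c3 := h.gc.comp (by fun_prop : Continuous fun q : ℝ × ℝ => ((q.1, T / 2 + q.2 / l) : ℝ × ℝ))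
    exact (c1.sub (((continuous_const.mul c2).add (continuous_const.mul c3)).div_const 2)).sub (by fun_prop)
  have hmemr : (r, s) ∈ Icc 0 R ×ˢ Icc 0 s := ⟨⟨hr, hRr.le⟩, hs, le_rfl⟩
  obtain ⟨⟨b, τ⟩, ⟨hb, hτ⟩, hmax⟩ := (isCompact_Icc.prod isCompact_Icc).exists_isMaxOn ⟨(r, s), hmemr⟩ (hcont.continuousOn (s := Icc 0 R ×ˢ Icc 0 s))
  have hmax' : ∀ x ∈ Icc 0 R, ∀ y ∈ Icc 0 s, H x y - η * y ≤ H b τ - η * τ := fun x hx y hy => hmax (show (x, y) ∈ Icc 0 R ×ˢ Icc 0 s from ⟨hx, hy⟩)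
  simp only at hb hτ
  have hss : s < T := by nlinarith
  have hbig : H r s / 2 ≤ H b τ - η * τ := by
    have h1 := hmax' r ⟨hr, hRr.le⟩ s ⟨hs, le_rfl⟩
    have : η * s ≤ H r s / 2 := by
      have : η * T = H r s / 2 := by rw [hη]; field_simp
      nlinarith
    linarith
  have hbig2 : 0 < H b τ := by nlinarith [mul_nonneg hη0.le hτ.1]
  have hτ0 : 0 < τ := by
    rcases hτ.1.eq_or_lt with h0 | h0
    · exfalso
      rw [← h0] at hbig2
      simp only [hH, mul_zero, zero_div, add_zero] at hbig2
      have hg := h.g_nonneg b (show T / 2 ≤ T by linarith)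
      have : 2 ≤ l ^ (-a) + l ^ a := by nlinarith [sq_nonneg (l ^ (-a) - l ^ a), sq_nonneg (l ^ (-a) + l ^ a - 2)]
      nlinarith
    · exact h0
  have ht3 := htime τ hτ
  have hbR : b < R := by
    rcases hb.2.eq_or_lt with h0 | h0
    · exfalso
      have g1 := hC b hb.1 (T / 2 + τ) ⟨ht3.1.1, ht3.1.2.le⟩
      have g2 := mul_nonneg hla'.le (h.g_nonneg b ht3.2.1.2.le)
      have g3 := mul_nonneg hla.le (h.g_nonneg b ht3.2.2.2.le)
      have : H b τ ≤ gU b (T / 2 + τ) := by simp only [hH]; linarith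
      have g4 : C * (T - (T / 2 + τ)) * exp (-(n * b / 2)) ≤ C * T * exp (-(n * b / 2)) := by
        gcongr; linarith
      rw [h0] at g4 g1
      rw [h0] at this
      have := mul_nonneg hη0.le hτ.1
      rw [h0] at hbig
      linarith
    · exact h0
  have hIoo : ∀ t, t ∈ Ico (T / 2) T → t ∈ Ioo 0 T := fun t ht => ⟨by linarith [ht.1], ht.2⟩
  have hf0 : 0 ≤ U b (T / 2 + τ) - (l ^ (-a) * U b (T / 2 + l * τ) + l ^ a * U b (T / 2 + τ / l)) / 2 := by
    refine spat_max h.hn (f := fun b => U b (T / 2 + τ) - (l ^ (-a) * U b (T / 2 + l * τ) + l ^ a * U b (T / 2 + τ / l)) / 2)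
      (hh := fun r => H r τ) ?_ ?_ hb.1 hbR (fun x hx => by linarith [hmax' x hx τ hτ])
    · exact (h.cr _).sub (((continuous_const.mul (h.cr _)).add (continuous_const.mul (h.cr _))).div_const 2)
    · intro x y hx hxy
      have e : ∀ r, Mf n (fun b => U b (T / 2 + τ) - (l ^ (-a) * U b (T / 2 + l * τ) + l ^ a * U b (T / 2 + τ / l)) / 2) r
          = MU r (T / 2 + τ) - (l ^ (-a) * MU r (T / 2 + l * τ) + l ^ a * MU r (T / 2 + τ / l)) / 2 := by
        intro r
        have c1 := (Mf_cont_int (n := n) (h.cr (T / 2 + τ))).intervalIntegrable (μ := volume) 0 r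
        have c2 := (Mf_cont_int (n := n) (h.cr (T / 2 + l * τ))).intervalIntegrable (μ := volume) 0 r
        have c3 := (Mf_cont_int (n := n) (h.cr (T / 2 + τ / l))).intervalIntegrable (μ := volume) 0 r
        unfold Mu Mf
        rw [← intervalIntegral.integral_const_mul, ← intervalIntegral.integral_const_mul,
          ← intervalIntegral.integral_add (c2.const_mul _) (c3.const_mul _), ← intervalIntegral.integral_div,
          ← intervalIntegral.integral_sub c1 (((c2.const_mul _).add (c3.const_mul _)).div_const 2)]
        congr 1; ext ρ; ring
      simp_rw [e]
      have hy := hx.trans hxy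
      have c1 := h.MS_int hx hy (T / 2 + τ)
      have c2 := h.MS_int hx hy (T / 2 + l * τ)
      have c3 := h.MS_int hx hy (T / 2 + τ / l)
      have d1 := h.g_diff hx hxy (hIoo _ ht3.1)
      have d2 := h.g_diff hx hxy (hIoo _ ht3.2.1)
      have d3 := h.g_diff hx hxy (hIoo _ ht3.2.2)
      have : (∫ r in x..y, (MU r (T / 2 + τ) - (l ^ (-a) * MU r (T / 2 + l * τ) + l ^ a * MU r (T / 2 + τ / l)) / 2) / S n r)
          = ∫ r in x..y, (MU r (T / 2 + τ) / S n r - (l ^ (-a) * (MU r (T / 2 + l * τ) / S n r) + l ^ a * (MU r (T / 2 + τ / l) / S n r)) / 2) := by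
        congr 1; ext r; ring
      rw [this, intervalIntegral.integral_sub c1 (((c2.const_mul _).add (c3.const_mul _)).div_const 2),
        intervalIntegral.integral_div, intervalIntegral.integral_add (c2.const_mul _) (c3.const_mul _),
        intervalIntegral.integral_const_mul, intervalIntegral.integral_const_mul, ← d1, ← d2, ← d3]
      simp only [hH]; ring
  have hw : (l ^ (1 - a) * wU b (T / 2 + l * τ) + l ^ (a - 1) * wU b (T / 2 + τ / l)) / 2 ≤ wU b (T / 2 + τ) := by
    have u1 := h.nonneg b (T / 2 + l * τ)
    have u2 := h.nonneg b (T / 2 + τ / l)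
    have e1 : l ^ (1 - a) * wU b (T / 2 + l * τ) = (l ^ (-a) * U b (T / 2 + l * τ)) ^ m := by
      unfold wf
      rw [mul_rpow hla'.le u1, ← rpow_mul hl0.le, neg_mul, ha, ex_mul h.hm1, neg_sub]
    have e2 : l ^ (a - 1) * wU b (T / 2 + τ / l) = (l ^ a * U b (T / 2 + τ / l)) ^ m := by
      unfold wf
      rw [mul_rpow hla.le u2, ← rpow_mul hl0.le, ha, ex_mul h.hm1]
    rw [e1, e2]
    refine (half_conc h.hm0 h.hm1 (by positivity) (by positivity)).trans ?_
    unfold wf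
    exact rpow_le_rpow (by positivity) (by linarith) h.hm0.le
  have hder : HasDerivAt (fun y => H b y - η * y)
      (-wU b (T / 2 + τ) + (l ^ (1 - a) * wU b (T / 2 + l * τ) + l ^ (a - 1) * wU b (T / 2 + τ / l)) / 2 - η) τ := by
    have d1 : HasDerivAt (fun y => gU b (T / 2 + y)) (-wU b (T / 2 + τ)) τ := by
      simpa using (h.g_dt b (T / 2 + τ)).comp_const_add (T / 2) τ
    have d2 : HasDerivAt (fun y => gU b (T / 2 + l * y)) (-wU b (T / 2 + l * τ) * l) τ := by
      have := (h.g_dt b (T / 2 + l * τ)).comp τ (((hasDerivAt_id' τ).const_mul l).const_add (T / 2))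
      rw [mul_one] at this
      exact this
    have d3 : HasDerivAt (fun y => gU b (T / 2 + y / l)) (-wU b (T / 2 + τ / l) * (1 / l)) τ := by
      exact (h.g_dt b (T / 2 + τ / l)).comp τ (((hasDerivAt_id' τ).div_const l).const_add (T / 2))
    refine ((d1.sub (((d2.const_mul (l ^ (-a))).add (d3.const_mul (l ^ a))).div_const 2)).sub ((hasDerivAt_id τ).const_mul η)).congr_deriv ?_
    have e1 : l ^ (1 - a) = l ^ (-a) * l := by rw [sub_eq_add_neg, rpow_add hl0, rpow_one]; ring
    have e2 : l ^ (a - 1) = l ^ a / l := rpow_sub_one hl0.ne' a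
    rw [e1, e2]; field_simp; ring
  have hge : 0 ≤ -wU b (T / 2 + τ) + (l ^ (1 - a) * wU b (T / 2 + l * τ) + l ^ (a - 1) * wU b (T / 2 + τ / l)) / 2 - η := by
    have hsl := hder.tendsto_slope.mono_left (nhdsWithin_mono τ (show Iio τ ⊆ {τ}ᶜ from fun x hx => (ne_of_lt hx)))
    refine ge_of_tendsto hsl ?_
    filter_upwards [Ioo_mem_nhdsLT hτ0] with y hy
    rw [slope_def_field]
    have := hmax' b hb y ⟨hy.1.le, hy.2.le.trans hτ.2⟩
    exact div_nonneg_of_nonpos (by linarith) (by linarith [hy.2])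
  linarith
end Core
lemma midconv_deriv {φ : ℝ → ℝ} {B x y d1 d2 : ℝ}
    (hmid : ∀ σ δ, 0 < δ → σ + δ < B → 2 * φ σ ≤ φ (σ + δ) + φ (σ - δ))
    (hx : HasDerivAt φ d1 x) (hy : HasDerivAt φ d2 y) (hxy : x < y) (hyB : y < B) : d1 ≤ d2 := by
  set δ : ℕ → ℝ := fun k => (y - x) / (k + 1) with hδ
  have hδ0 : ∀ k, 0 < δ k := fun k => div_pos (by linarith) (by positivity)
  have hδt : Tendsto δ atTop (𝓝 0) := by
    have := (tendsto_one_div_add_atTop_nhds_zero_nat (𝕜 := ℝ)).const_mul (y - x)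
    simp only [mul_zero] at this
    refine this.congr fun k => ?_
    simp only [hδ]; ring
  have hinc : ∀ k : ℕ, ∀ j : ℕ, j ≤ k → φ (x + δ k) - φ x ≤ φ (x + (j + 1) * δ k) - φ (x + j * δ k) := by
    intro k j
    induction j with
    | zero => intro _; simp
    | succ j ih =>
      intro hj
      have h1 := ih (by omega)
      have hk : (j + 1 + 1 : ℝ) ≤ k + 1 := by exact_mod_cast Nat.succ_le_succ hj
      have h3 : (k + 1) * δ k = y - x := by simp only [hδ]; field_simp
      have h2 := hmid (x + (j + 1) * δ k) (δ k) (hδ0 k) (by nlinarith [hδ0 k])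
      push_cast
      rw [show x + (j + 1) * δ k + δ k = x + (j + 1 + 1) * δ k by ring, show x + (j + 1) * δ k - δ k = x + j * δ k by ring] at h2
      linarith
  have s1 : Tendsto (fun k => slope φ x (x + δ k)) atTop (𝓝 d1) := by
    refine hx.tendsto_slope.comp (tendsto_nhdsWithin_iff.2 ⟨?_, ?_⟩)
    · simpa using hδt.const_add x
    · exact Eventually.of_forall fun k => by simp [(hδ0 k).ne']
  have s2 : Tendsto (fun k => slope φ y (y - δ k)) atTop (𝓝 d2) := by
    refine hy.tendsto_slope.comp (tendsto_nhdsWithin_iff.2 ⟨?_, ?_⟩)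
    · simpa using hδt.const_sub y
    · exact Eventually.of_forall fun k => by simp [(hδ0 k).ne']
  refine le_of_tendsto_of_tendsto' s1 s2 fun k => ?_
  have h1 := hinc k k le_rfl
  have h3 : (k + 1) * δ k = y - x := by simp only [hδ]; field_simp
  rw [h3, show x + k * δ k = y - δ k by linarith] at h1
  rw [slope_def_field, slope_def_field]
  rw [show x + δ k - x = δ k by ring, show y - δ k - y = -δ k by ring, div_neg, ← neg_div]
  rw [show x + (y - x) = y by ring] at h1
  gcongr
  linarith
namespace Core
variable {n : ℕ} {m T : ℝ} {U Ut : ℝ → ℝ → ℝ} (h : Core n m T U Ut)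
include h
local notation "wU" => wf m U
local notation "gU" => gf m T U
local notation "MU" => Mu n U
local notation "Mt" => Mu n Ut
lemma K_anti {r t t' : ℝ} (hr : 0 ≤ r) (ht : T / 2 < t) (htt : t ≤ t') (ht' : t' < T) :
    (t' - T / 2) ^ (-ex m) * (ex m * gU r t' + (t' - T / 2) * wU r t') ≤
    (t - T / 2) ^ (-ex m) * (ex m * gU r t + (t - T / 2) * wU r t) := by
  rcases htt.eq_or_lt with rfl | hlt
  · exact le_rfl
  set a := ex m
  set φ : ℝ → ℝ := fun σ => exp (-a * σ) * gU r (T / 2 + exp σ) with hφ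
  have hT := h.hT
  have hd : ∀ s, T / 2 < s → HasDerivAt φ (-((s - T / 2) ^ (-a) * (a * gU r s + (s - T / 2) * wU r s))) (log (s - T / 2)) := by
    intro s hs
    have hs0 : 0 < s - T / 2 := by linarith
    set σ := log (s - T / 2) with hσ
    have e1 : exp σ = s - T / 2 := exp_log hs0
    have e2 : exp (-a * σ) = (s - T / 2) ^ (-a) := by rw [rpow_def_of_pos hs0, mul_comm]
    have d1 : HasDerivAt (fun σ => exp (-a * σ)) (exp (-a * σ) * (-a * 1)) σ := ((hasDerivAt_id' σ).const_mul (-a)).exp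
    have d2 : HasDerivAt (fun σ => gU r (T / 2 + exp σ)) (-wU r (T / 2 + exp σ) * exp σ) σ :=
      HasDerivAt.comp (h₂ := fun t => gU r t) σ (h.g_dt r (T / 2 + exp σ)) ((hasDerivAt_exp σ).const_add (T / 2))
    refine (d1.mul d2).congr_deriv ?_
    rw [e1, e2, show T / 2 + (s - T / 2) = s by ring]
    ring
  have := midconv_deriv (φ := φ) (B := log (T / 2)) ?_ (hd t ht) (hd t' (ht.trans hlt))
    (log_lt_log (by linarith) (by linarith)) (log_lt_log (by linarith) (by linarith))
  · linarith
  · intro σ δ hδ hσ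
    have h1 := h.maxpr (l := exp δ) (r := r) (s := exp σ) (one_lt_exp_iff.2 hδ) hr (exp_pos _).le (by
      rw [← exp_add, ← exp_log (show 0 < T / 2 by linarith)]; apply exp_lt_exp.2; linarith)
    rw [← exp_add, ← exp_sub, add_comm δ σ] at h1
    rw [rpow_def_of_pos (exp_pos _), rpow_def_of_pos (exp_pos _), log_exp] at h1
    simp only [hφ]
    have e1 : exp (-a * (σ + δ)) = exp (-a * σ) * exp (δ * (-ex m)) := by rw [← exp_add]; congr 1; ring
    have e2 : exp (-a * (σ - δ)) = exp (-a * σ) * exp (δ * ex m) := by rw [← exp_add]; congr 1; ring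
    rw [e1, e2]
    have := exp_pos (-a * σ)
    nlinarith
lemma w_low {r t s t' : ℝ} (hr : 0 ≤ r) (ht : T / 2 < t) (hts : t ≤ s) (hst : s ≤ t') (ht' : t' < T) :
    ((t - T / 2) / (t' - T / 2)) ^ (ex m - 1) * wU r t' - ex m * gU r t / (t - T / 2) ≤ wU r s := by
  have hk := h.K_anti hr (ht.trans_le hts) hst ht'
  have ha := ex_gt h.hm0 h.hm1
  set a := ex m
  have p0 : 0 < t - T / 2 := by linarith
  have p1 : 0 < s - T / 2 := by linarith
  have p2 : 0 < t' - T / 2 := by linarith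
  have g1 := h.g_nonneg r ht'.le
  have g2 := h.g_nonneg r (hst.trans ht'.le)
  have g3 : gU r s ≤ gU r t := h.g_anti r hts
  have w1 := h.w_nonneg r t'
  have k2 : (s - T / 2) ^ (a - 1) * (t' - T / 2) ^ (1 - a) * wU r t' ≤ wU r s + a * gU r s / (s - T / 2) := by
    have q1 : 0 < (s - T / 2) ^ (a - 1) := rpow_pos_of_pos p1 _
    have q2 : 0 < (t' - T / 2) ^ (-a) := rpow_pos_of_pos p2 _
    have e1 : (t' - T / 2) ^ (1 - a) = (t' - T / 2) ^ (-a) * (t' - T / 2) := by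
      rw [show 1 - a = -a + 1 by ring, rpow_add p2, rpow_one]
    have e2 : (s - T / 2) ^ (a - 1) * (s - T / 2) ^ (-a) = (s - T / 2)⁻¹ := by
      rw [← rpow_add p1, show a - 1 + -a = -1 by ring, rpow_neg_one]
    have := mul_le_mul_of_nonneg_left hk q1.le
    rw [← mul_assoc _ _ (a * gU r s + _), e2] at this
    have e3 : (s - T / 2)⁻¹ * (a * gU r s + (s - T / 2) * wU r s) = wU r s + a * gU r s / (s - T / 2) := by
      rw [mul_add, inv_mul_cancel_left₀ p1.ne']; ring
    rw [e3] at this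
    rw [e1]
    have : 0 ≤ (s - T / 2) ^ (a - 1) * ((t' - T / 2) ^ (-a) * (a * gU r t')) := by positivity
    linarith
  have k3 : ((t - T / 2) / (t' - T / 2)) ^ (a - 1) ≤ (s - T / 2) ^ (a - 1) * (t' - T / 2) ^ (1 - a) := by
    rw [div_rpow p0.le p2.le, show (1 - a) = -(a - 1) by ring, rpow_neg p2.le, div_eq_mul_inv]
    gcongr
  have k4 : a * gU r s / (s - T / 2) ≤ a * gU r t / (t - T / 2) := by
    have : 0 ≤ gU r t := g2.trans g3
    have : 0 ≤ a * gU r t := by positivity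
    gcongr
  have := mul_le_mul_of_nonneg_right k3 w1
  linarith
lemma w_upp {r t s : ℝ} (hr : 0 ≤ r) (ht : T / 2 < t) (hts : t ≤ s) (hsT : s < T) :
    wU r s ≤ ((s - T / 2) / (t - T / 2)) ^ (ex m - 1) * (wU r t + ex m * gU r t / (t - T / 2)) := by
  have hk := h.K_anti hr ht hts hsT
  have ha := ex_gt h.hm0 h.hm1
  set a := ex m
  have p0 : 0 < t - T / 2 := by linarith
  have p1 : 0 < s - T / 2 := by linarith
  have g2 := h.g_nonneg r hsT.le
  have q1 : 0 < (s - T / 2) ^ (a - 1) := rpow_pos_of_pos p1 _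
  have e2 : (s - T / 2) ^ (a - 1) * (s - T / 2) ^ (-a) = (s - T / 2)⁻¹ := by
    rw [← rpow_add p1, show a - 1 + -a = -1 by ring, rpow_neg_one]
  have := mul_le_mul_of_nonneg_left hk q1.le
  rw [← mul_assoc _ _ (a * gU r s + _), e2] at this
  have e3 : (s - T / 2)⁻¹ * (a * gU r s + (s - T / 2) * wU r s) = wU r s + a * gU r s / (s - T / 2) := by
    rw [mul_add, inv_mul_cancel_left₀ p1.ne']; ring
  have e4 : (s - T / 2) ^ (a - 1) * ((t - T / 2) ^ (-a) * (a * gU r t + (t - T / 2) * wU r t))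
     = ((s - T / 2) / (t - T / 2)) ^ (a - 1) * (wU r t + a * gU r t / (t - T / 2)) := by
    rw [div_rpow p1.le p0.le, show -a = -(a-1) - 1 by ring, rpow_sub_one p0.ne', rpow_neg p0.le]
    generalize t - T / 2 = x at *
    field_simp
    ring
  rw [e3, e4] at this
  have : 0 ≤ a * gU r s / (s - T / 2) := by positivity
  linarith
lemma g_sub (r t t' : ℝ) : gU r t - gU r t' = ∫ s in t..t', wU r s := by
  have := intervalIntegral.integral_add_adjacent_intervals (μ := volume) ((h.wct r).intervalIntegrable t t') ((h.wct r).intervalIntegrable t' T)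
  unfold gf
  linarith
lemma UB {r t t' : ℝ} (hr : 0 ≤ r) (ht : T / 2 < t) (htt : t ≤ t') (ht' : t' < T) :
    (t' - t) * (((t - T / 2) / (t' - T / 2)) ^ (ex m - 1) * wU r t') ≤
      gU r t - gU r t' + (t' - t) * (ex m * gU r t / (t - T / 2)) := by
  have := intervalIntegral.integral_mono_on (μ := volume) htt
    ((continuous_const (y := ((t - T / 2) / (t' - T / 2)) ^ (ex m - 1) * wU r t' - ex m * gU r t / (t - T / 2))).intervalIntegrable t t')
    ((h.wct r).intervalIntegrable t t') (fun s hs => h.w_low hr ht hs.1 hs.2 ht')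
  rw [← h.g_sub, intervalIntegral.integral_const, smul_eq_mul] at this
  linarith
lemma LB {r t t' : ℝ} (hr : 0 ≤ r) (ht : T / 2 < t) (htt : t ≤ t') (ht' : t' < T) :
    gU r t - gU r t' ≤
      (t' - t) * (((t' - T / 2) / (t - T / 2)) ^ (ex m - 1) * (wU r t + ex m * gU r t / (t - T / 2))) := by
  have ha := ex_gt h.hm0 h.hm1
  have p0 : 0 < t - T / 2 := by linarith
  have g1 := h.g_nonneg r (htt.trans ht'.le)
  have w1 := h.w_nonneg r t
  have := intervalIntegral.integral_mono_on (μ := volume) htt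
    ((h.wct r).intervalIntegrable t t')
    ((continuous_const (y := ((t' - T / 2) / (t - T / 2)) ^ (ex m - 1) * (wU r t + ex m * gU r t / (t - T / 2)))).intervalIntegrable t t')
     (fun s hs => (h.w_upp hr ht hs.1 (hs.2.trans_lt ht')).trans (by
      have := hs.1; have := hs.2
      have : 0 ≤ s - T / 2 := by linarith
      have : 0 ≤ ex m := by linarith
      gcongr))
  rw [← h.g_sub, intervalIntegral.integral_const, smul_eq_mul] at this
  linarith
end Core
lemma MdivS_contOn {n : ℕ} (hn : 1 ≤ n) {f : ℝ → ℝ → ℝ} {c d : ℝ}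
    (hf : ContinuousOn (fun q : ℝ × ℝ => f q.1 q.2) (univ ×ˢ Ioo c d))
    (hM : ContinuousOn (fun q : ℝ × ℝ => Mu n f q.1 q.2) (univ ×ˢ Ioo c d)) :
    ContinuousOn (fun q : ℝ × ℝ => Mu n f q.1 q.2 / S n q.1) (Ici 0 ×ˢ Ioo c d) := by
  have hfr : ∀ t ∈ Ioo c d, Continuous (fun ρ => f ρ t) := fun t ht =>
    hf.comp_continuous (by fun_prop : Continuous fun ρ : ℝ => ((ρ, t) : ℝ × ℝ)) (fun ρ => ⟨mem_univ _, ht⟩)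
  rintro ⟨r, t⟩ ⟨hr, ht⟩
  simp only [mem_Ici] at hr ht
  rcases hr.eq_or_lt with h0 | h0
  · subst h0
    obtain ⟨a, ha0, hat⟩ := exists_between ht.1
    obtain ⟨b, htb, hbd⟩ := exists_between ht.2
    obtain ⟨K, hK⟩ := (isCompact_Icc.prod isCompact_Icc).exists_bound_of_continuousOn
      (hf.mono (fun q hq => ⟨mem_univ _, ha0.trans_le hq.2.1, hq.2.2.trans_lt hbd⟩ : Icc (0:ℝ) 1 ×ˢ Icc a b ⊆ univ ×ˢ Ioo c d))
    have hlim : Tendsto (fun q : ℝ × ℝ => |K| * q.1) (𝓝[Ici 0 ×ˢ Ioo c d] (0, t)) (𝓝 0) := by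
      have : Continuous (fun q : ℝ × ℝ => |K| * q.1) := by fun_prop
      have := this.tendsto (0, t)
      simp only [mul_zero] at this
      exact this.mono_left nhdsWithin_le_nhds
    have hz : Mu n f 0 t / S n 0 = 0 := by simp [Mu]
    unfold ContinuousWithinAt
    simp only [hz]
    refine squeeze_zero_norm' ?_ hlim
    have hnb : Iio (1:ℝ) ×ˢ Ioo a b ∈ 𝓝 ((0:ℝ), t) := (isOpen_Iio.prod isOpen_Ioo).mem_nhds ⟨by simp, hat, htb⟩
    filter_upwards [self_mem_nhdsWithin, mem_nhdsWithin_of_mem_nhds hnb] with q hq hq'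
    have hq0 : 0 ≤ q.1 := hq.1
    rcases hq0.eq_or_lt with h | h
    · rw [← h]; simp [Mu]
    · rw [norm_div, norm_of_nonneg (S_nonneg n hq0), div_le_iff₀ (S_pos n h)]
      refine Mf_abs_le' (hfr _ hq.2) hq0 fun x hx => ?_
      exact (hK (x, q.2) ⟨⟨hx.1, hx.2.trans (le_of_lt hq'.1)⟩, hq'.2.1.le, hq'.2.2.le⟩).trans (le_abs_self _)
  · have h1 : ContinuousAt (fun q : ℝ × ℝ => Mu n f q.1 q.2) (r, t) :=
      hM.continuousAt ((isOpen_univ.prod isOpen_Ioo).mem_nhds ⟨mem_univ _, ht⟩)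
    exact (h1.div ((S_cont n).comp continuous_fst).continuousAt (S_pos n h0).ne').continuousWithinAt
namespace Core
variable {n : ℕ} {m T : ℝ} {U Ut : ℝ → ℝ → ℝ} (h : Core n m T U Ut)
include h
local notation "wU" => wf m U
local notation "gU" => gf m T U
local notation "MU" => Mu n U
local notation "Mt" => Mu n Ut
lemma MSc : ContinuousOn (fun q : ℝ × ℝ => MU q.1 q.2 / S n q.1) (Ici 0 ×ˢ Ioo 0 T) :=
  MdivS_contOn h.hn h.cont.continuousOn h.Mc.continuousOn
lemma PSc : ContinuousOn (fun q : ℝ × ℝ => Mt q.1 q.2 / S n q.1) (Ici 0 ×ˢ Ioo 0 T) :=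
  MdivS_contOn h.hn h.Utc h.Pc
lemma Pcr {t : ℝ} (ht : t ∈ Ioo 0 T) : Continuous (fun r => Mt r t) := Mf_cont (h.Utr ht)
lemma ibp {f : ℝ → ℝ} (hf : Continuous f) {t R : ℝ} (ht : t ∈ Ioo 0 T) (hR : 0 ≤ R) :
    ∫ r in 0..R, Mf n f r * (Mt r t / S n r) = Mf n f R * wU R t - ∫ r in 0..R, S n r * f r * wU r t := by
  have i1 : IntervalIntegrable (fun r => Mf n f r * (Mt r t / S n r)) volume 0 R := by
    apply ContinuousOn.intervalIntegrable
    rw [uIcc_of_le hR]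
    exact (Mf_cont hf).continuousOn.mul ((Mf_div_contOn h.hn (h.Utr ht)).mono Icc_subset_Ici_self)
  have i2 : IntervalIntegrable (fun r => S n r * f r * wU r t) volume 0 R :=
    ((Mf_cont_int hf).mul (h.wcr t)).intervalIntegrable _ _
  have := intervalIntegral.integral_eq_sub_of_hasDerivAt_of_le hR (f := fun r => Mf n f r * wU r t)
    ((Mf_cont hf).mul (h.wcr t)).continuousOn
    (fun r hr => (Mf_hasDerivAt (n := n) hf r).mul (h.dr r hr.1 t ht)) (by
      refine (i2.add i1).congr fun r hr => ?_
      rfl)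
  have e : (∫ r in 0..R, (S n r * f r * wU r t + Mf n f r * (Mf n (fun ρ => Ut ρ t) r / S n r))) =
    (∫ r in 0..R, S n r * f r * wU r t) + ∫ r in 0..R, Mf n f r * (Mt r t / S n r) :=
    intervalIntegral.integral_add i2 i1
  rw [e] at this
  simp only [Mf_zero, zero_mul, sub_zero] at this
  linarith
lemma yR_dt {t R : ℝ} (ht : t ∈ Ioo 0 T) (hR : 0 ≤ R) :
    HasDerivAt (fun t => ∫ r in 0..R, S n r * U r t * wU r t) ((1 + m) * ∫ r in 0..R, S n r * Ut r t * wU r t) t := by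
  rw [← intervalIntegral.integral_const_mul]
  have csw : Continuous fun q : ℝ × ℝ => ((q.2, q.1) : ℝ × ℝ) := by fun_prop
  refine hasDerivAt_param (F := fun t r => S n r * U r t * wU r t)
    (F' := fun t r => (1 + m) * (S n r * Ut r t * wU r t)) hR ht ?_ ?_ ?_
  · exact ((((S_cont n).comp continuous_snd).mul (h.cont.comp csw)).mul (h.wc.comp csw)).continuousOn
  · refine continuousOn_const.mul ((((S_cont n).comp continuous_snd).continuousOn.mul ?_).mul (h.wc.comp csw).continuousOn)
    exact h.Utc.comp csw.continuousOn fun q hq => ⟨mem_univ _, hq.1⟩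
  · intro t ht r hr
    have d1 := h.dt r t ht
    have hp := h.pos r t ht
    have d2 := d1.rpow_const (p := m) (Or.inl hp.ne')
    refine ((d1.const_mul (S n r)).mul d2).congr_deriv ?_
    unfold wf
    rw [rpow_sub_one hp.ne']
    field_simp
lemma ER_dt {t R : ℝ} (ht : t ∈ Ioo 0 T) (hR : 0 ≤ R) :
    HasDerivAt (fun t => ∫ r in 0..R, MU r t * (MU r t / S n r)) (2 * ∫ r in 0..R, MU r t * (Mt r t / S n r)) t := by
  rw [← intervalIntegral.integral_const_mul]
  have csw : Continuous fun q : ℝ × ℝ => ((q.2, q.1) : ℝ × ℝ) := by fun_prop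
  have hsub : MapsTo (fun q : ℝ × ℝ => ((q.2, q.1) : ℝ × ℝ)) (Ioo 0 T ×ˢ Icc 0 R) (Ici 0 ×ˢ Ioo 0 T) :=
    fun q hq => ⟨hq.2.1, hq.1⟩
  refine hasDerivAt_param (F := fun t r => MU r t * (MU r t / S n r))
    (F' := fun t r => 2 * (MU r t * (Mt r t / S n r))) hR ht ?_ ?_ ?_
  · exact (h.Mc.comp csw).continuousOn.mul (h.MSc.comp csw.continuousOn hsub)
  · exact continuousOn_const.mul ((h.Mc.comp csw).continuousOn.mul (h.PSc.comp csw.continuousOn hsub))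
  · intro t ht r hr
    have d1 := h.M_dt hr.1 ht
    refine (d1.mul (d1.div_const (S n r))).congr_deriv ?_
    ring
omit h in
lemma par_cont {F : ℝ → ℝ → ℝ} {R : ℝ} (hR : 0 ≤ R)
    (hF : ContinuousOn (fun q : ℝ × ℝ => F q.1 q.2) (Ici 0 ×ˢ Ioo 0 T)) :
    ContinuousOn (fun t => ∫ r in 0..R, F r t) (Ioo 0 T) := by
  intro t ht
  apply ContinuousAt.continuousWithinAt
  obtain ⟨a, ha0, hat⟩ := exists_between ht.1
  obtain ⟨b, htb, hbd⟩ := exists_between ht.2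
  obtain ⟨K, hK⟩ := (isCompact_Icc.prod isCompact_Icc).exists_bound_of_continuousOn
    (hF.mono (fun q hq => ⟨hq.1.1, ha0.trans_le hq.2.1, hq.2.2.trans_lt hbd⟩ : Icc (0:ℝ) R ×ˢ Icc a b ⊆ Ici 0 ×ˢ Ioo 0 T))
  refine intervalIntegral.continuousAt_of_dominated_interval (bound := fun _ => K) ?_ ?_ (by simp) ?_
  · filter_upwards [Ioo_mem_nhds hat htb] with s hs
    refine (ContinuousOn.intervalIntegrable ?_).def'.aestronglyMeasurable
    rw [uIcc_of_le hR]
    exact hF.comp (by fun_prop : Continuous fun y : ℝ => ((y, s) : ℝ × ℝ)).continuousOn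
      fun y hy => ⟨hy.1, ha0.trans hs.1, hs.2.trans hbd⟩
  · filter_upwards [Ioo_mem_nhds hat htb] with s hs
    refine Eventually.of_forall fun r hr => ?_
    rw [uIoc_of_le hR] at hr
    exact hK (r, s) ⟨⟨hr.1.le, hr.2⟩, hs.1.le, hs.2.le⟩
  · refine Eventually.of_forall fun r hr => ?_
    rw [uIoc_of_le hR] at hr
    have : ContinuousOn (fun t => F r t) (Ioo 0 T) := hF.comp (by fun_prop : Continuous fun t : ℝ => ((r, t) : ℝ × ℝ)).continuousOn
      fun y hy => ⟨hr.1.le, hy⟩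
    exact this.continuousAt (Ioo_mem_nhds ht.1 ht.2)
end Core
lemma int_exp_lin {c : ℝ} (hc : c ≠ 0) (r : ℝ) : ∫ x in (0:ℝ)..r, exp (c * x) = (exp (c * r) - 1) / c := by
  have hd : ∀ x ∈ uIcc 0 r, HasDerivAt (fun x => exp (c * x) / c) (exp (c * x)) x := fun x _ => by
    have := (((hasDerivAt_id' x).const_mul c).exp).div_const c
    refine this.congr_deriv ?_
    field_simp
  rw [intervalIntegral.integral_eq_sub_of_hasDerivAt hd ((by fun_prop : Continuous fun x => exp (c * x)).intervalIntegrable _ _)]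
  simp; ring
lemma Mf_le_int_exp {n : ℕ} {f : ℝ → ℝ} (hf : Continuous f) {A β r : ℝ} (hr : 0 ≤ r) (hA : 0 ≤ A)
    (H : ∀ x ∈ Icc 0 r, f x ≤ A * exp (-(β * x))) : Mf n f r ≤ A * ∫ x in (0:ℝ)..r, exp ((n - β) * x) := by
  rw [← intervalIntegral.integral_const_mul]
  refine intervalIntegral.integral_mono_on hr ((Mf_cont_int hf).intervalIntegrable _ _)
    ((by fun_prop : Continuous fun x => A * exp ((n - β) * x)).intervalIntegrable _ _) fun x hx => ?_
  have h1 := S_le_exp n hx.1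
  have h2 := S_nonneg n hx.1
  calc S n x * f x ≤ S n x * (A * exp (-(β * x))) := by gcongr; exact H x hx
    _ ≤ exp (n * x) * (A * exp (-(β * x))) := by gcongr
    _ = A * (exp (n * x) * exp (-(β * x))) := by ring
    _ = _ := by rw [← exp_add]; congr 2; ring
lemma Mf_exp_grow {n : ℕ} {f : ℝ → ℝ} (hf : Continuous f) {A β r : ℝ} (hr : 0 ≤ r) (hA : 0 ≤ A) (hβ : β < n)
    (H : ∀ x ∈ Icc 0 r, f x ≤ A * exp (-(β * x))) : Mf n f r ≤ A / (n - β) * exp ((n - β) * r) := by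
  refine (Mf_le_int_exp hf hr hA H).trans ?_
  have h0 : 0 < n - β := by linarith
  rw [int_exp_lin h0.ne', div_mul_eq_mul_div, mul_div_assoc]
  gcongr
  linarith
lemma Mf_exp_bdd {n : ℕ} {f : ℝ → ℝ} (hf : Continuous f) {A β r : ℝ} (hr : 0 ≤ r) (hA : 0 ≤ A) (hβ : n < β)
    (H : ∀ x ∈ Icc 0 r, f x ≤ A * exp (-(β * x))) : Mf n f r ≤ A / (β - n) := by
  refine (Mf_le_int_exp hf hr hA H).trans ?_
  have h0 : n - β < 0 := by linarith
  have h1 : 0 < β - n := by linarith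
  rw [int_exp_lin h0.ne, ← neg_div_neg_eq, neg_sub, neg_sub, ← mul_div_assoc]
  have := exp_pos ((n - β) * r)
  gcongr
  nlinarith
noncomputable def En (n : ℕ) (U : ℝ → ℝ → ℝ) (t : ℝ) : ℝ := ∫ r in Ioi (0:ℝ), Mu n U r t * (Mu n U r t / S n r)
noncomputable def Yn (n : ℕ) (m : ℝ) (U : ℝ → ℝ → ℝ) (t : ℝ) : ℝ := ∫ r in Ioi (0:ℝ), S n r * U r t * wf m U r t
lemma int_of_exp {F : ℝ → ℝ} (hF : ContinuousOn F (Ici 0)) {C σ : ℝ} (hσ : 0 < σ)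
    (H : ∀ r ≥ 0, |F r| ≤ C * exp (-(σ * r))) : IntegrableOn F (Ioi 0) := by
  have h1 : IntegrableOn (fun r => C * exp (-σ * r)) (Ioi 0) := (exp_neg_integrableOn_Ioi 0 hσ).const_mul C
  refine Integrable.mono' h1 ((hF.mono Ioi_subset_Ici_self).aestronglyMeasurable measurableSet_Ioi) ?_
  refine (ae_restrict_iff' measurableSet_Ioi).2 (Eventually.of_forall fun r hr => ?_)
  rw [neg_mul]
  exact H r (le_of_lt hr)
namespace Core
variable {n : ℕ} {m T : ℝ} {U Ut : ℝ → ℝ → ℝ} (h : Core n m T U Ut)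
include h
local notation "wU" => wf m U
local notation "gU" => gf m T U
local notation "MU" => Mu n U
local notation "Mt" => Mu n Ut
lemma rough : ∃ C σ, 0 ≤ C ∧ 0 < σ ∧ ∀ r ≥ 0, ∀ t ≥ T / 2,
    S n r * U r t * wU r t ≤ C * exp (-(σ * r)) ∧ MU r t * (MU r t / S n r) ≤ C * exp (-(σ * r)) ∧
    MU r t * wU r t ≤ C * exp (-(σ * r)) ∧ wU r t ≤ C * exp (-(σ * r)) := by
  obtain ⟨C0, hC0⟩ := h.decay
  have hn : (1:ℝ) ≤ n := by exact_mod_cast h.hn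
  set C1 := max C0 1 with hC1
  have h1 : 1 ≤ C1 := le_max_right _ _
  have hm0 := h.hm0
  have hp : 1 < 1 / m := by rw [lt_div_iff₀ h.hm0]; linarith [h.hm1]
  set p := 1 / m with hpdef
  set q := min p (3 / 2) with hq
  have hq1 : 1 < q := lt_min hp (by norm_num)
  have hq2 : q ≤ 3 / 2 := min_le_right _ _
  have hq3 : q ≤ p := min_le_left _ _
  set A := C1 ^ p with hA
  have hA0 : 0 < A := rpow_pos_of_pos (by linarith) _
  have hw : ∀ r ≥ 0, ∀ t ≥ T / 2, wU r t ≤ C1 * exp (-(n * r / 2)) := fun r hr t ht =>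
    (hC0 r hr t ht).trans (by gcongr; exact le_max_left _ _)
  have hu : ∀ r ≥ 0, ∀ t ≥ T / 2, U r t ≤ A * exp (-(n * q / 2 * r)) := by
    intro r hr t ht
    rw [h.u_eq]
    refine (rpow_le_rpow (h.w_nonneg r t) (hw r hr t ht) (by linarith)).trans ?_
    rw [mul_rpow (by linarith) (exp_pos _).le, ← exp_mul]
    gcongr
    have : n * r / 2 * q ≤ n * r / 2 * p := by gcongr
    linarith
  set l := n - n * q / 2 with hl
  have hl0 : 0 < l := by nlinarith
  set σ := n * (q - 1) / 2 with hσ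
  have hσ0 : 0 < σ := by have : 0 < q - 1 := by linarith
                         positivity
  have hM : ∀ r ≥ 0, ∀ t ≥ T / 2, MU r t ≤ A / l * exp (l * r) := fun r hr t ht =>
    Mf_exp_grow (h.cr t) hr hA0.le (by nlinarith) fun x hx => hu x hx.1 t ht
  have hM' : ∀ r ≥ 0, ∀ t ≥ T / 2, MU r t ≤ A * r * S n r := fun r hr t ht =>
    (le_abs_self _).trans (Mf_abs_le' (h.cr t) hr fun x hx => by
      rw [abs_of_nonneg (h.nonneg _ _)]
      refine (hu x hx.1 t ht).trans (mul_le_of_le_one_right hA0.le ?_)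
      rw [exp_le_one_iff]
      have : 0 ≤ n * q / 2 * x := mul_nonneg (by positivity) hx.1
      linarith)
  set B1 := A * C1
  set B2 := (A / l) ^ 2 * 4 ^ n
  set B3 := A ^ 2 * exp n * exp σ
  set B4 := A / l * C1
  have b1 : 0 ≤ B1 := by positivity
  have b2 : 0 ≤ B2 := by positivity
  have b3 : 0 ≤ B3 := by positivity
  have b4 : 0 ≤ B4 := by positivity
  refine ⟨B1 + B2 + B3 + B4 + C1, σ, by positivity, hσ0, fun r hr t ht => ?_⟩
  have hS := S_nonneg n hr
  have w0 := h.w_nonneg r t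
  have u0 := h.nonneg r t
  have M0 := h.M_nonneg hr t
  have ee := exp_pos (-(σ * r))
  refine ⟨?_, ?_, ?_, ?_⟩
  · calc S n r * U r t * wU r t ≤ exp (n * r) * (A * exp (-(n * q / 2 * r))) * (C1 * exp (-(n * r / 2))) := by
          gcongr
          exacts [S_le_exp n hr, hu r hr t ht, hw r hr t ht]
      _ = B1 * (exp (n * r) * exp (-(n * q / 2 * r)) * exp (-(n * r / 2))) := by ring
      _ = B1 * exp (-(σ * r)) := by rw [← exp_add, ← exp_add]; congr 2; ring
      _ ≤ _ := by gcongr; linarith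
  · rcases le_total r 1 with hr1 | hr1
    · have : MU r t * (MU r t / S n r) ≤ A ^ 2 * exp n := by
        rcases hr.eq_or_lt with h0 | h0
        · rw [← h0]; simp only [Mu, Mf_zero, zero_mul]; positivity
        · have hSp := S_pos n h0
          have k1 : MU r t / S n r ≤ A * r := by rw [div_le_iff₀ hSp]; exact hM' r hr t ht
          have k2 : S n r ≤ exp n := (S_le_exp n hr).trans (by gcongr; exact mul_le_of_le_one_right (by positivity) hr1)
          calc MU r t * (MU r t / S n r) ≤ (A * r * S n r) * (A * r) := by
                gcongr; exact hM' r hr t ht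
            _ ≤ (A * 1 * exp n) * (A * 1) := by gcongr
            _ = _ := by ring
      refine this.trans ?_
      calc A ^ 2 * exp n ≤ A ^ 2 * exp n * (exp σ * exp (-(σ * r))) := by
            apply le_mul_of_one_le_right (by positivity)
            rw [← exp_add]; apply one_le_exp; linarith [mul_le_of_le_one_right hσ0.le hr1]
        _ = B3 * exp (-(σ * r)) := by ring
        _ ≤ _ := by gcongr; linarith
    · have hSp := S_pos n (show 0 < r by linarith)
      have k1 : 1 / S n r ≤ 4 ^ n * exp (-(n * r)) := by
        rw [div_le_iff₀ hSp, exp_neg]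
        have := exp_le_S n hr1
        have := exp_pos (n * r)
        rw [show 4 ^ n * (exp (n * r))⁻¹ * S n r = (4 ^ n * S n r) / exp (n * r) by ring, le_div_iff₀ this]
        linarith
      calc MU r t * (MU r t / S n r) = MU r t * MU r t * (1 / S n r) := by ring
        _ ≤ (A / l * exp (l * r)) * (A / l * exp (l * r)) * (4 ^ n * exp (-(n * r))) := by
          gcongr
          exacts [hM r hr t ht, hM r hr t ht]
        _ = B2 * (exp (l * r) * exp (l * r) * exp (-(n * r))) := by ring
        _ = B2 * exp (-(2 * σ * r)) := by rw [← exp_add, ← exp_add]; congr 2; ring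
        _ ≤ B2 * exp (-(σ * r)) := by gcongr; linarith [mul_nonneg hσ0.le hr]
        _ ≤ _ := by gcongr; linarith
  · calc MU r t * wU r t ≤ (A / l * exp (l * r)) * (C1 * exp (-(n * r / 2))) := by
          gcongr
          exacts [hM r hr t ht, hw r hr t ht]
      _ = B4 * (exp (l * r) * exp (-(n * r / 2))) := by ring
      _ = B4 * exp (-(σ * r)) := by rw [← exp_add]; congr 2; ring
      _ ≤ _ := by gcongr; linarith
  · refine (hw r hr t ht).trans ?_
    have : exp (-(n * r / 2)) ≤ exp (-(σ * r)) := by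
      apply exp_le_exp.2
      have : n * (q - 1) / 2 * r ≤ n * 1 / 2 * r := by gcongr; linarith
      simp only [hσ]; linarith
    calc _ ≤ C1 * exp (-(σ * r)) := by gcongr
      _ ≤ _ := by gcongr; linarith
lemma Fy_cont (t : ℝ) : Continuous (fun r => S n r * U r t * wU r t) :=
  (Mf_cont_int (h.cr t)).mul (h.wcr t)
lemma Fe_cont (t : ℝ) : ContinuousOn (fun r => MU r t * (MU r t / S n r)) (Ici 0) :=
  (h.Mcr t).continuousOn.mul (Mf_div_contOn h.hn (h.cr t))
lemma Fy_nonneg {r : ℝ} (hr : 0 ≤ r) (t : ℝ) : 0 ≤ S n r * U r t * wU r t :=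
  mul_nonneg (mul_nonneg (S_nonneg n hr) (h.nonneg r t)) (h.w_nonneg r t)
lemma Fe_nonneg {r : ℝ} (hr : 0 ≤ r) (t : ℝ) : 0 ≤ MU r t * (MU r t / S n r) :=
  mul_nonneg (h.M_nonneg hr t) (div_nonneg (h.M_nonneg hr t) (S_nonneg n hr))
lemma Fy_int {t : ℝ} (ht : T / 2 ≤ t) : IntegrableOn (fun r => S n r * U r t * wU r t) (Ioi 0) := by
  obtain ⟨C, σ, hC, hσ, H⟩ := h.rough
  exact int_of_exp (h.Fy_cont t).continuousOn hσ fun r hr => by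
    rw [abs_of_nonneg (h.Fy_nonneg hr t)]; exact (H r hr t ht).1
lemma Fe_int {t : ℝ} (ht : T / 2 ≤ t) : IntegrableOn (fun r => MU r t * (MU r t / S n r)) (Ioi 0) := by
  obtain ⟨C, σ, hC, hσ, H⟩ := h.rough
  exact int_of_exp (h.Fe_cont t) hσ fun r hr => by
    rw [abs_of_nonneg (h.Fe_nonneg hr t)]; exact (H r hr t ht).2.1
lemma Y_cont : ContinuousOn (Yn n m U) (Ici (T / 2)) := by
  obtain ⟨C, σ, hC, hσ, H⟩ := h.rough
  refine continuousOn_of_dominated (bound := fun r => C * exp (-σ * r)) ?_ ?_ ((exp_neg_integrableOn_Ioi 0 hσ).const_mul C) ?_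
  · exact fun t ht => (h.Fy_int ht).aestronglyMeasurable
  · intro t ht
    refine (ae_restrict_iff' measurableSet_Ioi).2 (Eventually.of_forall fun r hr => ?_)
    rw [norm_of_nonneg (h.Fy_nonneg (le_of_lt hr) t), neg_mul]
    exact (H r (le_of_lt hr) t ht).1
  · refine Eventually.of_forall fun r => Continuous.continuousOn ?_
    exact (continuous_const.mul (h.cont.comp (by fun_prop : Continuous fun t : ℝ => ((r, t) : ℝ × ℝ)))).mul (h.wct r)
lemma E_cont : ContinuousOn (En n U) (Ici (T / 2)) := by
  obtain ⟨C, σ, hC, hσ, H⟩ := h.rough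
  refine continuousOn_of_dominated (bound := fun r => C * exp (-σ * r)) ?_ ?_ ((exp_neg_integrableOn_Ioi 0 hσ).const_mul C) ?_
  · exact fun t ht => (h.Fe_int ht).aestronglyMeasurable
  · intro t ht
    refine (ae_restrict_iff' measurableSet_Ioi).2 (Eventually.of_forall fun r hr => ?_)
    rw [norm_of_nonneg (h.Fe_nonneg (le_of_lt hr) t), neg_mul]
    exact (H r (le_of_lt hr) t ht).2.1
  · refine Eventually.of_forall fun r => Continuous.continuousOn ?_
    exact (h.Mct r).mul ((h.Mct r).div_const _)
lemma yR_le {t R : ℝ} (ht : T / 2 ≤ t) (hR : 0 ≤ R) :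
    ∫ r in 0..R, S n r * U r t * wU r t ≤ Yn n m U t := by
  rw [intervalIntegral.integral_of_le hR]
  refine setIntegral_mono_set (h.Fy_int ht) ?_ (LE.le.eventuallyLE fun x hx => hx.1)
  exact (ae_restrict_iff' measurableSet_Ioi).2 (Eventually.of_forall fun r hr => h.Fy_nonneg (le_of_lt hr) t)
lemma eR_le {t R : ℝ} (ht : T / 2 ≤ t) (hR : 0 ≤ R) :
    ∫ r in 0..R, MU r t * (MU r t / S n r) ≤ En n U t := by
  rw [intervalIntegral.integral_of_le hR]
  refine setIntegral_mono_set (h.Fe_int ht) ?_ (LE.le.eventuallyLE fun x hx => hx.1)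
  exact (ae_restrict_iff' measurableSet_Ioi).2 (Eventually.of_forall fun r hr => h.Fe_nonneg (le_of_lt hr) t)
lemma yR_nonneg {t R : ℝ} (hR : 0 ≤ R) : 0 ≤ ∫ r in 0..R, S n r * U r t * wU r t :=
  intervalIntegral.integral_nonneg hR fun r hr => h.Fy_nonneg hr.1 t
lemma Y_pos {t : ℝ} (ht : T / 2 ≤ t) (ht' : t < T) : 0 < Yn n m U t := by
  have ht0 : t ∈ Ioo 0 T := ⟨by linarith [h.hT], ht'⟩
  refine lt_of_lt_of_le ?_ (h.yR_le ht zero_le_one)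
  exact intervalIntegral.intervalIntegral_pos_of_pos_on ((h.Fy_cont t).intervalIntegrable _ _)
    (fun r hr => mul_pos (mul_pos (S_pos n hr.1) (h.pos r t ht0)) (h.w_pos r ht0)) one_pos
lemma yR_tendsto {t : ℝ} (ht : T / 2 ≤ t) {R : ℕ → ℝ} (hR : Tendsto R atTop atTop) :
    Tendsto (fun k => ∫ r in 0..R k, S n r * U r t * wU r t) atTop (𝓝 (Yn n m U t)) :=
  intervalIntegral_tendsto_integral_Ioi 0 (h.Fy_int ht) hR
lemma eR_tendsto {t : ℝ} (ht : T / 2 ≤ t) {R : ℕ → ℝ} (hR : Tendsto R atTop atTop) :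
    Tendsto (fun k => ∫ r in 0..R k, MU r t * (MU r t / S n r)) atTop (𝓝 (En n U t)) :=
  intervalIntegral_tendsto_integral_Ioi 0 (h.Fe_int ht) hR
lemma sub_Ioo {t1 t2 : ℝ} (h1 : T / 2 ≤ t1) (h2 : t2 < T) : Icc t1 t2 ⊆ Ioo 0 T :=
  fun t ht => ⟨by linarith [ht.1, h.hT], by linarith [ht.2]⟩
lemma yR_cont {R : ℝ} (hR : 0 ≤ R) : ContinuousOn (fun t => ∫ r in 0..R, S n r * U r t * wU r t) (Ioo 0 T) :=
  fun t ht => (h.yR_dt ht hR).continuousAt.continuousWithinAt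
lemma int_yR_tendsto {t1 t2 : ℝ} (h1 : T / 2 ≤ t1) (h12 : t1 ≤ t2) (h2 : t2 < T)
    {R : ℕ → ℝ} (hR0 : ∀ k, 0 ≤ R k) (hR : Tendsto R atTop atTop) {κ : ℝ → ℝ} (hκ : ContinuousOn κ (Icc t1 t2)) :
    Tendsto (fun k => ∫ t in t1..t2, κ t * ∫ r in 0..R k, S n r * U r t * wU r t) atTop (𝓝 (∫ t in t1..t2, κ t * Yn n m U t)) := by
  have hY : ContinuousOn (Yn n m U) (Icc t1 t2) := h.Y_cont.mono fun t ht => h1.trans ht.1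
  refine intervalIntegral.tendsto_integral_filter_of_dominated_convergence (fun t => |κ t| * Yn n m U t) ?_ ?_ ?_ ?_
  · refine Eventually.of_forall fun k => (ContinuousOn.intervalIntegrable ?_).def'.aestronglyMeasurable
    rw [uIcc_of_le h12]
    exact hκ.mul ((h.yR_cont (hR0 k)).mono (h.sub_Ioo h1 h2))
  · refine Eventually.of_forall fun k => Eventually.of_forall fun t ht => ?_
    rw [uIoc_of_le h12] at ht
    rw [norm_mul, norm_eq_abs, norm_of_nonneg (h.yR_nonneg (hR0 k))]
    have := h.yR_le (h1.trans ht.1.le) (hR0 k)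
    gcongr
  · apply ContinuousOn.intervalIntegrable
    rw [uIcc_of_le h12]
    exact hκ.abs.mul hY
  · refine Eventually.of_forall fun t ht => ?_
    rw [uIoc_of_le h12] at ht
    exact (h.yR_tendsto (h1.trans ht.1.le) hR).const_mul _
lemma int_Mw_tendsto {t1 t2 : ℝ} (h1 : T / 2 ≤ t1) (h12 : t1 ≤ t2)
    {R : ℕ → ℝ} (hR0 : ∀ k, 0 ≤ R k) (hR : Tendsto R atTop atTop) {κ : ℝ → ℝ} (hκ : ContinuousOn κ (Icc t1 t2)) :
    Tendsto (fun k => ∫ t in t1..t2, κ t * (MU (R k) t * wU (R k) t)) atTop (𝓝 0) := by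
  obtain ⟨C, σ, hC, hσ, H⟩ := h.rough
  have hlim : Tendsto (fun k => C * exp (-(σ * R k))) atTop (𝓝 0) := by
    rw [← mul_zero C]
    exact (tendsto_exp_neg_atTop_nhds_zero.comp (hR.const_mul_atTop hσ)).const_mul C
  have : Tendsto (fun k => ∫ t in t1..t2, κ t * (MU (R k) t * wU (R k) t)) atTop (𝓝 (∫ t in t1..t2, (0:ℝ))) := by
    refine intervalIntegral.tendsto_integral_filter_of_dominated_convergence (fun t => |κ t| * C) ?_ ?_ ?_ ?_
    · refine Eventually.of_forall fun k => (ContinuousOn.intervalIntegrable ?_).def'.aestronglyMeasurable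
      rw [uIcc_of_le h12]
      exact hκ.mul ((h.Mct _).mul (h.wct _)).continuousOn
    · refine Eventually.of_forall fun k => Eventually.of_forall fun t ht => ?_
      rw [uIoc_of_le h12] at ht
      rw [norm_mul, norm_eq_abs, norm_of_nonneg (mul_nonneg (h.M_nonneg (hR0 k) t) (h.w_nonneg _ t))]
      gcongr
      refine (H (R k) (hR0 k) t (h1.trans ht.1.le)).2.2.1.trans (mul_le_of_le_one_right hC ?_)
      rw [exp_le_one_iff]
      have := mul_nonneg hσ.le (hR0 k)
      linarith
    · apply ContinuousOn.intervalIntegrable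
      rw [uIcc_of_le h12]
      exact hκ.abs.mul continuousOn_const
    · refine Eventually.of_forall fun t ht => ?_
      rw [uIoc_of_le h12] at ht
      have : Tendsto (fun k => MU (R k) t * wU (R k) t) atTop (𝓝 0) :=
        squeeze_zero (fun k => mul_nonneg (h.M_nonneg (hR0 k) t) (h.w_nonneg _ t)) (fun k => (H (R k) (hR0 k) t (h1.trans ht.1.le)).2.2.1) hlim
      simpa using this.const_mul (κ t)
  simpa using this
lemma E_diff {t1 t2 : ℝ} (h1 : T / 2 ≤ t1) (h12 : t1 ≤ t2) (h2 : t2 < T) :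
    En n U t1 - En n U t2 = ∫ t in t1..t2, 2 * Yn n m U t := by
  have hR : Tendsto (fun k : ℕ => (k:ℝ)) atTop atTop := tendsto_natCast_atTop_atTop
  have hk0 : ∀ k : ℕ, (0:ℝ) ≤ k := fun k => Nat.cast_nonneg k
  have l1 := (h.eR_tendsto h1 hR).sub (h.eR_tendsto (h1.trans h12) hR)
  have l2 := (h.int_yR_tendsto h1 h12 h2 hk0 hR (continuousOn_const (c := 2))).sub (h.int_Mw_tendsto h1 h12 hk0 hR (continuousOn_const (c := 2)))
  rw [sub_zero] at l2
  refine tendsto_nhds_unique l1 (l2.congr fun k => ?_)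
  have hs := h.sub_Ioo h1 h2
  have i1 : IntervalIntegrable (fun t => 2 * ∫ r in 0..(k:ℝ), S n r * U r t * wU r t) volume t1 t2 := by
    apply ContinuousOn.intervalIntegrable
    rw [uIcc_of_le h12]
    exact continuousOn_const.mul ((h.yR_cont (hk0 k)).mono hs)
  have i2 : IntervalIntegrable (fun t => 2 * (MU (k:ℝ) t * wU (k:ℝ) t)) volume t1 t2 :=
    (continuous_const.mul ((h.Mct _).mul (h.wct _))).intervalIntegrable _ _
  rw [← intervalIntegral.integral_sub i1 i2]
  have := intervalIntegral.integral_eq_sub_of_hasDerivAt_of_le h12 (f := fun t => -∫ r in 0..(k:ℝ), MU r t * (MU r t / S n r))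
    (f' := fun t => 2 * (∫ r in 0..(k:ℝ), S n r * U r t * wU r t) - 2 * (MU (k:ℝ) t * wU (k:ℝ) t)) ?_ ?_ (i1.sub i2)
  · rw [this]; ring
  · exact fun t ht => (h.ER_dt (hs ht) (hk0 k)).neg.continuousAt.continuousWithinAt
  · intro t ht
    have ht' := hs ⟨ht.1.le, ht.2.le⟩
    refine (h.ER_dt ht' (hk0 k)).neg.congr_deriv ?_
    have := h.ibp (h.cr t) ht' (hk0 k)
    have e : ∫ r in 0..(k:ℝ), MU r t * (Mt r t / S n r) = MU (k:ℝ) t * wU (k:ℝ) t - ∫ r in 0..(k:ℝ), S n r * U r t * wU r t := this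
    rw [e]; ring
lemma E_T : En n U T = 0 := by
  have : ∀ r, MU r T = 0 := fun r => by unfold Mu Mf; simp [h.ext _ T le_rfl]
  simp [En, this]
lemma E_eq {t : ℝ} (ht : T / 2 ≤ t) (ht' : t < T) : En n U t = ∫ s in t..T, 2 * Yn n m U s := by
  have hT := h.hT
  have hY : ContinuousOn (fun s => 2 * Yn n m U s) (Icc t T) := continuousOn_const.mul (h.Y_cont.mono fun s hs => ht.trans hs.1)
  have hi : IntegrableOn (fun s => 2 * Yn n m U s) (Icc t T) := hY.integrableOn_Icc
  have c1 := intervalIntegral.continuousOn_primitive_interval (a := t) (b := T) (by rwa [uIcc_of_le ht'.le])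
  rw [uIcc_of_le ht'.le] at c1
  have l1 : Tendsto (fun s => ∫ x in t..s, 2 * Yn n m U x) (𝓝[Icc t T] T) (𝓝 (∫ x in t..T, 2 * Yn n m U x)) := c1 T ⟨ht'.le, le_rfl⟩
  have l2 : Tendsto (fun s => En n U t - En n U s) (𝓝[Icc t T] T) (𝓝 (En n U t - En n U T)) :=
    tendsto_const_nhds.sub ((h.E_cont.mono (fun s hs => ht.trans hs.1)) T ⟨ht'.le, le_rfl⟩)
  rw [h.E_T, sub_zero] at l2
  have hsub : 𝓝[Ioo t T] T ≤ 𝓝[Icc t T] T := nhdsWithin_mono _ Ioo_subset_Icc_self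
  have hne : (𝓝[Ioo t T] T).NeBot := by rw [nhdsWithin_Ioo_eq_nhdsLT ht']; infer_instance
  refine tendsto_nhds_unique (l2.mono_left hsub) ((l1.mono_left hsub).congr' ?_)
  filter_upwards [self_mem_nhdsWithin] with s hs
  exact (h.E_diff ht hs.1.le hs.2).symm
end Core
noncomputable def Df (n : ℕ) (U Ut : ℝ → ℝ → ℝ) (L k t : ℝ) : ℝ :=
  ∫ r in 0..L, (Mu n Ut r t + k * Mu n U r t) * (Mu n Ut r t / S n r + k * (Mu n U r t / S n r))
namespace Core
variable {n : ℕ} {m T : ℝ} {U Ut : ℝ → ℝ → ℝ} (h : Core n m T U Ut)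
include h
local notation "wU" => wf m U
local notation "gU" => gf m T U
local notation "MU" => Mu n U
local notation "Mt" => Mu n Ut
lemma goodR {t1 t2 : ℝ} (h1 : T / 2 ≤ t1) (h12 : t1 < t2) (h2 : t2 < T) (R0 : ℝ) :
    ∃ R ≥ R0, 0 ≤ R ∧ ∫ t in t1..t2, Mt R t * wU R t ≤ 0 := by
  by_contra hcon
  push Not at hcon
  have hs := h.sub_Ioo h1 h2
  set R1 := max R0 1 with hR1
  have hR10 : 1 ≤ R1 := le_max_right _ _
  set ψ : ℝ → ℝ := fun R => ∫ t in t1..t2, wU R t * wU R t with hψ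
  have hd : ∀ R, 0 < R → HasDerivAt ψ (∫ t in t1..t2, 2 * (wU R t * (Mt R t / S n R))) R := by
    intro R hR
    refine hasDerivAt_param (F := fun r t => wU r t * wU r t) (F' := fun r t => 2 * (wU r t * (Mt r t / S n r))) h12.le
      (c := 0) (d := R + 1) ⟨hR, by linarith⟩ (h.wc.mul h.wc).continuousOn ?_ ?_
    · refine continuousOn_const.mul (h.wc.continuousOn.mul (h.PSc.mono fun q hq => ⟨le_of_lt hq.1.1, hs hq.2⟩))
    · intro r hr t ht
      have := h.dr r hr.1 t (hs ht)
      refine (this.mul this).congr_deriv ?_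
      unfold wf Mu; ring
  have hmono : MonotoneOn ψ (Ici R1) := by
    refine monotoneOn_of_deriv_nonneg (convex_Ici R1) (fun R hR => ?_) (fun R hR => ?_) fun R hR => ?_
    · exact (hd R (by have : R1 ≤ R := hR
                      linarith)).continuousAt.continuousWithinAt
    · rw [interior_Ici] at hR
      exact (hd R (by have : R1 < R := hR
                      linarith)).differentiableAt.differentiableWithinAt
    · rw [interior_Ici] at hR
      have hR' : R1 < R := hR
      have hRp : 0 < R := by linarith
      rw [(hd R hRp).deriv]
      have := hcon R ((le_max_left _ _).trans hR'.le) hRp.le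
      have e : (∫ t in t1..t2, 2 * (wU R t * (Mt R t / S n R))) = 2 / S n R * ∫ t in t1..t2, Mt R t * wU R t := by
        rw [← intervalIntegral.integral_const_mul]; congr 1; ext t; ring
      rw [e]
      have := S_pos n hRp
      positivity
  have hpos : 0 < ψ R1 := by
    refine intervalIntegral.intervalIntegral_pos_of_pos_on (((h.wct R1).mul (h.wct R1)).intervalIntegrable _ _) (fun t ht => ?_) h12
    have := h.w_pos R1 (hs ⟨ht.1.le, ht.2.le⟩)
    positivity
  obtain ⟨C, σ, hC, hσ, H⟩ := h.rough
  have hle : ∀ R ≥ 0, ψ R ≤ (t2 - t1) * ((C * exp (-(σ * R))) * (C * exp (-(σ * R)))) := by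
    intro R hR
    have := intervalIntegral.integral_mono_on (μ := volume) h12.le (((h.wct R).mul (h.wct R)).intervalIntegrable t1 t2)
      ((continuous_const (y := (C * exp (-(σ * R))) * (C * exp (-(σ * R))))).intervalIntegrable t1 t2) (fun t ht => by
        have a1 := (H R hR t (h1.trans ht.1)).2.2.2
        have a2 := h.w_nonneg R t
        simp only [Pi.mul_apply]
        gcongr)
    rw [intervalIntegral.integral_const, smul_eq_mul] at this
    exact this
  have hlim : Tendsto (fun R : ℝ => (t2 - t1) * ((C * exp (-(σ * R))) * (C * exp (-(σ * R))))) atTop (𝓝 0) := by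
    have : Tendsto (fun R : ℝ => C * exp (-(σ * R))) atTop (𝓝 0) := by
      rw [← mul_zero C]
      exact (tendsto_exp_neg_atTop_nhds_zero.comp (tendsto_id.const_mul_atTop hσ)).const_mul C
    simpa using (this.mul this).const_mul (t2 - t1)
  obtain ⟨R, hR, hR2⟩ := ((eventually_ge_atTop R1).and (hlim.eventually (gt_mem_nhds hpos))).exists
  have a1 := hmono (mem_Ici.2 (le_refl R1)) hR hR
  have a2 := hle R (by linarith)
  linarith
lemma Df_expand {L : ℝ} (hL : 0 ≤ L) {t : ℝ} (ht : t ∈ Ioo 0 T) (k : ℝ) :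
    Df n U Ut L k t = (∫ r in 0..L, Mt r t * (Mt r t / S n r)) + 2 * (k * ∫ r in 0..L, MU r t * (Mt r t / S n r))
      + k * k * ∫ r in 0..L, MU r t * (MU r t / S n r) := by
  have c1 := (Mf_div_contOn h.hn (h.Utr ht)).mono (fun x hx => hx.1 : Icc 0 L ⊆ Ici 0)
  have c2 := (Mf_div_contOn h.hn (h.cr t)).mono (fun x hx => hx.1 : Icc 0 L ⊆ Ici 0)
  have i1 : IntervalIntegrable (fun r => Mt r t * (Mt r t / S n r)) volume 0 L := by
    apply ContinuousOn.intervalIntegrable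
    rw [uIcc_of_le hL]; exact (h.Pcr ht).continuousOn.mul c1
  have i2 : IntervalIntegrable (fun r => MU r t * (Mt r t / S n r)) volume 0 L := by
    apply ContinuousOn.intervalIntegrable
    rw [uIcc_of_le hL]; exact (h.Mcr t).continuousOn.mul c1
  have i3 : IntervalIntegrable (fun r => MU r t * (MU r t / S n r)) volume 0 L := by
    apply ContinuousOn.intervalIntegrable
    rw [uIcc_of_le hL]; exact (h.Mcr t).continuousOn.mul c2
  unfold Df
  rw [← mul_assoc, ← intervalIntegral.integral_const_mul, ← intervalIntegral.integral_const_mul,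
    ← intervalIntegral.integral_add i1 (i2.const_mul _), ← intervalIntegral.integral_add (i1.add (i2.const_mul _)) (i3.const_mul _)]
  congr 1; ext r; ring
lemma Df_mono {L R : ℝ} (hL : 0 ≤ L) (hLR : L ≤ R) {t : ℝ} (ht : t ∈ Ioo 0 T) (k : ℝ) :
    Df n U Ut L k t ≤ Df n U Ut R k t := by
  have c1 := (Mf_div_contOn h.hn (h.Utr ht)).mono (fun x hx => hx.1 : Icc 0 R ⊆ Ici 0)
  have c2 := (Mf_div_contOn h.hn (h.cr t)).mono (fun x hx => hx.1 : Icc 0 R ⊆ Ici 0)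
  refine intervalIntegral.integral_mono_interval le_rfl hL hLR ?_ ?_
  · refine (ae_restrict_iff' measurableSet_Ioc).2 (Eventually.of_forall fun r hr => ?_)
    have : (Mt r t + k * MU r t) * (Mt r t / S n r + k * (MU r t / S n r)) = (Mt r t + k * MU r t) ^ 2 / S n r := by ring
    simp only [Pi.zero_apply]
    rw [this]
    exact div_nonneg (sq_nonneg _) (S_nonneg n hr.1.le)
  · apply ContinuousOn.intervalIntegrable
    rw [uIcc_of_le (hL.trans hLR)]
    exact (((h.Pcr ht).continuousOn.add (continuousOn_const.mul (h.Mcr t).continuousOn)).mul (c1.add (continuousOn_const.mul c2)))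
lemma Df_cont {L : ℝ} (hL : 0 ≤ L) {t1 t2 : ℝ} (h1 : T / 2 ≤ t1) (h2 : t2 < T) {κ : ℝ → ℝ} (hκ : ContinuousOn κ (Icc t1 t2)) :
    ContinuousOn (fun t => Df n U Ut L (κ t) t) (Icc t1 t2) := by
  have hs := h.sub_Ioo h1 h2
  have c1 : ContinuousOn (fun t => ∫ r in 0..L, Mt r t * (Mt r t / S n r)) (Icc t1 t2) :=
    (par_cont (F := fun r t => Mt r t * (Mt r t / S n r)) hL ((h.Pc.mono fun q hq => ⟨mem_univ _, hq.2⟩).mul h.PSc)).mono hs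
  have c2 : ContinuousOn (fun t => ∫ r in 0..L, MU r t * (Mt r t / S n r)) (Icc t1 t2) :=
    (par_cont (F := fun r t => MU r t * (Mt r t / S n r)) hL (h.Mc.continuousOn.mul h.PSc)).mono hs
  have c3 : ContinuousOn (fun t => ∫ r in 0..L, MU r t * (MU r t / S n r)) (Icc t1 t2) :=
    (par_cont (F := fun r t => MU r t * (MU r t / S n r)) hL (h.Mc.continuousOn.mul h.MSc)).mono hs
  refine ((c1.add ((continuousOn_const (c := 2)).mul (hκ.mul c2))).add ((hκ.mul hκ).mul c3)).congr fun t ht => ?_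
  exact h.Df_expand hL (hs ht) (κ t)
lemma master {L : ℝ} (hL : 0 ≤ L) {t1 t2 : ℝ} (h1 : T / 2 ≤ t1) (h12 : t1 < t2) (h2 : t2 < T)
    {κ : ℝ → ℝ} (hκ : ContinuousOn κ (Icc t1 t2)) :
    (1 + m) * (∫ t in t1..t2, (Df n U Ut L (κ t) t + 2 * κ t * Yn n m U t - κ t * κ t * En n U t)) ≤ Yn n m U t1 - Yn n m U t2 := by
  have hs := h.sub_Ioo h1 h2
  choose R hR1 hR0 hR2 using fun k : ℕ => h.goodR h1 h12 h2 (max L k)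
  have hRL : ∀ k, L ≤ R k := fun k => (le_max_left _ _).trans (hR1 k)
  have hRt : Tendsto R atTop atTop := tendsto_atTop_mono (fun k => (le_max_right _ _).trans (hR1 k)) tendsto_natCast_atTop_atTop
  have hii : ∀ {f : ℝ → ℝ}, ContinuousOn f (Icc t1 t2) → IntervalIntegrable f volume t1 t2 := fun hf => by
    apply ContinuousOn.intervalIntegrable
    rwa [uIcc_of_le h12.le]
  have hκ2 : ContinuousOn (fun t => 2 * κ t) (Icc t1 t2) := continuousOn_const.mul hκ
  have cD := h.Df_cont hL h1 h2 hκ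
  have cE : ContinuousOn (fun t => κ t * κ t * En n U t) (Icc t1 t2) := (hκ.mul hκ).mul (h.E_cont.mono fun t ht => h1.trans ht.1)
  have cY : ContinuousOn (fun t => 2 * κ t * Yn n m U t) (Icc t1 t2) := hκ2.mul (h.Y_cont.mono fun t ht => h1.trans ht.1)
  have l1 := (h.yR_tendsto h1 hRt).sub (h.yR_tendsto (h1.trans h12.le) hRt)
  have l2 := (((h.int_yR_tendsto h1 h12.le h2 hR0 hRt hκ2).sub (h.int_Mw_tendsto h1 h12.le hR0 hRt hκ2)).add_const
    ((∫ t in t1..t2, Df n U Ut L (κ t) t) - ∫ t in t1..t2, κ t * κ t * En n U t)).const_mul (1 + m)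
  have e0 : (∫ t in t1..t2, (Df n U Ut L (κ t) t + 2 * κ t * Yn n m U t - κ t * κ t * En n U t)) =
      (∫ t in t1..t2, 2 * κ t * Yn n m U t) - 0 + ((∫ t in t1..t2, Df n U Ut L (κ t) t) - ∫ t in t1..t2, κ t * κ t * En n U t) := by
    rw [intervalIntegral.integral_sub ((hii cD).add (hii cY)) (hii cE), intervalIntegral.integral_add (hii cD) (hii cY)]
    ring
  rw [e0]
  refine le_of_tendsto_of_tendsto' l2 l1 fun k => ?_
  have cYR : ContinuousOn (fun t => 2 * κ t * ∫ r in 0..R k, S n r * U r t * wU r t) (Icc t1 t2) := hκ2.mul ((h.yR_cont (hR0 k)).mono hs)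
  have cMw : ContinuousOn (fun t => 2 * κ t * (MU (R k) t * wU (R k) t)) (Icc t1 t2) := hκ2.mul ((h.Mct _).mul (h.wct _)).continuousOn
  have cPw : ContinuousOn (fun t => Mt (R k) t * wU (R k) t) (Icc t1 t2) :=
    (h.Pc.comp (by fun_prop : Continuous fun t : ℝ => ((R k, t) : ℝ × ℝ)).continuousOn fun t ht => ⟨mem_univ _, hs ht⟩).mul (h.wct _).continuousOn
  have cPP : ContinuousOn (fun t => ∫ r in 0..R k, Mt r t * (Mt r t / S n r)) (Icc t1 t2) :=
    (par_cont (F := fun r t => Mt r t * (Mt r t / S n r)) (hR0 k) ((h.Pc.mono fun q hq => ⟨mem_univ _, hq.2⟩).mul h.PSc)).mono hs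
  have hyd := intervalIntegral.integral_eq_sub_of_hasDerivAt_of_le h12.le (f := fun t => -∫ r in 0..R k, S n r * U r t * wU r t)
    (f' := fun t => (1 + m) * ((∫ r in 0..R k, Mt r t * (Mt r t / S n r)) - Mt (R k) t * wU (R k) t))
    ((h.yR_cont (hR0 k)).neg.mono hs) (fun t ht => by
      have ht' := hs ⟨ht.1.le, ht.2.le⟩
      refine (h.yR_dt ht' (hR0 k)).neg.congr_deriv ?_
      have := h.ibp (h.Utr ht') ht' (hR0 k)
      have e : ∫ r in 0..R k, Mt r t * (Mt r t / S n r) = Mt (R k) t * wU (R k) t - ∫ r in 0..R k, S n r * Ut r t * wU r t := this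
      rw [e]; ring) (hii (continuousOn_const.mul (cPP.sub cPw)))
  rw [intervalIntegral.integral_const_mul, intervalIntegral.integral_sub (hii cPP) (hii cPw)] at hyd
  have hm0 := h.hm0
  have hcmp : (∫ t in t1..t2, (2 * κ t * (∫ r in 0..R k, S n r * U r t * wU r t) - 2 * κ t * (MU (R k) t * wU (R k) t)
      + (Df n U Ut L (κ t) t - κ t * κ t * En n U t))) ≤ ∫ t in t1..t2, ∫ r in 0..R k, Mt r t * (Mt r t / S n r) := by
    refine intervalIntegral.integral_mono_on h12.le (hii ((cYR.sub cMw).add (cD.sub cE))) (hii cPP) fun t ht => ?_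
    have ht' := hs ht
    have a1 := h.Df_mono hL (hRL k) ht' (κ t)
    have a2 := h.Df_expand (hR0 k) ht' (κ t)
    have a3 : ∫ r in 0..R k, MU r t * (Mt r t / S n r) = MU (R k) t * wU (R k) t - ∫ r in 0..R k, S n r * U r t * wU r t :=
      h.ibp (h.cr t) ht' (hR0 k)
    have a4 := mul_le_mul_of_nonneg_left (h.eR_le (h1.trans ht.1) (hR0 k)) (mul_self_nonneg (κ t))
    rw [a3] at a2
    linarith
  rw [intervalIntegral.integral_add ((hii cYR).sub (hii cMw)) ((hii cD).sub (hii cE)),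
    intervalIntegral.integral_sub (hii cYR) (hii cMw), intervalIntegral.integral_sub (hii cD) (hii cE)] at hcmp
  have hk := hR2 k
  have hk2 := hcmp.trans (show (∫ t in t1..t2, ∫ r in 0..R k, Mt r t * (Mt r t / S n r)) ≤
    (∫ t in t1..t2, ∫ r in 0..R k, Mt r t * (Mt r t / S n r)) - ∫ t in t1..t2, Mt (R k) t * wU (R k) t by linarith)
  have hle := mul_le_mul_of_nonneg_left hk2 (show 0 ≤ 1 + m by linarith)
  rw [hyd] at hle
  linarith
end Core
noncomputable def Qn (n : ℕ) (m : ℝ) (U : ℝ → ℝ → ℝ) (t : ℝ) : ℝ := Yn n m U t / En n U t ^ ((1 + m) / 2)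
namespace Core
variable {n : ℕ} {m T : ℝ} {U Ut : ℝ → ℝ → ℝ} (h : Core n m T U Ut)
include h
local notation "wU" => wf m U
local notation "gU" => gf m T U
local notation "MU" => Mu n U
local notation "Mt" => Mu n Ut
lemma E_pos {t : ℝ} (ht : T / 2 ≤ t) (ht' : t < T) : 0 < En n U t := by
  rw [h.E_eq ht ht']
  refine intervalIntegral.intervalIntegral_pos_of_pos_on ?_ (fun s hs => ?_) ht'
  · apply ContinuousOn.intervalIntegrable
    rw [uIcc_of_le ht'.le]
    exact continuousOn_const.mul (h.Y_cont.mono fun s hs => ht.trans hs.1)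
  · have := h.Y_pos (ht.trans hs.1.le) hs.2
    linarith
lemma E_dt {t : ℝ} (ht : t ∈ Ioo (T / 2) T) : HasDerivAt (En n U) (-(2 * Yn n m U t)) t := by
  have hi : IntervalIntegrable (fun s => 2 * Yn n m U s) volume t T := by
    apply ContinuousOn.intervalIntegrable
    rw [uIcc_of_le ht.2.le]
    exact continuousOn_const.mul (h.Y_cont.mono fun s hs => ht.1.le.trans hs.1)
  have hc : ContinuousOn (fun s => 2 * Yn n m U s) (Ioi (T / 2)) := continuousOn_const.mul (h.Y_cont.mono Ioi_subset_Ici_self)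
  have := intervalIntegral.integral_hasDerivAt_left hi (hc.stronglyMeasurableAtFilter isOpen_Ioi t ht.1) (hc.continuousAt (Ioi_mem_nhds ht.1))
  refine this.congr_of_eventuallyEq ?_
  filter_upwards [Ioo_mem_nhds ht.1 ht.2] with s hs
  exact h.E_eq hs.1.le hs.2
lemma z_dt {t : ℝ} (ht : t ∈ Ioo (T / 2) T) :
    HasDerivAt (fun t => En n U t ^ ((1 + m) / 2)) (-((1 + m) * (Yn n m U t / En n U t * En n U t ^ ((1 + m) / 2)))) t := by
  have hE := h.E_pos ht.1.le ht.2
  refine ((h.E_dt ht).rpow_const (p := (1 + m) / 2) (Or.inl hE.ne')).congr_deriv ?_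
  rw [rpow_sub_one hE.ne']
  field_simp
lemma e_dt {t : ℝ} (ht : t ∈ Ioo (T / 2) T) :
    HasDerivAt (fun t => En n U t ^ ((1 - m) / 2)) (-((1 - m) * Qn n m U t)) t := by
  have hE := h.E_pos ht.1.le ht.2
  refine ((h.E_dt ht).rpow_const (p := (1 - m) / 2) (Or.inl hE.ne')).congr_deriv ?_
  have : En n U t ^ ((1 - m) / 2 - 1) = (En n U t ^ ((1 + m) / 2))⁻¹ := by
    rw [← rpow_neg hE.le]; congr 1; ring
  rw [this]; unfold Qn; ring
lemma masterQ {L : ℝ} (hL : 0 ≤ L) {t1 t2 : ℝ} (h1 : T / 2 ≤ t1) (h12 : t1 < t2) (h2 : t2 < T) :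
    (1 + m) * (∫ t in t1..t2, (Df n U Ut L (Yn n m U t / En n U t) t + Yn n m U t / En n U t * Yn n m U t)) ≤ Yn n m U t1 - Yn n m U t2 := by
  have hk : ContinuousOn (fun t => Yn n m U t / En n U t) (Icc t1 t2) :=
    (h.Y_cont.mono fun s hs => h1.trans hs.1).div (h.E_cont.mono fun s hs => h1.trans hs.1) fun s hs => (h.E_pos (h1.trans hs.1) (hs.2.trans_lt h2)).ne'
  have := h.master hL h1 h12 h2 hk
  convert this using 2
  refine intervalIntegral.integral_congr fun s hs => ?_
  rw [uIcc_of_le h12.le] at hs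
  have := (h.E_pos (h1.trans hs.1) (hs.2.trans_lt h2)).ne'
  field_simp
  ring
lemma Df_nonneg {L : ℝ} (hL : 0 ≤ L) {t : ℝ} (ht : t ∈ Ioo 0 T) (k : ℝ) : 0 ≤ Df n U Ut L k t := by
  have := h.Df_mono le_rfl hL ht k
  simpa [Df] using this
lemma kc {t1 t2 : ℝ} (h1 : T / 2 ≤ t1) (h2 : t2 < T) : ContinuousOn (fun t => Yn n m U t / En n U t) (Icc t1 t2) :=
  (h.Y_cont.mono fun s hs => h1.trans hs.1).div (h.E_cont.mono fun s hs => h1.trans hs.1) fun s hs => (h.E_pos (h1.trans hs.1) (hs.2.trans_lt h2)).ne'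
lemma zc {t1 t2 : ℝ} (h1 : T / 2 ≤ t1) : ContinuousOn (fun t => En n U t ^ ((1 + m) / 2)) (Icc t1 t2) := by
  have := h.hm0
  exact (h.E_cont.mono fun s hs => h1.trans hs.1).rpow_const fun s _ => Or.inr (by linarith)
lemma z_int {t1 t2 : ℝ} (h1 : T / 2 ≤ t1) (h12 : t1 ≤ t2) (h2 : t2 < T) :
    (1 + m) * ∫ t in t1..t2, Yn n m U t / En n U t * En n U t ^ ((1 + m) / 2) = En n U t1 ^ ((1 + m) / 2) - En n U t2 ^ ((1 + m) / 2) := by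
  have := intervalIntegral.integral_eq_sub_of_hasDerivAt_of_le h12 (h.zc h1) (fun t ht => h.z_dt ⟨h1.trans_lt ht.1, ht.2.trans h2⟩) (by
    apply ContinuousOn.intervalIntegrable
    rw [uIcc_of_le h12]
    exact (continuousOn_const.mul ((h.kc h1 h2).mul (h.zc h1))).neg)
  rw [intervalIntegral.integral_neg, intervalIntegral.integral_const_mul] at this
  linarith
lemma Q_anti {t1 t2 : ℝ} (h1 : T / 2 ≤ t1) (h12 : t1 ≤ t2) (h2 : t2 < T) : Qn n m U t2 ≤ Qn n m U t1 := by
  have hm0 := h.hm0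
  set q := Qn n m U t1 with hq
  set D : ℝ → ℝ := fun t => Yn n m U t - q * En n U t ^ ((1 + m) / 2) with hD
  have hDc : ContinuousOn D (Icc t1 t2) := (h.Y_cont.mono fun s hs => h1.trans hs.1).sub (continuousOn_const.mul (h.zc h1))
  have hz2 : 0 < En n U t2 ^ ((1 + m) / 2) := rpow_pos_of_pos (h.E_pos (h1.trans h12) h2) _
  suffices D t2 ≤ 0 by
    unfold Qn; rw [div_le_iff₀ hz2]; simp only [hD] at this; linarith
  by_contra hcon
  push Not at hcon
  have hD1 : D t1 = 0 := by
    have : 0 < En n U t1 ^ ((1 + m) / 2) := rpow_pos_of_pos (h.E_pos h1 (h12.trans_lt h2)) _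
    simp only [hD, hq, Qn]; field_simp; ring
  have hcl : IsClosed (Icc t1 t2 ∩ D ⁻¹' Iic 0) := hDc.preimage_isClosed_of_isClosed isClosed_Icc isClosed_Iic
  obtain ⟨s, hs, hsg⟩ := (isCompact_Icc.of_isClosed_subset hcl inter_subset_left).exists_isGreatest ⟨t1, ⟨le_rfl, h12⟩, hD1.le⟩
  have hs2 : s < t2 := lt_of_le_of_ne hs.1.2 (fun e => by
    have h0 : D s ≤ 0 := hs.2
    rw [e] at h0; linarith)
  have hs1 := h1.trans hs.1.1
  have hpos : ∀ x ∈ Icc s t2, s < x → 0 < D x := fun x hx hsx => by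
    by_contra hc
    have := hsg ⟨⟨hs.1.1.trans hx.1, hx.2⟩, not_lt.1 hc⟩
    linarith
  have ii : ∀ {f : ℝ → ℝ}, ContinuousOn f (Icc s t2) → IntervalIntegrable f volume s t2 := fun hf => by
    apply ContinuousOn.intervalIntegrable
    rwa [uIcc_of_le hs2.le]
  have m1 := h.masterQ le_rfl hs1 hs2 h2 (L := 0)
  have m2 := h.z_int hs1 hs2.le h2
  have e1 : (∫ t in s..t2, (Df n U Ut 0 (Yn n m U t / En n U t) t + Yn n m U t / En n U t * Yn n m U t)) =
      ∫ t in s..t2, Yn n m U t / En n U t * Yn n m U t := by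
    congr 1; ext t; simp [Df]
  have cY : ContinuousOn (Yn n m U) (Icc s t2) := h.Y_cont.mono fun s hs => hs1.trans hs.1
  have m3 : 0 ≤ ∫ t in s..t2, (Yn n m U t / En n U t * Yn n m U t - q * (Yn n m U t / En n U t * En n U t ^ ((1 + m) / 2))) := by
    refine intervalIntegral.integral_nonneg_of_ae_restrict hs2.le ((ae_restrict_iff' measurableSet_Icc).2 (?_))
    have : ∀ᵐ x : ℝ, x ≠ s := by simp [ae_iff, measure_singleton]
    filter_upwards [this] with x hx hx2
    have hp := hpos x hx2 (lt_of_le_of_ne hx2.1 (Ne.symm hx))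
    have a1 := h.E_pos (hs1.trans hx2.1) (hx2.2.trans_lt h2)
    have a2 := h.Y_pos (hs1.trans hx2.1) (hx2.2.trans_lt h2)
    have : Yn n m U x / En n U x * Yn n m U x - q * (Yn n m U x / En n U x * En n U x ^ ((1 + m) / 2)) = Yn n m U x / En n U x * D x := by
      simp only [hD]; ring
    simp only [Pi.zero_apply]
    rw [this]; positivity
  have i1 : IntervalIntegrable (fun t => Yn n m U t / En n U t * Yn n m U t) volume s t2 := ii ((h.kc hs1 h2).mul cY)
  have i2 : IntervalIntegrable (fun t => q * (Yn n m U t / En n U t * En n U t ^ ((1 + m) / 2))) volume s t2 :=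
    ii (continuousOn_const.mul ((h.kc hs1 h2).mul (h.zc hs1)))
  rw [intervalIntegral.integral_sub i1 i2, intervalIntegral.integral_const_mul] at m3
  rw [e1] at m1
  have hs0 : D s ≤ 0 := hs.2
  have : D t2 ≤ D s := by
    simp only [hD]
    have := mul_nonneg (by linarith : 0 ≤ 1 + m) m3
    have mq : q * ((1 + m) * ∫ t in s..t2, Yn n m U t / En n U t * En n U t ^ ((1 + m) / 2)) = q * (En n U s ^ ((1 + m) / 2) - En n U t2 ^ ((1 + m) / 2)) := by rw [m2]
    linarith
  linarith
lemma Def_int {L : ℝ} (hL : 0 ≤ L) {t1 t2 : ℝ} (h1 : T / 2 ≤ t1) (h12 : t1 < t2) (h2 : t2 < T) :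
    (∫ t in t1..t2, Df n U Ut L (Yn n m U t / En n U t) t) ≤ (Qn n m U t1 - Qn n m U t2) * En n U t1 ^ ((1 + m) / 2) := by
  have hm0 := h.hm0
  have ii : ∀ {f : ℝ → ℝ}, ContinuousOn f (Icc t1 t2) → IntervalIntegrable f volume t1 t2 := fun hf => by
    apply ContinuousOn.intervalIntegrable
    rwa [uIcc_of_le h12.le]
  have cY : ContinuousOn (Yn n m U) (Icc t1 t2) := h.Y_cont.mono fun s hs => h1.trans hs.1
  have cD := h.Df_cont hL h1 h2 (h.kc h1 h2)
  have m1 := h.masterQ hL h1 h12 h2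
  have m2 := h.z_int h1 h12.le h2
  have i1 : IntervalIntegrable (fun t => Yn n m U t / En n U t * Yn n m U t) volume t1 t2 := ii ((h.kc h1 h2).mul cY)
  rw [intervalIntegral.integral_add (ii cD) i1] at m1
  have m3 : ∫ t in t1..t2, Qn n m U t2 * (Yn n m U t / En n U t * En n U t ^ ((1 + m) / 2)) ≤ ∫ t in t1..t2, Yn n m U t / En n U t * Yn n m U t := by
    refine intervalIntegral.integral_mono_on h12.le (ii (continuousOn_const.mul ((h.kc h1 h2).mul (h.zc h1)))) (ii ((h.kc h1 h2).mul cY)) fun t ht => ?_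
    have a1 := h.E_pos (h1.trans ht.1) (ht.2.trans_lt h2)
    have a2 := h.Y_pos (h1.trans ht.1) (ht.2.trans_lt h2)
    have a3 := h.Q_anti (h1.trans ht.1) ht.2 h2
    have a4 : 0 < En n U t ^ ((1 + m) / 2) := rpow_pos_of_pos a1 _
    have a5 : Yn n m U t = Qn n m U t * En n U t ^ ((1 + m) / 2) := by unfold Qn; field_simp
    calc Qn n m U t2 * (Yn n m U t / En n U t * En n U t ^ ((1 + m) / 2)) ≤ Qn n m U t * (Yn n m U t / En n U t * En n U t ^ ((1 + m) / 2)) := by gcongr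
      _ = _ := by
        rw [show Yn n m U t / En n U t * Yn n m U t = Yn n m U t / En n U t * (Qn n m U t * En n U t ^ ((1 + m) / 2)) by rw [← a5]]; ring
  rw [intervalIntegral.integral_const_mul] at m3
  have hD0 : 0 ≤ ∫ t in t1..t2, Df n U Ut L (Yn n m U t / En n U t) t :=
    intervalIntegral.integral_nonneg h12.le fun t ht => h.Df_nonneg hL (h.sub_Ioo h1 h2 ht) _
  have b1 : Yn n m U t1 = Qn n m U t1 * En n U t1 ^ ((1 + m) / 2) := by
    have : 0 < En n U t1 ^ ((1 + m) / 2) := rpow_pos_of_pos (h.E_pos h1 (h12.trans h2)) _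
    unfold Qn; field_simp
  have b2 : Yn n m U t2 = Qn n m U t2 * En n U t2 ^ ((1 + m) / 2) := by
    have : 0 < En n U t2 ^ ((1 + m) / 2) := rpow_pos_of_pos (h.E_pos (h1.trans h12.le) h2) _
    unfold Qn; field_simp
  rw [b1, b2] at m1
  have m4 := mul_le_mul_of_nonneg_left m3 (by linarith : 0 ≤ 1 + m)
  have mq : Qn n m U t2 * ((1 + m) * ∫ t in t1..t2, Yn n m U t / En n U t * En n U t ^ ((1 + m) / 2)) =
    Qn n m U t2 * (En n U t1 ^ ((1 + m) / 2) - En n U t2 ^ ((1 + m) / 2)) := by rw [m2]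
  have mp := mul_nonneg hm0.le hD0
  linarith
lemma e_cmp {t k1 k2 : ℝ} (h1 : T / 2 ≤ t) (h2 : t < T) (H : ∀ s ∈ Ioo t T, k1 ≤ Qn n m U s ∧ Qn n m U s ≤ k2) :
    (1 - m) * k1 * (T - t) ≤ En n U t ^ ((1 - m) / 2) ∧ En n U t ^ ((1 - m) / 2) ≤ (1 - m) * k2 * (T - t) := by
  have hm1 := h.hm1
  have ec : ContinuousOn (fun t => En n U t ^ ((1 - m) / 2)) (Icc t T) :=
    (h.E_cont.mono fun s hs => h1.trans hs.1).rpow_const fun s _ => Or.inr (by linarith)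
  have eT : En n U T ^ ((1 - m) / 2) = 0 := by
    rw [h.E_T]; exact zero_rpow (by linarith)
  have key : ∀ k : ℝ, ∀ s ∈ Ioo t T, HasDerivAt (fun t => En n U t ^ ((1 - m) / 2) + (1 - m) * k * t) (-((1 - m) * Qn n m U s) + (1 - m) * k) s := fun k s hs => by
    exact ((h.e_dt ⟨h1.trans_lt hs.1, hs.2⟩).add ((hasDerivAt_id' s).const_mul ((1 - m) * k))).congr_deriv (by ring)
  have kc : ∀ k : ℝ, ContinuousOn (fun t => En n U t ^ ((1 - m) / 2) + (1 - m) * k * t) (Icc t T) := fun k => ec.add (by fun_prop)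
  constructor
  · have := antitoneOn_of_deriv_nonpos (convex_Icc t T) (kc k1) (fun s hs => by
      rw [interior_Icc] at hs
      exact (key k1 s hs).differentiableAt.differentiableWithinAt) (fun s hs => by
      rw [interior_Icc] at hs
      rw [(key k1 s hs).deriv]
      nlinarith [(H s hs).1]) (left_mem_Icc.2 h2.le) (right_mem_Icc.2 h2.le) h2.le
    simp only [eT] at this
    linarith
  · have := monotoneOn_of_deriv_nonneg (convex_Icc t T) (kc k2) (fun s hs => by
      rw [interior_Icc] at hs
      exact (key k2 s hs).differentiableAt.differentiableWithinAt) (fun s hs => by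
      rw [interior_Icc] at hs
      rw [(key k2 s hs).deriv]
      nlinarith [(H s hs).2]) (left_mem_Icc.2 h2.le) (right_mem_Icc.2 h2.le) h2.le
    simp only [eT] at this
    linarith
end Core
lemma S_ge_pow (n : ℕ) {r : ℝ} (hr : 0 ≤ r) : r ^ n ≤ S n r := pow_le_pow_left₀ hr (self_le_sinh_iff.2 hr) n
lemma Ik_int {n : ℕ} (hn : 1 ≤ n) {α : ℝ} (h0 : 0 < α) (h1 : α < 1) (hs : (n:ℝ) - 1 < (n + 1) * α) :
    IntegrableOn (fun r => (r * S n r) ^ α / S n r) (Ioi 0) := by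
  have hn' : (1:ℝ) ≤ n := by exact_mod_cast hn
  have e : ∀ r > 0, (r * S n r) ^ α / S n r = r ^ α * S n r ^ (α - 1) := fun r hr => by
    have := S_pos n hr
    rw [mul_rpow hr.le this.le, rpow_sub_one this.ne']; ring
  have hc : ContinuousOn (fun r => (r * S n r) ^ α / S n r) (Ioi 0) := by
    refine ContinuousOn.div (((continuous_id.mul (S_cont n)).rpow_const fun _ => Or.inr h0.le).continuousOn) (S_cont n).continuousOn fun r hr => (S_pos n hr).ne'
  rw [← Ioc_union_Ioi_eq_Ioi (zero_le_one' ℝ)]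
  refine IntegrableOn.union ?_ ?_
  · have i1 : IntegrableOn (fun r : ℝ => r ^ ((n + 1) * α - n)) (Ioc 0 1) := by
      rw [← intervalIntegrable_iff_integrableOn_Ioc_of_le zero_le_one]
      exact intervalIntegral.intervalIntegrable_rpow' (by linarith)
    refine Integrable.mono' i1 ((hc.mono Ioc_subset_Ioi_self).aestronglyMeasurable measurableSet_Ioc) ?_
    refine (ae_restrict_iff' measurableSet_Ioc).2 (Eventually.of_forall fun r hr => ?_)
    have hS := S_pos n hr.1
    have hr0 := hr.1
    rw [norm_of_nonneg (by positivity), e r hr.1]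
    have := rpow_le_rpow_of_nonpos (pow_pos hr0 n) (S_ge_pow n hr0.le) (by linarith : α - 1 ≤ 0)
    calc r ^ α * S n r ^ (α - 1) ≤ r ^ α * (r ^ n) ^ (α - 1) := by gcongr
      _ = r ^ ((n + 1) * α - n) := by
        rw [← rpow_natCast, ← rpow_mul hr0.le, ← rpow_add hr0]; congr 1; ring
  · set δ := n * (1 - α) / 2 with hδ
    have hδ0 : 0 < δ := by
      have : 0 < 1 - α := by linarith
      positivity
    have i1 : IntegrableOn (fun r => ((((4:ℝ) ^ n)⁻¹) ^ (α - 1) / δ) * exp (-δ * r)) (Ioi 1) := (exp_neg_integrableOn_Ioi 1 hδ0).const_mul _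
    refine Integrable.mono' i1 ((hc.mono (Ioi_subset_Ioi zero_le_one)).aestronglyMeasurable measurableSet_Ioi) ?_
    refine (ae_restrict_iff' measurableSet_Ioi).2 (Eventually.of_forall fun r hr => ?_)
    have hr1 : 1 < r := hr
    have hr0 : 0 < r := by linarith
    have hS := S_pos n hr0
    rw [norm_of_nonneg (by positivity), e r hr0]
    have hle : ((4:ℝ) ^ n)⁻¹ * exp (n * r) ≤ S n r := by
      rw [inv_mul_le_iff₀ (by positivity)]; exact exp_le_S n hr1.le
    have a1 := rpow_le_rpow_of_nonpos (by positivity) hle (by linarith : α - 1 ≤ 0)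
    have a2 : r ^ α ≤ r := by
      calc r ^ α ≤ r ^ (1:ℝ) := rpow_le_rpow_of_exponent_le hr1.le h1.le
        _ = r := rpow_one r
    have a3 : r ≤ exp (δ * r) / δ := by
      rw [le_div_iff₀ hδ0]
      have := add_one_le_exp (δ * r)
      linarith
    calc r ^ α * S n r ^ (α - 1) ≤ (exp (δ * r) / δ) * (((4:ℝ) ^ n)⁻¹ * exp (n * r)) ^ (α - 1) := by
          gcongr; exact a2.trans a3
      _ = _ := by
        rw [mul_rpow (by positivity) (by positivity), ← exp_mul, show n * r * (α - 1) = -(δ * r) + -δ * r by rw [hδ]; ring, exp_add]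
        have : exp (δ * r) * exp (-(δ * r)) = 1 := by rw [← exp_add]; simp
        calc _ = (exp (δ * r) * exp (-(δ * r))) * ((((4:ℝ) ^ n)⁻¹) ^ (α - 1) / δ * exp (-δ * r)) := by ring
          _ = _ := by rw [this, one_mul]
namespace Core
variable {n : ℕ} {m T : ℝ} {U Ut : ℝ → ℝ → ℝ} (h : Core n m T U Ut)
include h
local notation "wU" => wf m U
local notation "gU" => gf m T U
local notation "MU" => Mu n U
local notation "Mt" => Mu n Ut
lemma M_young {r t A : ℝ} (hr : 0 ≤ r) (ht : T / 2 ≤ t) (hA : 0 < A) :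
    MU r t ≤ A * (r * S n r) + A ^ (-m) * Yn n m U t := by
  have hm0 := h.hm0
  have hp : ∀ x, U x t ≤ A + A ^ (-m) * (U x t * wU x t) := fun x => by
    have u0 := h.nonneg x t
    have w0 := h.w_nonneg x t
    have A0 : 0 < A ^ (-m) := rpow_pos_of_pos hA _
    rcases le_total (U x t) A with hle | hle
    · have : 0 ≤ A ^ (-m) * (U x t * wU x t) := by positivity
      linarith
    · have : 1 ≤ A ^ (-m) * wU x t := by
        rw [rpow_neg hA.le, ← div_eq_inv_mul, le_div_iff₀ (rpow_pos_of_pos hA _), one_mul]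
        exact rpow_le_rpow hA.le hle hm0.le
      nlinarith
  have cuw : Continuous fun x => U x t * wU x t := (h.cr t).mul (h.wcr t)
  have h1 : MU r t ≤ Mf n (fun x => A + A ^ (-m) * (U x t * wU x t)) r :=
    Mf_mono_fun (h.cr t) (continuous_const.add (continuous_const.mul cuw)) hr fun x _ => hp x
  have h2 : Mf n (fun x => A + A ^ (-m) * (U x t * wU x t)) r = Mf n (fun _ => A) r + A ^ (-m) * ∫ x in 0..r, S n x * U x t * wU x t := by
    unfold Mf
    rw [← intervalIntegral.integral_const_mul, ← intervalIntegral.integral_add]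
    · congr 1; ext x; ring
    · exact ((S_cont n).mul continuous_const).intervalIntegrable _ _
    · exact (continuous_const.mul (h.Fy_cont t)).intervalIntegrable _ _
  have h3 := (le_abs_self _).trans (Mf_abs_le' (n := n) (f := fun _ => A) continuous_const hr (C := A) fun x _ => (abs_of_pos hA).le)
  have h4 := mul_le_mul_of_nonneg_left (h.yR_le ht hr) (rpow_pos_of_pos hA (-m)).le
  calc _ ≤ _ := h1
    _ = _ := h2
    _ ≤ _ := by linarith
lemma M_holder {r t : ℝ} (hr : 0 < r) (ht : T / 2 ≤ t) (ht' : t < T) :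
    MU r t * (MU r t / S n r) ≤ 4 * Yn n m U t ^ (2 / (1 + m)) * ((r * S n r) ^ (2 * m / (1 + m)) / S n r) := by
  have hm0 := h.hm0
  have hY := h.Y_pos ht ht'
  have hS := S_pos n hr
  set B := r * S n r with hB
  have hB0 : 0 < B := by positivity
  have hA : 0 < (Yn n m U t / B) ^ (1 / (1 + m)) := by positivity
  have h1 := h.M_young hr.le ht hA
  rw [← hB] at h1
  set Y := Yn n m U t
  have e1 : (Y / B) ^ (1 / (1 + m)) * B = Y ^ (1 / (1 + m)) * B ^ (m / (1 + m)) := by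
    rw [div_rpow hY.le hB0.le, div_mul_eq_mul_div, mul_div_assoc]
    congr 1
    nth_rw 1 [← rpow_one B]
    rw [← rpow_sub hB0]; congr 1; field_simp; ring
  have e2 : ((Y / B) ^ (1 / (1 + m))) ^ (-m) * Y = Y ^ (1 / (1 + m)) * B ^ (m / (1 + m)) := by
    rw [← rpow_mul (by positivity), div_rpow hY.le hB0.le, div_eq_mul_inv, ← rpow_neg hB0.le]
    rw [show Y ^ (1 / (1 + m) * -m) * B ^ (-(1 / (1 + m) * -m)) * Y = (Y ^ (1 / (1 + m) * -m) * Y ^ (1:ℝ)) * B ^ (-(1 / (1 + m) * -m)) by rw [rpow_one]; ring]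
    rw [← rpow_add hY]
    congr 2
    · field_simp; ring
    · field_simp
  rw [e1, e2] at h1
  have h0 := h.M_nonneg hr.le t
  have h2 : MU r t * MU r t ≤ (2 * (Y ^ (1 / (1 + m)) * B ^ (m / (1 + m)))) * (2 * (Y ^ (1 / (1 + m)) * B ^ (m / (1 + m)))) :=
    mul_le_mul (by linarith) (by linarith) h0 (by positivity)
  have e3 : (2 * (Y ^ (1 / (1 + m)) * B ^ (m / (1 + m)))) * (2 * (Y ^ (1 / (1 + m)) * B ^ (m / (1 + m)))) = 4 * Y ^ (2 / (1 + m)) * B ^ (2 * m / (1 + m)) := by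
    rw [show 2 / (1 + m) = 1 / (1 + m) + 1 / (1 + m) by ring, show 2 * m / (1 + m) = m / (1 + m) + m / (1 + m) by ring, rpow_add hY, rpow_add hB0]
    ring
  rw [← mul_div_assoc, ← mul_div_assoc]
  rw [e3] at h2
  gcongr
lemma Q_low : ∃ K > 0, ∀ t, T / 2 ≤ t → t < T → K ≤ Qn n m U t := by
  have hm0 := h.hm0
  have hm1 := h.hm1
  have hi := Ik_int h.hn (α := 2 * m / (1 + m)) (by positivity) (by rw [div_lt_one (by linarith)]; linarith) (by
    rw [mul_div_assoc', lt_div_iff₀ (by linarith)]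
    have := h.hsub
    nlinarith)
  set I := ∫ r in Ioi (0:ℝ), (r * S n r) ^ (2 * m / (1 + m)) / S n r with hI
  have hI0 : 0 ≤ I := setIntegral_nonneg measurableSet_Ioi fun r hr => by
    have h1 := S_pos n hr
    have h2 : 0 < r := hr
    positivity
  refine ⟨((4 * (I + 1)) ^ ((1 + m) / 2))⁻¹, by positivity, fun t ht ht' => ?_⟩
  have hY := h.Y_pos ht ht'
  have hE : En n U t ≤ 4 * (I + 1) * Yn n m U t ^ (2 / (1 + m)) := by
    have := setIntegral_mono_on (h.Fe_int ht) (hi.const_mul (4 * Yn n m U t ^ (2 / (1 + m)))) measurableSet_Ioi fun r hr => h.M_holder hr ht ht'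
    rw [integral_const_mul] at this
    have h0 : 0 < Yn n m U t ^ (2 / (1 + m)) := by positivity
    calc En n U t ≤ 4 * Yn n m U t ^ (2 / (1 + m)) * I := this
      _ ≤ _ := by nlinarith
  have hE0 := h.E_pos ht ht'
  unfold Qn
  rw [inv_eq_one_div, div_le_div_iff₀ (by positivity) (by positivity), one_mul]
  calc En n U t ^ ((1 + m) / 2) ≤ (4 * (I + 1) * Yn n m U t ^ (2 / (1 + m))) ^ ((1 + m) / 2) := by gcongr
    _ = _ := by
      rw [mul_rpow (by positivity) (by positivity), ← rpow_mul hY.le, show 2 / (1 + m) * ((1 + m) / 2) = 1 by field_simp, rpow_one, mul_comm]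
lemma E_of_e {t : ℝ} (ht : T / 2 ≤ t) (ht' : t < T) : (En n U t ^ ((1 - m) / 2)) ^ (2 * ex m) = En n U t := by
  have hm1 := h.hm1
  have := h.E_pos ht ht'
  have h1 : 1 - m ≠ 0 := by linarith
  rw [← rpow_mul this.le, show (1 - m) / 2 * (2 * ex m) = 1 by unfold ex; field_simp, rpow_one]
lemma E_bd : ∃ c > 0, ∃ C > 0, ∀ t, T / 2 ≤ t → t < T → c * (T - t) ^ (2 * ex m) ≤ En n U t ∧ En n U t ≤ C * (T - t) ^ (2 * ex m) := by
  obtain ⟨K, hK, hQ⟩ := h.Q_low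
  have hm1 := h.hm1
  have hT := h.hT
  have ha := ex_gt h.hm0 h.hm1
  have hK2 : 0 < Qn n m U (T / 2) := hK.trans_le (hQ _ le_rfl (by linarith))
  have h1m : 0 < 1 - m := by linarith
  refine ⟨((1 - m) * K) ^ (2 * ex m), by positivity, ((1 - m) * Qn n m U (T / 2)) ^ (2 * ex m), by positivity, fun t ht ht' => ?_⟩
  have := h.e_cmp ht ht' (k1 := K) (k2 := Qn n m U (T / 2)) fun s hs => ⟨hQ s (ht.trans hs.1.le) hs.2, h.Q_anti le_rfl (ht.trans hs.1.le) hs.2⟩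
  have hth : 0 < T - t := by linarith
  rw [← h.E_of_e ht ht', ← mul_rpow (by positivity) hth.le, ← mul_rpow (by positivity) hth.le]
  have hE := h.E_pos ht ht'
  exact ⟨rpow_le_rpow (by positivity) this.1 (by linarith), rpow_le_rpow (by positivity) this.2 (by linarith)⟩
lemma good_times {η L ε : ℝ} (hη : 0 < η) (hη1 : η < 1) (hL : 0 ≤ L) (hε : 0 < ε) :
    ∃ τ, T / 2 ≤ τ ∧ τ < T ∧ ∀ t, τ ≤ t → t < T → ∃ t', t ≤ t' ∧ t' ≤ t + η * (T - t) ∧ ∃ κ, |κ * (T - t') - ex m| ≤ ε ∧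
      Df n U Ut L κ t' ≤ ε * (T - t') ^ (2 * ex m - 2) := by
  obtain ⟨K, hK, hQ⟩ := h.Q_low
  obtain ⟨c, hc, C, hC, hE⟩ := h.E_bd
  have hm1 := h.hm1
  have hm0 := h.hm0
  have hT := h.hT
  have ha := ex_gt h.hm0 h.hm1
  have h1m : 0 < 1 - m := by linarith
  have ham := ex_mul h.hm1
  set A := Qn n m U '' (Ico (T / 2) T) with hA
  have hne : A.Nonempty := ⟨_, T / 2, ⟨le_rfl, by linarith⟩, rfl⟩
  have hbd : BddBelow A := ⟨K, by rintro _ ⟨s, hs, rfl⟩; exact hQ s hs.1 hs.2⟩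
  set q := sInf A with hq
  have hqK : K ≤ q := le_csInf hne (by rintro _ ⟨s, hs, rfl⟩; exact hQ s hs.1 hs.2)
  have hq0 : 0 < q := hK.trans_le hqK
  have hql : ∀ s, T / 2 ≤ s → s < T → q ≤ Qn n m U s := fun s h1 h2 => csInf_le hbd ⟨s, ⟨h1, h2⟩, rfl⟩
  set C' := C ^ ((1 + m) / 2) with hC'
  have hC'0 : 0 < C' := by positivity
  have h1η : 0 < 1 - η := by linarith
  set B := 2 * C' / η / (1 - η) ^ (2 * ex m - 2) with hB
  have hB0 : 0 < B := by positivity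
  set δ := min (ε * q / ex m) (ε / B) with hδ
  have hδ0 : 0 < δ := by
    have : 0 < ex m := by linarith
    rw [hδ]; positivity
  obtain ⟨_, ⟨τ, hτ, rfl⟩, hτq⟩ := exists_lt_of_csInf_lt hne (show sInf A < q + δ by linarith)
  refine ⟨τ, hτ.1, hτ.2, fun t ht ht' => ?_⟩
  have ht2 : T / 2 ≤ t := hτ.1.trans ht
  have hth : 0 < T - t := by linarith
  have hqu : ∀ s, t ≤ s → s < T → Qn n m U s ≤ q + δ := fun s h1 h2 => (h.Q_anti hτ.1 (ht.trans h1) h2).trans hτq.le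
  set t2 := t + η * (T - t) with ht2d
  have h12 : t < t2 := by
    have : 0 < η * (T - t) := by positivity
    linarith
  have h2T : t2 < T := by nlinarith
  have hint := h.Def_int hL ht2 h12 h2T
  have hz : En n U t ^ ((1 + m) / 2) ≤ C' * (T - t) ^ (2 * ex m - 1) := by
    calc En n U t ^ ((1 + m) / 2) ≤ (C * (T - t) ^ (2 * ex m)) ^ ((1 + m) / 2) := rpow_le_rpow (h.E_pos ht2 ht').le (hE t ht2 ht').2 (by linarith)
      _ = _ := by
        rw [mul_rpow hC.le (by positivity), ← rpow_mul hth.le]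
        congr 2
        linear_combination ham
  have hz0 : 0 < En n U t ^ ((1 + m) / 2) := rpow_pos_of_pos (h.E_pos ht2 ht') _
  have hint2 : (∫ s in t..t2, Df n U Ut L (Yn n m U s / En n U s) s) ≤ δ * (C' * (T - t) ^ (2 * ex m - 1)) := by
    refine hint.trans (mul_le_mul ?_ hz hz0.le hδ0.le)
    have := hql t2 (ht2.trans h12.le) h2T
    have := hqu t le_rfl ht'
    linarith
  have hex : ∃ t' ∈ Icc t t2, Df n U Ut L (Yn n m U t' / En n U t') t' ≤ 2 * (δ * (C' * (T - t) ^ (2 * ex m - 1))) / (η * (T - t)) := by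
    by_contra hcon
    push Not at hcon
    have := intervalIntegral.integral_mono_on (μ := volume) h12.le (continuous_const.intervalIntegrable t t2) (by
      apply ContinuousOn.intervalIntegrable
      rw [uIcc_of_le h12.le]
      exact h.Df_cont hL ht2 h2T (h.kc ht2 h2T)) fun s hs => (hcon s hs).le
    rw [intervalIntegral.integral_const, smul_eq_mul, show t2 - t = η * (T - t) by rw [ht2d]; ring, mul_div_cancel₀ _ (by positivity)] at this
    have h0 : 0 < δ * (C' * (T - t) ^ (2 * ex m - 1)) := by positivity
    linarith
  obtain ⟨t', ht'm, hDf⟩ := hex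
  have h2t' := ht2.trans ht'm.1
  have htT := ht'm.2.trans_lt h2T
  have hth' : 0 < T - t' := by linarith
  refine ⟨t', ht'm.1, ht'm.2, _, ?_, hDf.trans ?_⟩
  · have he := h.e_cmp h2t' htT (k1 := q) (k2 := q + δ) fun s hs => ⟨hql s (h2t'.trans hs.1.le) hs.2, hqu s (ht'm.1.trans hs.1.le) hs.2⟩
    set e := En n U t' ^ ((1 - m) / 2) with hee
    have hE0 := h.E_pos h2t' htT
    have he0 : 0 < e := rpow_pos_of_pos hE0 _
    have hk : Yn n m U t' / En n U t' = Qn n m U t' / e := by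
      unfold Qn
      rw [div_div, hee, ← rpow_add hE0, show (1 + m) / 2 + (1 - m) / 2 = 1 by ring, rpow_one]
    have q1 := hql t' h2t' htT
    have q2 := hqu t' ht'm.1 htT
    have hδ1 : ex m * δ ≤ ε * q := by
      have := min_le_left (ε * q / ex m) (ε / B)
      rw [← hδ, le_div_iff₀ (by linarith)] at this
      linarith
    have hexm : ex m * (1 - m) = 1 := by linarith
    rw [hk, div_mul_eq_mul_div, abs_le]
    have hb := mul_le_mul_of_nonneg_left he.1 (by linarith : 0 ≤ ex m)
    have hb2 := mul_le_mul_of_nonneg_left he.2 (by linarith : 0 ≤ ex m)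
    have r1 : ex m * ((1 - m) * q * (T - t')) = q * (T - t') := by linear_combination (q * (T - t')) * hexm
    have r2 : ex m * ((1 - m) * (q + δ) * (T - t')) = (q + δ) * (T - t') := by linear_combination ((q + δ) * (T - t')) * hexm
    rw [r1] at hb
    rw [r2] at hb2
    have k1 : δ * (T - t') ≤ ε * e := by
      have : q * (δ * (T - t')) ≤ q * (ε * e) := by
        calc q * (δ * (T - t')) = δ * (q * (T - t')) := by ring
          _ ≤ δ * (ex m * e) := by gcongr
          _ = ex m * δ * e := by ring
          _ ≤ ε * q * e := by gcongr
          _ = _ := by ring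
      exact le_of_mul_le_mul_left this hq0
    have k2 := mul_le_mul_of_nonneg_right q1 hth'.le
    have k3 := mul_le_mul_of_nonneg_right q2 hth'.le
    constructor
    · rw [neg_le_sub_iff_le_add, ← sub_le_iff_le_add, le_div_iff₀ he0]
      linarith
    · rw [sub_le_iff_le_add, div_le_iff₀ he0]
      linarith
  · have e1 : 2 * (δ * (C' * (T - t) ^ (2 * ex m - 1))) / (η * (T - t)) = δ * (2 * C' / η * (T - t) ^ (2 * ex m - 2)) := by
      rw [show 2 * ex m - 1 = (2 * ex m - 2) + 1 by ring, rpow_add hth, rpow_one]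
      field_simp
    have e2 : (T - t) ^ (2 * ex m - 2) ≤ (T - t') ^ (2 * ex m - 2) / (1 - η) ^ (2 * ex m - 2) := by
      rw [← div_rpow hth'.le h1η.le]
      refine rpow_le_rpow hth.le ?_ (by linarith)
      rw [le_div_iff₀ h1η]
      have := ht'm.2
      rw [ht2d] at this
      linarith
    have e3 : δ * B ≤ ε := by
      have := min_le_right (ε * q / ex m) (ε / B)
      rwa [← hδ, le_div_iff₀ hB0] at this
    rw [e1]
    calc δ * (2 * C' / η * (T - t) ^ (2 * ex m - 2)) ≤ δ * (2 * C' / η * ((T - t') ^ (2 * ex m - 2) / (1 - η) ^ (2 * ex m - 2))) := by gcongr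
      _ = δ * B * (T - t') ^ (2 * ex m - 2) := by rw [hB]; ring
      _ ≤ _ := by gcongr
end Core
lemma exp_int_le {γ x y : ℝ} (hγ : 0 < γ) : ∫ ρ in x..y, exp (-(γ * ρ)) ≤ exp (-(γ * x)) / γ := by
  have := intervalIntegral.integral_eq_sub_of_hasDerivAt (a := x) (b := y) (f := fun ρ => -(exp (-(γ * ρ)) / γ)) (f' := fun ρ => exp (-(γ * ρ)))
    (fun ρ _ => by
      refine ((((hasDerivAt_id' ρ).const_mul γ).neg.exp).div_const γ).neg.congr_deriv ?_
      field_simp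
      rfl) (by apply Continuous.intervalIntegrable; fun_prop)
  rw [this]
  have : 0 ≤ exp (-(γ * y)) / γ := by positivity
  linarith
lemma inv_S_le {n : ℕ} {r : ℝ} (hr : 1 ≤ r) : (S n r)⁻¹ ≤ 4 ^ n * exp (-(n * r)) := by
  have := exp_le_S n hr
  rw [exp_neg, inv_le_comm₀ (S_pos n (by linarith)) (by positivity), mul_inv, inv_inv, inv_mul_le_iff₀ (by positivity)]
  exact this
lemma G_far {n : ℕ} (hn : 1 ≤ n) {x y : ℝ} (hx : 1 ≤ x) (hxy : x ≤ y) : ∫ ρ in x..y, (S n ρ)⁻¹ ≤ 4 ^ n * exp (-(n * x)) := by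
  have hn' : (1:ℝ) ≤ n := by exact_mod_cast hn
  have h1 : ∫ ρ in x..y, (S n ρ)⁻¹ ≤ ∫ ρ in x..y, 4 ^ n * exp (-(n * ρ)) := by
    refine intervalIntegral.integral_mono_on hxy ?_ ((by fun_prop : Continuous fun ρ : ℝ => (4:ℝ) ^ n * exp (-(n * ρ))).intervalIntegrable _ _) fun ρ hρ => inv_S_le (hx.trans hρ.1)
    apply ContinuousOn.intervalIntegrable
    rw [uIcc_of_le hxy]
    exact (S_cont n).continuousOn.inv₀ fun ρ hρ => (S_pos n (by linarith [hρ.1])).ne'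
  rw [intervalIntegral.integral_const_mul] at h1
  refine h1.trans (mul_le_mul_of_nonneg_left ((exp_int_le (by linarith)).trans ?_) (by positivity))
  exact div_le_self (exp_pos _).le hn'
lemma sinh_ge_rpow {κ ρ : ℝ} (h1 : 1 ≤ κ) (h2 : κ ≤ 2) (hρ : 0 < ρ) : ρ ^ κ / 4 ≤ sinh ρ := by
  rcases le_total ρ 1 with h | h
  · have a1 : ρ ^ κ ≤ ρ ^ (1:ℝ) := rpow_le_rpow_of_exponent_ge hρ h h1
    rw [rpow_one] at a1
    have := self_le_sinh_iff.2 hρ.le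
    linarith
  · have a1 : ρ ^ κ ≤ ρ ^ (2:ℝ) := rpow_le_rpow_of_exponent_le h h2
    rw [rpow_two] at a1
    have a2 := quadratic_le_exp_of_nonneg hρ.le
    have a3 : exp (-ρ) ≤ 1 := by rw [exp_le_one_iff]; linarith
    rw [sinh_eq]
    nlinarith
lemma G_near {n : ℕ} {κ x y : ℝ} (h1 : 1 ≤ κ) (h2 : κ ≤ 2) (hk : 1 < n * κ) (hx : 0 < x) (hxy : x ≤ y) :
    ∫ ρ in x..y, (S n ρ)⁻¹ ≤ 4 ^ n / (n * κ - 1) * x ^ (-(n * κ - 1)) := by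
  have hμ : 0 < n * κ - 1 := by linarith
  have h0 : ∀ ρ ∈ Icc x y, ρ ≠ 0 := fun ρ hρ => (hx.trans_le hρ.1).ne'
  have h3 : ∫ ρ in x..y, (S n ρ)⁻¹ ≤ ∫ ρ in x..y, 4 ^ n * ρ ^ (-(n * κ)) := by
    refine intervalIntegral.integral_mono_on hxy ?_ ?_ fun ρ hρ => ?_
    · apply ContinuousOn.intervalIntegrable
      rw [uIcc_of_le hxy]
      exact (S_cont n).continuousOn.inv₀ fun ρ hρ => (S_pos n (by linarith [hρ.1])).ne'
    · apply ContinuousOn.intervalIntegrable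
      rw [uIcc_of_le hxy]
      exact continuousOn_const.mul (continuousOn_id.rpow_const fun ρ hρ => Or.inl (h0 ρ hρ))
    · have hρ0 : 0 < ρ := hx.trans_le hρ.1
      have := pow_le_pow_left₀ (by positivity) (sinh_ge_rpow h1 h2 hρ0) n
      rw [inv_le_comm₀ (S_pos n hρ0) (by positivity), mul_inv, rpow_neg hρ0.le, inv_inv, mul_comm (n:ℝ), rpow_mul hρ0.le, rpow_natCast, ← div_eq_inv_mul, ← div_pow]
      exact this
  rw [intervalIntegral.integral_const_mul, integral_rpow (Or.inr ⟨by linarith, by rw [uIcc_of_le hxy]; exact fun h => h0 0 h rfl⟩)] at h3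
  refine h3.trans ?_
  rw [show -(n * κ) + 1 = -(n * κ - 1) by ring, div_neg, ← neg_div, mul_div_assoc', div_mul_eq_mul_div]
  have : 0 ≤ y ^ (-(n * κ - 1)) := by have := hx.trans_le hxy; positivity
  gcongr
  linarith
namespace Core
variable {n : ℕ} {m T : ℝ} {U Ut : ℝ → ℝ → ℝ} (h : Core n m T U Ut)
include h
local notation "wU" => wf m U
local notation "gU" => gf m T U
local notation "MU" => Mu n U
local notation "Mt" => Mu n Ut
lemma g_le_of {x t B : ℝ} (hx : 0 ≤ x) (ht : T / 2 ≤ t) (ht' : t < T) (H : ∀ y ≥ x, ∫ r in x..y, MU r t / S n r ≤ B) : gU x t ≤ B := by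
  obtain ⟨C, hC, hg⟩ := h.g_decay
  have hT := h.hT
  have hn : (1:ℝ) ≤ n := by exact_mod_cast h.hn
  have hlim : Tendsto (fun y : ℝ => B + C * (T - t) * exp (-(n * y / 2))) atTop (𝓝 (B + C * (T - t) * 0)) := by
    refine tendsto_const_nhds.add (tendsto_const_nhds.mul ?_)
    refine tendsto_exp_neg_atTop_nhds_zero.comp ?_
    exact (tendsto_id.const_mul_atTop (by linarith : (0:ℝ) < n)).atTop_div_const (by norm_num)
  rw [mul_zero, add_zero] at hlim
  refine ge_of_tendsto hlim ((eventually_ge_atTop x).mono fun y hy => ?_)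
  have h1 := h.g_diff hx hy (t := t) ⟨by linarith, ht'⟩
  have h2 := H y hy
  have h3 := hg y (hx.trans hy) t ⟨ht, ht'.le⟩
  linarith
lemma g_tail {x t γ D : ℝ} (hx : 1 ≤ x) (ht : T / 2 ≤ t) (ht' : t < T) (hγ : 0 < γ) (hD : 0 ≤ D)
    (H : ∀ y ≥ x, MU y t ≤ D * exp ((n - γ) * y)) : gU x t ≤ 4 ^ n * D / γ * exp (-(γ * x)) := by
  refine h.g_le_of (by linarith) ht ht' fun y hy => ?_
  have : ∫ r in x..y, MU r t / S n r ≤ ∫ r in x..y, 4 ^ n * D * exp (-(γ * r)) := by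
    refine intervalIntegral.integral_mono_on hy (h.MS_int (by linarith) (by linarith) t) ((by fun_prop : Continuous fun ρ : ℝ => (4:ℝ) ^ n * D * exp (-(γ * ρ))).intervalIntegrable _ _) fun r hr => ?_
    rw [div_eq_mul_inv]
    have hr1 := hx.trans hr.1
    have := S_pos n (by linarith : 0 < r)
    calc _ ≤ (D * exp ((n - γ) * r)) * (4 ^ n * exp (-(n * r))) := by
          gcongr
          · exact H r hr.1
          · exact inv_S_le hr1
      _ = 4 ^ n * D * (exp ((n - γ) * r) * exp (-(n * r))) := by ring
      _ = _ := by rw [← exp_add]; congr 2; ring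
  refine this.trans ?_
  rw [intervalIntegral.integral_const_mul, div_mul_eq_mul_div, mul_div_assoc]
  exact mul_le_mul_of_nonneg_left (exp_int_le hγ) (by positivity)
lemma g_CS {x t lam B : ℝ} (hx : 0 < x) (ht : T / 2 ≤ t) (ht' : t < T) (hl : 0 < lam)
    (H : ∀ y ≥ x, ∫ r in x..y, (S n r)⁻¹ ≤ B) : gU x t ≤ lam / 2 * En n U t + 1 / (2 * lam) * B := by
  refine h.g_le_of hx.le ht ht' fun y hy => ?_
  have c : ContinuousOn (fun r => (S n r)⁻¹) (Icc x y) := (S_cont n).continuousOn.inv₀ fun ρ hρ => (S_pos n (by linarith [hρ.1])).ne'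
  have c2 : ContinuousOn (fun r => MU r t * (MU r t / S n r)) (Icc 0 y) := (h.Fe_cont t).mono fun r hr => hr.1
  have i1 : IntervalIntegrable (fun r => 1 / (2 * lam) * (S n r)⁻¹) volume x y := by
    apply ContinuousOn.intervalIntegrable
    rw [uIcc_of_le hy]; exact continuousOn_const.mul c
  have hy0 := hx.le.trans hy
  have i0 : IntervalIntegrable (fun r => MU r t * (MU r t / S n r)) volume 0 y := by
    apply ContinuousOn.intervalIntegrable
    rw [uIcc_of_le hy0]; exact c2
  have i2 : IntervalIntegrable (fun r => lam / 2 * (MU r t * (MU r t / S n r))) volume x y := by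
    apply ContinuousOn.intervalIntegrable
    rw [uIcc_of_le hy]; exact continuousOn_const.mul (c2.mono (Icc_subset_Icc_left hx.le))
  have h1 : ∫ r in x..y, MU r t / S n r ≤ ∫ r in x..y, (lam / 2 * (MU r t * (MU r t / S n r)) + 1 / (2 * lam) * (S n r)⁻¹) := by
    refine intervalIntegral.integral_mono_on hy (h.MS_int hx.le hy0 t) (i2.add i1) fun r hr => ?_
    have hS := S_pos n (hx.trans_le hr.1)
    have hM : MU r t ≤ lam / 2 * (MU r t * MU r t) + 1 / (2 * lam) := by
      have : lam / 2 * (MU r t * MU r t) + 1 / (2 * lam) - MU r t = (lam * MU r t - 1) ^ 2 / (2 * lam) := by field_simp; ring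
      have : 0 ≤ (lam * MU r t - 1) ^ 2 / (2 * lam) := by positivity
      linarith
    calc MU r t / S n r ≤ (lam / 2 * (MU r t * MU r t) + 1 / (2 * lam)) / S n r := by gcongr
      _ = _ := by ring
  rw [intervalIntegral.integral_add i2 i1, intervalIntegral.integral_const_mul, intervalIntegral.integral_const_mul] at h1
  have h2 : ∫ r in x..y, MU r t * (MU r t / S n r) ≤ ∫ r in 0..y, MU r t * (MU r t / S n r) := by
    refine intervalIntegral.integral_mono_interval hx.le hy le_rfl ((ae_restrict_iff' measurableSet_Ioc).2 (Eventually.of_forall fun r hr => ?_)) i0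
    exact h.Fe_nonneg hr.1.le t
  have h3 := mul_le_mul_of_nonneg_left (h2.trans (h.eR_le ht hy0)) (by positivity : 0 ≤ lam / 2)
  have h4 := mul_le_mul_of_nonneg_left (H y hy) (by positivity : 0 ≤ 1 / (2 * lam))
  linarith
lemma g_sq : ∃ C1 > 0, ∀ t, T / 2 ≤ t → t < T → ∀ x > 0, ∀ B > 0, (∀ y ≥ x, ∫ r in x..y, (S n r)⁻¹ ≤ B) →
    gU x t ≤ C1 * sqrt B * (T - t) ^ ex m := by
  obtain ⟨c, hc, C, hC, hE⟩ := h.E_bd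
  refine ⟨(C + 1) / 2, by positivity, fun t ht ht' x hx B hB H => ?_⟩
  have hth : 0 < T - t := by linarith
  have hs : 0 < sqrt B := sqrt_pos.2 hB
  have hta : 0 < (T - t) ^ ex m := by positivity
  have h1 := h.g_CS hx ht ht' (lam := sqrt B / (T - t) ^ ex m) (by positivity) H
  refine h1.trans ?_
  have h2 := (hE t ht ht').2
  rw [show 2 * ex m = ex m + ex m by ring, rpow_add hth] at h2
  have hB2 : B = sqrt B * sqrt B := (mul_self_sqrt hB.le).symm
  calc _ ≤ sqrt B / (T - t) ^ ex m / 2 * (C * ((T - t) ^ ex m * (T - t) ^ ex m)) + 1 / (2 * (sqrt B / (T - t) ^ ex m)) * (sqrt B * sqrt B) := by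
        rw [← hB2]; gcongr
    _ = _ := by field_simp
lemma wg : ∃ C2 > 0, ∀ r ≥ 0, ∀ t t', 5 * T / 8 ≤ t → t ≤ t' → t' < T → (t' - t) * wU r t' ≤ C2 * gU r t := by
  have hT := h.hT
  have ha := ex_gt h.hm0 h.hm1
  refine ⟨(1 + 3 * ex m) / (1 / 4) ^ (ex m - 1), by positivity, fun r hr t t' h1 h2 h3 => ?_⟩
  have hub := h.UB hr (by linarith : T / 2 < t) h2 h3
  have q : (1 / 4 : ℝ) ^ (ex m - 1) ≤ ((t - T / 2) / (t' - T / 2)) ^ (ex m - 1) := by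
    refine rpow_le_rpow (by norm_num) ?_ (by linarith)
    rw [div_le_div_iff₀ (by norm_num) (by linarith)]; linarith
  have hg := h.g_nonneg r (by linarith : t ≤ T)
  have hg' := h.g_nonneg r h3.le
  have hw := h.w_nonneg r t'
  have a2 : (t' - t) * (ex m * gU r t / (t - T / 2)) ≤ 3 * ex m * gU r t := by
    rw [← mul_div_assoc, div_le_iff₀ (by linarith)]
    have : t' - t ≤ 3 * (t - T / 2) := by linarith
    have := mul_le_mul_of_nonneg_right this (show 0 ≤ ex m * gU r t by positivity)
    linarith
  have a3 : (t' - t) * ((1 / 4 : ℝ) ^ (ex m - 1) * wU r t') ≤ (1 + 3 * ex m) * gU r t := by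
    have : (t' - t) * ((1 / 4 : ℝ) ^ (ex m - 1) * wU r t') ≤ (t' - t) * (((t - T / 2) / (t' - T / 2)) ^ (ex m - 1) * wU r t') := by
      have : 0 ≤ t' - t := by linarith
      gcongr
    linarith
  rw [div_mul_eq_mul_div, le_div_iff₀ (by positivity)]
  linarith
end Core
lemma exists_X {p μ K1 K2 X0 : ℝ} (hp : 1 < p) (hμ : 0 < μ) (hs : μ * (p - 1) < 4) (hK1 : 0 < K1) (hK2 : 0 < K2) :
    ∃ X, X0 ≤ X ∧ 0 < X ∧ ∃ δ > 0, K1 * δ ^ (-(μ / 2)) + K2 * X ^ p * (δ * δ) ≤ X := by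
  set s := sqrt (1 / (2 * K2)) with hsd
  have hs0 : 0 < s := sqrt_pos.2 (by positivity)
  have hss : s * s = 1 / (2 * K2) := mul_self_sqrt (by positivity)
  have hlim : Tendsto (fun X : ℝ => X ^ (1 - μ * (p - 1) / 4)) atTop atTop := tendsto_rpow_atTop (by linarith)
  obtain ⟨X, ⟨hX0, hX1⟩, hX⟩ := (((eventually_ge_atTop X0).and (eventually_gt_atTop 0)).and (hlim.eventually_ge_atTop (2 * (K1 * s ^ (-(μ / 2)))))).exists
  refine ⟨X, hX0, hX1, s * X ^ (-((p - 1) / 2)), by positivity, ?_⟩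
  have e1 : (s * X ^ (-((p - 1) / 2))) ^ (-(μ / 2)) = s ^ (-(μ / 2)) * X ^ (μ * (p - 1) / 4) := by
    rw [mul_rpow hs0.le (by positivity), ← rpow_mul hX1.le]; congr 2; ring
  have e2 : K2 * X ^ p * (s * X ^ (-((p - 1) / 2)) * (s * X ^ (-((p - 1) / 2)))) = X / 2 := by
    calc _ = K2 * (s * s) * (X ^ p * (X ^ (-((p - 1) / 2)) * X ^ (-((p - 1) / 2)))) := by ring
      _ = K2 * (s * s) * X ^ (1:ℝ) := by rw [← rpow_add hX1, ← rpow_add hX1]; congr 2; ring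
      _ = _ := by rw [hss, rpow_one]; field_simp
  rw [e1, e2]
  have e3 : X ^ (1 - μ * (p - 1) / 4) * X ^ (μ * (p - 1) / 4) = X := by
    rw [← rpow_add hX1, sub_add_cancel, rpow_one]
  have : 0 < X ^ (μ * (p - 1) / 4) := by positivity
  have := mul_le_mul_of_nonneg_right hX this.le
  rw [e3] at this
  linarith
lemma ex_p {m : ℝ} (h0 : 0 < m) (h1 : m < 1) : (ex m - 1) * (1 / m) = ex m := by
  rw [← ex_mul h1]; field_simp
namespace Core
variable {n : ℕ} {m T : ℝ} {U Ut : ℝ → ℝ → ℝ} (h : Core n m T U Ut)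
include h
local notation "wU" => wf m U
local notation "gU" => gf m T U
local notation "MU" => Mu n U
local notation "Mt" => Mu n Ut
lemma U_of_w {r t C e : ℝ} (hC : 0 ≤ C) (he : 0 ≤ e) (ht : t < T) (H : wU r t ≤ C * (T - t) ^ (ex m - 1) * e) :
    U r t ≤ C ^ (1 / m) * (T - t) ^ ex m * e ^ (1 / m) := by
  have hth : 0 < T - t := by linarith
  have hm0 := h.hm0
  rw [h.u_eq r t]
  calc _ ≤ (C * (T - t) ^ (ex m - 1) * e) ^ (1 / m) := rpow_le_rpow (h.w_nonneg r t) H (by positivity)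
    _ = _ := by rw [mul_rpow (by positivity) he, mul_rpow hC (by positivity), ← rpow_mul hth.le, ex_p h.hm0 h.hm1]
lemma Linf : ∃ X > 0, ∀ r ≥ 0, ∀ t, 5 * T / 8 ≤ t → t < T → wU r t ≤ X * (T - t) ^ (ex m - 1) := by
  have hT := h.hT
  have hm0 := h.hm0
  have hm1 := h.hm1
  have ha := ex_gt hm0 hm1
  have hn : (1:ℝ) ≤ n := by exact_mod_cast h.hn
  have hp : 1 < 1 / m := by rw [lt_div_iff₀ hm0]; linarith
  obtain ⟨C0, hC0⟩ := h.decay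
  obtain ⟨C1, hC1, hg⟩ := h.g_sq
  obtain ⟨C2, hC2, hw⟩ := h.wg
  have hsub : ((n:ℝ) - 1) * (1 / m - 1) < 4 := by
    have := h.hsub
    have e : ((n:ℝ) - 1) * (1 / m - 1) = (n - 1) * (1 - m) / m := by field_simp
    rw [e, div_lt_iff₀ hm0]; nlinarith
  obtain ⟨μ, hμ1, hμ2⟩ : ∃ μ : ℝ, (n:ℝ) - 1 < μ ∧ μ < min (n:ℝ) (4 / (1 / m - 1)) := exists_between (lt_min (by linarith) (by
    rw [lt_div_iff₀ (by linarith)]; exact hsub))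
  have hμn := hμ2.trans_le (min_le_left _ _)
  have hμp := hμ2.trans_le (min_le_right _ _)
  rw [lt_div_iff₀ (by linarith)] at hμp
  have hμ0 : 0 < μ := by linarith
  have hn0 : (0:ℝ) < n := by linarith
  set κ := (μ + 1) / n with hκ
  have hnκ : n * κ - 1 = μ := by rw [hκ]; field_simp; ring
  have hκ1 : 1 ≤ κ := by rw [hκ, le_div_iff₀ hn0]; linarith
  have hκ2 : κ ≤ 2 := by rw [hκ, div_le_iff₀ hn0]; linarith
  set Bc := sqrt (4 ^ n / μ) with hBc
  have hBc0 : 0 < Bc := sqrt_pos.2 (by positivity)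
  set th0 := 3 * T / 16 with hth0
  have hth00 : 0 < th0 := by positivity
  obtain ⟨X, hX0, hX, δ, hδ, hineq⟩ := exists_X (p := 1 / m) (μ := μ) (K1 := C2 * C1 * Bc * 2 ^ ex m) (K2 := C2 * 2 ^ ex m) (X0 := C0 / th0 ^ (ex m - 1))
    hp hμ0 hμp (by positivity) (by positivity)
  refine ⟨X, hX, ?_⟩
  have key : ∀ k : ℕ, ∀ r ≥ 0, ∀ t, 5 * T / 8 ≤ t → t < T → 2 * th0 / 2 ^ k ≤ T - t → wU r t ≤ X * (T - t) ^ (ex m - 1) := by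
    intro k
    have big : ∀ r ≥ 0, ∀ t, 5 * T / 8 ≤ t → t < T → th0 ≤ T - t → wU r t ≤ X * (T - t) ^ (ex m - 1) := by
      intro r hr t ht ht' hth
      have h1 := hC0 r hr t (by linarith)
      have h2 : exp (-(n * r / 2)) ≤ 1 := by
        rw [exp_le_one_iff]
        have : 0 ≤ (n:ℝ) * r / 2 := by positivity
        linarith
      have hC00 : 0 ≤ C0 := by
        have := (h.w_nonneg r t).trans h1
        by_contra hc
        push Not at hc
        have := mul_neg_of_neg_of_pos hc (exp_pos (-(n * r / 2)))
        linarith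
      calc wU r t ≤ C0 * 1 := h1.trans (by gcongr)
        _ = C0 / th0 ^ (ex m - 1) * th0 ^ (ex m - 1) := by field_simp
        _ ≤ _ := by
          have : 0 ≤ ex m - 1 := by linarith
          gcongr
    induction k with
    | zero =>
      intro r hr t ht ht' hth
      refine big r hr t ht ht' ?_
      norm_num at hth; linarith
    | succ k ih =>
      intro r hr t' ht ht' hth
      rcases le_total th0 (T - t') with hb | hb
      · exact big r hr t' ht ht' hb
      · set t := T - 2 * (T - t') with htd
        have hθ : 0 < T - t' := by linarith
        have ht1 : 5 * T / 8 ≤ t := by rw [htd]; linarith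
        have htT : t < T := by linarith
        have ht2 : T / 2 ≤ t := by linarith
        have ihk : ∀ x ≥ 0, wU x t ≤ X * (T - t) ^ (ex m - 1) * 1 := fun x hx => by
          rw [mul_one]
          refine ih x hx t ht1 htT ?_
          rw [pow_succ, ← div_div] at hth
          rw [htd]; linarith
        have hU : ∀ x ≥ 0, U x t ≤ X ^ (1 / m) * (T - t) ^ ex m := fun x hx => by
          have := h.U_of_w hX.le zero_le_one htT (ihk x hx)
          simpa using this
        have hM : ∀ x ≥ 0, MU x t ≤ (X ^ (1 / m) * (T - t) ^ ex m) * x * S n x := fun x hx =>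
          (le_abs_self _).trans (Mf_abs_le' (h.cr t) hx fun y hy => by rw [abs_of_nonneg (h.nonneg y t)]; exact hU y hy.1)
        have ht0 : t ∈ Ioo 0 T := ⟨by linarith, htT⟩
        have hd := h.g_diff le_rfl hδ.le ht0
        have hTt : 0 < T - t := by linarith
        have hi : ∫ x in 0..δ, MU x t / S n x ≤ (X ^ (1 / m) * (T - t) ^ ex m) * (δ * δ) := by
          have : ∫ x in 0..δ, MU x t / S n x ≤ ∫ x in 0..δ, (X ^ (1 / m) * (T - t) ^ ex m) * δ := by
            refine intervalIntegral.integral_mono_on hδ.le (h.MS_int le_rfl hδ.le t) (continuous_const.intervalIntegrable _ _) fun x hx => ?_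
            rcases hx.1.eq_or_lt with h0 | h0
            · rw [← h0, S_zero h.hn, div_zero]; positivity
            · rw [div_le_iff₀ (S_pos n h0)]
              refine (hM x hx.1).trans ?_
              have := S_nonneg n hx.1
              gcongr
              exact hx.2
          rw [intervalIntegral.integral_const, smul_eq_mul] at this
          linarith
        have hgd := hg t ht2 htT δ hδ (4 ^ n / μ * δ ^ (-μ)) (by positivity) (fun y hy => by
          have := G_near (n := n) hκ1 hκ2 (by linarith) hδ hy
          rwa [hnκ] at this)
        have hsq : sqrt (4 ^ n / μ * δ ^ (-μ)) = Bc * δ ^ (-(μ / 2)) := by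
          rw [sqrt_mul (by positivity), ← hBc, sqrt_eq_rpow (δ ^ (-μ)), ← rpow_mul hδ.le]; congr 2; ring
        rw [hsq] at hgd
        have hwr := hw r hr t t' ht1 (by linarith) ht'
        have hga := h.g_antir ht0 le_rfl hr
        have e1 : T - t = 2 * (T - t') := by rw [htd]; ring
        have e2 : t' - t = T - t' := by rw [htd]; ring
        have e3 : (T - t) ^ ex m = 2 ^ ex m * ((T - t') ^ (ex m - 1) * (T - t')) := by
          rw [e1, mul_rpow (by norm_num) hθ.le, ← rpow_add_one hθ.ne', sub_add_cancel]
        rw [e3] at hgd hi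
        rw [e2] at hwr
        have hpos : 0 < (T - t') ^ (ex m - 1) * (T - t') := by positivity
        have : (T - t') * wU r t' ≤ (T - t') * (X * (T - t') ^ (ex m - 1)) := by
          calc _ ≤ C2 * gU r t := hwr
            _ ≤ C2 * (C1 * (Bc * δ ^ (-(μ / 2))) * (2 ^ ex m * ((T - t') ^ (ex m - 1) * (T - t'))) + X ^ (1 / m) * (2 ^ ex m * ((T - t') ^ (ex m - 1) * (T - t'))) * (δ * δ)) := by
              gcongr; linarith
            _ = (C2 * C1 * Bc * 2 ^ ex m * δ ^ (-(μ / 2)) + C2 * 2 ^ ex m * X ^ (1 / m) * (δ * δ)) * ((T - t') ^ (ex m - 1) * (T - t')) := by ring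
            _ ≤ X * ((T - t') ^ (ex m - 1) * (T - t')) := by gcongr
            _ = _ := by ring
        exact le_of_mul_le_mul_left this hθ
  intro r hr t ht ht'
  have hth : 0 < T - t := by linarith
  obtain ⟨k, hk⟩ := pow_unbounded_of_one_lt (2 * th0 / (T - t)) (by norm_num : (1:ℝ) < 2)
  refine key k r hr t ht ht' ?_
  rw [div_lt_iff₀ hth] at hk
  rw [div_le_iff₀ (by positivity)]; linarith
end Core
def Pd (n : ℕ) (m T : ℝ) (U : ℝ → ℝ → ℝ) (β : ℝ) : Prop :=
  ∃ C > 0, ∃ τ, 5 * T / 8 ≤ τ ∧ τ < T ∧ ∀ r ≥ 0, ∀ t, τ ≤ t → t < T → wf m U r t ≤ C * (T - t) ^ (ex m - 1) * exp (-(β * r))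
namespace Core
variable {n : ℕ} {m T : ℝ} {U Ut : ℝ → ℝ → ℝ} (h : Core n m T U Ut)
include h
local notation "wU" => wf m U
local notation "gU" => gf m T U
local notation "MU" => Mu n U
local notation "Mt" => Mu n Ut
lemma w_of_g {D τ γ : ℝ} (hD : 0 < D) (hγ : 0 ≤ γ) (hτ : 5 * T / 8 ≤ τ) (hτ' : τ < T)
    (H : ∀ r ≥ 1, ∀ t, τ ≤ t → t < T → gU r t ≤ D * (T - t) ^ ex m * exp (-(γ * r))) : Pd n m T U γ := by
  obtain ⟨X, hX, hw⟩ := h.Linf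
  obtain ⟨C2, hC2, hwg⟩ := h.wg
  refine ⟨X * exp γ + C2 * D * 2 ^ ex m, by positivity, T - (T - τ) / 2, by linarith, by linarith, fun r hr t' h1 h2 => ?_⟩
  have hθ : 0 < T - t' := by linarith
  rcases le_total r 1 with hr1 | hr1
  · have a1 := hw r hr t' (by linarith) h2
    have a2 : 1 ≤ exp γ * exp (-(γ * r)) := by
      rw [← exp_add, one_le_exp_iff]
      nlinarith
    calc wU r t' ≤ X * (T - t') ^ (ex m - 1) * 1 := by linarith
      _ ≤ X * (T - t') ^ (ex m - 1) * (exp γ * exp (-(γ * r))) := by gcongr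
      _ = (X * exp γ + 0) * (T - t') ^ (ex m - 1) * exp (-(γ * r)) := by ring
      _ ≤ _ := by gcongr; positivity
  · set t := T - 2 * (T - t') with htd
    have hg := H r hr1 t (by linarith) (by linarith)
    have a1 := hwg r hr t t' (by linarith) (by linarith) h2
    have e3 : (T - t) ^ ex m = 2 ^ ex m * ((T - t') ^ (ex m - 1) * (T - t')) := by
      rw [show T - t = 2 * (T - t') by rw [htd]; ring, mul_rpow (by norm_num) hθ.le, ← rpow_add_one hθ.ne', sub_add_cancel]
    rw [show t' - t = T - t' by rw [htd]; ring] at a1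
    rw [e3] at hg
    refine le_of_mul_le_mul_left ?_ hθ
    calc _ ≤ C2 * gU r t := a1
      _ ≤ C2 * (D * (2 ^ ex m * ((T - t') ^ (ex m - 1) * (T - t'))) * exp (-(γ * r))) := by gcongr
      _ = (T - t') * ((0 + C2 * D * 2 ^ ex m) * (T - t') ^ (ex m - 1) * exp (-(γ * r))) := by ring
      _ ≤ _ := by gcongr; positivity
lemma Pd_half : Pd n m T U (n / 2) := by
  obtain ⟨C1, hC1, hg⟩ := h.g_sq
  have hT := h.hT
  refine h.w_of_g (D := C1 * sqrt (4 ^ n)) (τ := 5 * T / 8) (by positivity) (by positivity) le_rfl (by linarith) fun r hr t ht ht' => ?_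
  have := hg t (by linarith) ht' r (by linarith) _ (by positivity) fun y hy => G_far h.hn hr hy
  rw [sqrt_mul (by positivity)] at this
  have e : sqrt (exp (-(n * r))) = exp (-(n / 2 * r)) := by
    rw [sqrt_eq_iff_mul_self_eq (by positivity) (by positivity), ← exp_add]; congr 1; ring
  rw [e] at this
  linarith
omit h in
lemma Pd_mono {β β' : ℝ} (hb : β' ≤ β) (hP : Pd n m T U β) : Pd n m T U β' := by
  obtain ⟨C, hC, τ, h1, h2, H⟩ := hP
  refine ⟨C, hC, τ, h1, h2, fun r hr t ht ht' => (H r hr t ht ht').trans ?_⟩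
  have : 0 < T - t := by linarith
  gcongr
lemma U_dec {β : ℝ} (hP : Pd n m T U β) : ∃ A > 0, ∃ τ, 5 * T / 8 ≤ τ ∧ τ < T ∧
    ∀ r ≥ 0, ∀ t, τ ≤ t → t < T → U r t ≤ A * (T - t) ^ ex m * exp (-(1 / m * β * r)) := by
  obtain ⟨C, hC, τ, h1, h2, H⟩ := hP
  refine ⟨C ^ (1 / m), by positivity, τ, h1, h2, fun r hr t ht ht' => ?_⟩
  have := h.U_of_w hC.le (exp_pos _).le ht' (H r hr t ht ht')
  rwa [← exp_mul, show -(β * r) * (1 / m) = -(1 / m * β * r) by ring] at this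
lemma Pd_step {β : ℝ} (hβ : 0 < β) (hP : Pd n m T U β) (hlt : 1 / m * β < n) : Pd n m T U (1 / m * β) := by
  obtain ⟨A, hA, τ, h1, h2, H⟩ := h.U_dec hP
  have hm0 := h.hm0
  set γ := 1 / m * β with hγ
  have hγ0 : 0 < γ := by positivity
  have hnγ : 0 < n - γ := by linarith
  refine h.w_of_g (D := 4 ^ n * (A / (n - γ)) / γ) (τ := τ) (by positivity) hγ0.le h1 h2 fun r hr t ht ht' => ?_
  have hθ : 0 < T - t := by linarith
  have := h.g_tail hr (by linarith [h.hT]) ht' hγ0 (D := A * (T - t) ^ ex m / (n - γ)) (by positivity) fun y hy =>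
    Mf_exp_grow (h.cr t) (by linarith) (by positivity) hlt fun x hx => H x hx.1 t ht ht'
  refine this.trans (le_of_eq ?_)
  ring
lemma Pd_all : ∀ β : ℝ, 0 < β → β < (n:ℝ) → Pd n m T U β := by
  have hm0 := h.hm0
  have hm1 := h.hm1
  have hp : 1 < 1 / m := by rw [lt_div_iff₀ hm0]; linarith
  have key : ∀ k : ℕ, ∀ β : ℝ, 0 < β → β < (n:ℝ) → β ≤ (1 / m) ^ k * ((n:ℝ) / 2) → Pd n m T U β := by
    intro k
    induction k with
    | zero => intro β _ _ h3; exact Pd_mono (by simpa using h3) h.Pd_half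
    | succ k ih =>
      intro β h1 h2 h3
      have hmb : m * β < β := by nlinarith
      have := h.Pd_step (β := m * β) (by positivity) (ih (m * β) (by positivity) (by linarith) (by
        rw [pow_succ] at h3
        calc m * β ≤ m * ((1 / m) ^ k * (1 / m) * (n / 2)) := by gcongr
          _ = _ := by field_simp)) (by rw [← mul_assoc, one_div_mul_cancel hm0.ne', one_mul]; exact h2)
      rwa [← mul_assoc, one_div_mul_cancel hm0.ne', one_mul] at this
  intro β h1 h2
  obtain ⟨k, hk⟩ := pow_unbounded_of_one_lt 2 hp
  refine key k β h1 h2 ?_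
  have hn : (1:ℝ) ≤ n := by exact_mod_cast h.hn
  nlinarith
lemma upper : ∃ C > 0, ∃ τ, 5 * T / 8 ≤ τ ∧ τ < T ∧ ∀ r ≥ 0, ∀ t, τ ≤ t → t < T →
    wU r t ≤ C * (T - t) ^ (ex m - 1) * exp (-(n * r)) ∧ MU r t ≤ C * (T - t) ^ ex m ∧
    gU r t ≤ C * (T - t) ^ ex m * exp (-(n * r)) := by
  have hm0 := h.hm0
  have hm1 := h.hm1
  have hT := h.hT
  have ha := ex_gt hm0 hm1
  have hn : (1:ℝ) ≤ n := by exact_mod_cast h.hn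
  have hn0 : (0:ℝ) < n := by linarith
  obtain ⟨β, hb1, hb2⟩ : ∃ β : ℝ, m * n < β ∧ β < n := exists_between (by nlinarith)
  have hβ0 : 0 < β := lt_trans (by positivity) hb1
  have hpb : (n:ℝ) < 1 / m * β := by rw [one_div_mul_eq_div, lt_div_iff₀ hm0]; linarith
  obtain ⟨A, hA, τ, h1, h2, H⟩ := h.U_dec (h.Pd_all β hβ0 hb2)
  set A2 := A / (1 / m * β - n) with hA2
  have hA20 : 0 < A2 := div_pos hA (by linarith)
  have hM : ∀ r ≥ 0, ∀ t, τ ≤ t → t < T → MU r t ≤ A2 * (T - t) ^ ex m := fun r hr t ht ht' => by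
    have hθ : 0 < T - t := by linarith
    have := Mf_exp_bdd (h.cr t) hr (by positivity) hpb fun x hx => H x hx.1 t ht ht'
    refine this.trans (le_of_eq ?_)
    rw [hA2]; ring
  have hg : ∀ r ≥ 1, ∀ t, τ ≤ t → t < T → gU r t ≤ (4 ^ n * A2 / n) * (T - t) ^ ex m * exp (-(n * r)) := fun r hr t ht ht' => by
    have hθ : 0 < T - t := by linarith
    have := h.g_tail hr (by linarith) ht' hn0 (D := A2 * (T - t) ^ ex m) (by positivity) fun y hy => by
      rw [sub_self, zero_mul, exp_zero, mul_one]; exact hM y (by linarith) t ht ht'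
    refine this.trans (le_of_eq ?_)
    ring
  obtain ⟨C3, hC3, τ3, h3, h3', H3⟩ := h.w_of_g (by positivity) hn0.le h1 h2 hg
  refine ⟨C3 + A2, by positivity, max τ τ3, h1.trans (le_max_left _ _), max_lt h2 h3', fun r hr t ht ht' => ?_⟩
  have ht1 := (le_max_left _ _).trans ht
  have ht3 := (le_max_right _ _).trans ht
  have hθ : 0 < T - t := by linarith
  have hw : ∀ s, t ≤ s → s < T → wU r s ≤ (C3 + A2) * (T - s) ^ (ex m - 1) * exp (-(n * r)) := fun s hs hs' => by
    have := H3 r hr s (ht3.trans hs) hs'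
    have : 0 < T - s := by linarith
    refine (H3 r hr s (ht3.trans hs) hs').trans ?_
    gcongr; linarith
  refine ⟨hw t le_rfl ht', (hM r hr t ht1 ht').trans (by gcongr; linarith), ?_⟩
  have hle : ∀ s ∈ Icc t T, wU r s ≤ (C3 + A2) * (T - t) ^ (ex m - 1) * exp (-(n * r)) := fun s hs => by
    rcases hs.2.eq_or_lt with e | hlt
    · rw [e, h.w_ext r le_rfl]; positivity
    · refine (hw s hs.1 hlt).trans ?_
      have : T - s ≤ T - t := by linarith [hs.1]
      have : 0 ≤ T - s := by linarith
      have : 0 ≤ ex m - 1 := by linarith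
      gcongr
  have := intervalIntegral.integral_mono_on (μ := volume) ht'.le ((h.wct r).intervalIntegrable t T) (continuous_const.intervalIntegrable t T) hle
  rw [intervalIntegral.integral_const, smul_eq_mul] at this
  refine this.trans (le_of_eq ?_)
  have e : (T - t) ^ ex m = (T - t) ^ (ex m - 1) * (T - t) := by rw [← rpow_add_one hθ.ne', sub_add_cancel]
  rw [e]; ring
lemma g0_low : ∃ c > 0, ∃ τ, 5 * T / 8 ≤ τ ∧ τ < T ∧ ∀ t, τ ≤ t → t < T → c * (T - t) ^ ex m ≤ gU 0 t := by
  obtain ⟨C, hC, τ, h1, h2, H⟩ := h.upper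
  obtain ⟨c, hc, _, _, hE⟩ := h.E_bd
  have hT := h.hT
  refine ⟨c / C, by positivity, τ, h1, h2, fun t ht ht' => ?_⟩
  have hθ : 0 < T - t := by linarith
  have ht2 : T / 2 ≤ t := by linarith
  have e1 : En n U t ≤ C * (T - t) ^ ex m * gU 0 t := by
    refine le_of_tendsto (h.eR_tendsto ht2 (R := fun k : ℕ => (k:ℝ)) tendsto_natCast_atTop_atTop) (Eventually.of_forall fun k => ?_)
    have hk : (0:ℝ) ≤ k := by positivity
    have i0 : IntervalIntegrable (fun r => MU r t * (MU r t / S n r)) volume 0 k := by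
      apply ContinuousOn.intervalIntegrable
      rw [uIcc_of_le hk]; exact (h.Fe_cont t).mono fun r hr => hr.1
    have := intervalIntegral.integral_mono_on hk i0 ((h.MS_int le_rfl hk t).const_mul (C * (T - t) ^ ex m)) fun r hr => by
      have a1 := (H r hr.1 t ht ht').2.1
      have a2 : 0 ≤ MU r t / S n r := div_nonneg (h.M_nonneg hr.1 t) (S_nonneg n hr.1)
      gcongr
    rw [intervalIntegral.integral_const_mul, ← h.g_diff le_rfl hk ⟨by linarith, ht'⟩] at this
    refine this.trans ?_
    have := h.g_nonneg k ht'.le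
    gcongr; linarith
  have e2 := (hE t ht2 ht').1.trans e1
  rw [show 2 * ex m = ex m + ex m by ring, rpow_add hθ] at e2
  have hpos : 0 < (T - t) ^ ex m := by positivity
  rw [div_mul_eq_mul_div, div_le_iff₀ hC]
  refine le_of_mul_le_mul_left ?_ hpos
  linarith
end Core
lemma gron {D : ℝ → ℝ} (hD : Continuous D) {A K R : ℝ} (hA : 0 ≤ A) (hK : 0 ≤ K)
    (H : ∀ r ∈ Icc 0 R, D r ≤ A + K * ∫ s in (0:ℝ)..r, D s) : ∀ r ∈ Icc 0 R, D r ≤ A * exp (K * R) := by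
  intro r hr
  have hF : ∀ x, HasDerivAt (fun x => ∫ s in (0:ℝ)..x, D s) (D x) x := fun x =>
    intervalIntegral.integral_hasDerivAt_right (hD.intervalIntegrable _ _) (hD.stronglyMeasurableAtFilter _ _) hD.continuousAt
  have hG : ∀ x, HasDerivAt (fun x => exp (-(K * x)) * (A + K * ∫ s in (0:ℝ)..x, D s))
      (exp (-(K * x)) * (K * (D x - (A + K * ∫ s in (0:ℝ)..x, D s)))) x := fun x =>
    ((((hasDerivAt_id' x).const_mul K).neg.exp).mul (((hF x).const_mul K).const_add A)).congr_deriv (by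
      simp only [Pi.neg_apply]; ring)
  have hanti : AntitoneOn (fun x => exp (-(K * x)) * (A + K * ∫ s in (0:ℝ)..x, D s)) (Icc 0 R) := by
    refine antitoneOn_of_deriv_nonpos (convex_Icc _ _) (fun x _ => (hG x).continuousAt.continuousWithinAt) (fun x _ => (hG x).differentiableAt.differentiableWithinAt) fun x hx => ?_
    rw [interior_Icc] at hx
    rw [(hG x).deriv]
    refine mul_nonpos_of_nonneg_of_nonpos (exp_pos _).le (mul_nonpos_of_nonneg_of_nonpos hK ?_)
    linarith [H x ⟨hx.1.le, hx.2.le⟩]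
  have h1 := hanti ⟨le_rfl, hr.1.trans hr.2⟩ hr hr.1
  simp only [mul_zero, neg_zero, exp_zero, intervalIntegral.integral_same, add_zero, one_mul] at h1
  rw [exp_neg, inv_mul_le_iff₀ (exp_pos _)] at h1
  refine (H r hr).trans (h1.trans ?_)
  rw [mul_comm]
  have := hr.2
  gcongr
lemma rpow_lip {p C x y : ℝ} (hp : 1 < p) (hx : 0 ≤ x) (hxC : x ≤ C) (hy : 0 ≤ y) (hyC : y ≤ C) :
    |x ^ p - y ^ p| ≤ p * C ^ (p - 1) * |x - y| := by
  have := (convex_Icc (0:ℝ) C).norm_image_sub_le_of_norm_hasDerivWithin_le (f := fun z => z ^ p) (f' := fun z => p * z ^ (p - 1)) (C := p * C ^ (p - 1))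
    (fun z hz => (hasDerivAt_rpow_const (Or.inr hp.le)).hasDerivWithinAt) (fun z hz => by
      have := hz.1
      rw [norm_of_nonneg (by positivity)]
      have : 0 ≤ p - 1 := by linarith
      have := hz.2
      gcongr) (show y ∈ Icc 0 C from ⟨hy, hyC⟩) (show x ∈ Icc 0 C from ⟨hx, hxC⟩)
  simpa [norm_eq_abs] using this
lemma cmp {n : ℕ} (hn : 1 ≤ n) {H1 H2 q1 q2 e : ℝ → ℝ} (hH1 : Continuous H1) (hH2 : Continuous H2) (hq1 : Continuous q1) (hq2 : Continuous q2)
    (he : Continuous e) {a K R : ℝ} (ha : 0 < a) (hK : 0 ≤ K) (he0 : ∀ r, 0 ≤ e r)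
    (E1 : ∀ r ≥ 0, H1 0 - H1 r = ∫ s in (0:ℝ)..r, a * (Mf n q1 s / S n s))
    (E2 : ∀ r ≥ 0, H2 0 - H2 r = ∫ s in (0:ℝ)..r, a * (Mf n q2 s / S n s))
    (hq : ∀ r ∈ Icc 0 R, |q1 r - q2 r| ≤ e r + K * |H1 r - H2 r|) : ∀ r ∈ Icc 0 R,
    |H1 r - H2 r| ≤ (|H1 0 - H2 0| + a * R * ∫ s in (0:ℝ)..R, e s) * exp (a * R * K * R) := by
  intro r hr
  have hR : 0 ≤ R := hr.1.trans hr.2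
  have hDc : Continuous fun r => |H1 r - H2 r| := (hH1.sub hH2).abs
  have hE0 : 0 ≤ ∫ s in (0:ℝ)..R, e s := intervalIntegral.integral_nonneg hR fun x _ => he0 x
  refine gron hDc (by positivity) (by positivity) ?_ r hr
  intro r hr
  have hI : ∀ x ∈ Icc 0 r, ∫ s in (0:ℝ)..x, |q1 s - q2 s| ≤ (∫ s in (0:ℝ)..R, e s) + K * ∫ s in (0:ℝ)..r, |H1 s - H2 s| := by
    intro x hx
    have i1 : IntervalIntegrable (fun s => e s) volume 0 x := he.intervalIntegrable _ _
    have i2 : IntervalIntegrable (fun s => K * |H1 s - H2 s|) volume 0 x := (continuous_const.mul hDc).intervalIntegrable _ _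
    have := intervalIntegral.integral_mono_on (μ := volume) hx.1 ((hq1.sub hq2).abs.intervalIntegrable 0 x) (i1.add i2) fun s hs => hq s ⟨hs.1, hs.2.trans (hx.2.trans hr.2)⟩
    rw [intervalIntegral.integral_add i1 i2, intervalIntegral.integral_const_mul] at this
    refine this.trans (add_le_add ?_ (mul_le_mul_of_nonneg_left ?_ hK))
    · exact intervalIntegral.integral_mono_interval le_rfl hx.1 (hx.2.trans hr.2) (Eventually.of_forall fun s => he0 s) (he.intervalIntegrable _ _)
    · exact intervalIntegral.integral_mono_interval le_rfl hx.1 hx.2 (Eventually.of_forall fun s => abs_nonneg _) (hDc.intervalIntegrable _ _)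
  set B := (∫ s in (0:ℝ)..R, e s) + K * ∫ s in (0:ℝ)..r, |H1 s - H2 s| with hB
  have hB0 : 0 ≤ B := by
    have := hI 0 ⟨le_rfl, hr.1⟩
    simpa using this
  have i1 := (Mf_div_int hn hq1 le_rfl hr.1).const_mul a
  have i2 := (Mf_div_int hn hq2 le_rfl hr.1).const_mul a
  have h3 : |∫ s in (0:ℝ)..r, (a * (Mf n q1 s / S n s) - a * (Mf n q2 s / S n s))| ≤ a * B * |r - 0| := by
    refine intervalIntegral.norm_integral_le_of_norm_le_const (f := fun s => a * (Mf n q1 s / S n s) - a * (Mf n q2 s / S n s)) fun s hs => ?_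
    rw [uIoc_of_le hr.1] at hs
    have hS := S_pos n hs.1
    rw [← mul_sub, ← sub_div, Mf_sub hq1 hq2, norm_eq_abs, abs_mul, abs_of_pos ha, abs_div, abs_of_pos hS]
    refine mul_le_mul_of_nonneg_left ?_ ha.le
    rw [div_le_iff₀ hS, mul_comm B]
    exact (Mf_abs_le (hq1.sub hq2) hs.1.le).trans (mul_le_mul_of_nonneg_left (hI s ⟨hs.1.le, hs.2⟩) hS.le)
  rw [intervalIntegral.integral_sub i1 i2, ← E1 r hr.1, ← E2 r hr.1, sub_zero, abs_of_nonneg hr.1] at h3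
  have h4 : a * B * r ≤ a * B * R := by have := hr.2; gcongr
  have h5 : |H1 r - H2 r| ≤ |H1 0 - H2 0| + |H1 0 - H1 r - (H2 0 - H2 r)| := by
    have := abs_sub (H1 0 - H2 0) (H1 0 - H1 r - (H2 0 - H2 r))
    rwa [show H1 0 - H2 0 - (H1 0 - H1 r - (H2 0 - H2 r)) = H1 r - H2 r by ring] at this
  refine h5.trans ((add_le_add le_rfl (h3.trans h4)).trans (le_of_eq ?_))
  rw [hB]; ring
structure Seqs (n : ℕ) (p a C : ℝ) (W H : ℕ → ℝ → ℝ) : Prop where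
  hn : 1 ≤ n
  hp : 1 < p
  ha : 0 < a
  hC : 0 < C
  Wc : ∀ j, Continuous (W j)
  Hc : ∀ j, Continuous (H j)
  W0 : ∀ j r, 0 ≤ W j r
  H0 : ∀ j, ∀ r ≥ 0, 0 ≤ H j r
  Wb : ∀ j, ∀ r ≥ 0, W j r ≤ C * exp (-(n * r))
  Hb : ∀ j, ∀ r ≥ 0, H j r ≤ C * exp (-(n * r))
  eq : ∀ j, ∀ x y, 0 ≤ x → x ≤ y → H j x - H j y = ∫ r in x..y, a * (Mf n (fun s => W j s ^ p) r / S n r)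
  lim : ∀ r > 0, Tendsto (fun j => W j r - H j r) atTop (𝓝 0)
namespace Seqs
variable {n : ℕ} {p a C : ℝ} {W H : ℕ → ℝ → ℝ}
lemma sub (h : Seqs n p a C W H) {φ : ℕ → ℕ} (hφ : StrictMono φ) : Seqs n p a C (fun j => W (φ j)) (fun j => H (φ j)) where
  hn := h.hn
  hp := h.hp
  ha := h.ha
  hC := h.hC
  Wc j := h.Wc _
  Hc j := h.Hc _
  W0 j := h.W0 _
  H0 j := h.H0 _
  Wb j := h.Wb _
  Hb j := h.Hb _
  eq j := h.eq _
  lim r hr := (h.lim r hr).comp hφ.tendsto_atTop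
lemma expC (h : Seqs n p a C W H) {r : ℝ} (hr : 0 ≤ r) : C * exp (-(n * r)) ≤ C := by
  have := h.hC
  have h1 : exp (-(n * r)) ≤ 1 := by
      rw [exp_le_one_iff]
      have : 0 ≤ n * r := by positivity
      linarith
  nlinarith
lemma qc (h : Seqs n p a C W H) (j : ℕ) : Continuous fun s => W j s ^ p :=
  (h.Wc j).rpow_const fun _ => Or.inr (by linarith [h.hp])
lemma dWH (h : Seqs n p a C W H) {R : ℝ} (hR : 0 ≤ R) : Tendsto (fun j => ∫ s in (0:ℝ)..R, |W j s - H j s|) atTop (𝓝 0) := by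
  have := intervalIntegral.tendsto_integral_filter_of_dominated_convergence (μ := volume) (l := atTop) (a := 0) (b := R)
    (F := fun j s => |W j s - H j s|) (f := fun _ => (0:ℝ)) (fun _ => C)
    (Eventually.of_forall fun j => ((h.Wc j).sub (h.Hc j)).abs.aestronglyMeasurable)
    (Eventually.of_forall fun j => Eventually.of_forall fun s hs => by
      rw [uIoc_of_le hR] at hs
      have a1 := h.W0 j s
      have a2 := h.H0 j s hs.1.le
      have a3 := (h.Wb j s hs.1.le).trans (h.expC hs.1.le)
      have a4 := (h.Hb j s hs.1.le).trans (h.expC hs.1.le)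
      rw [norm_eq_abs, abs_abs, abs_le]; constructor <;> linarith)
    (continuous_const.intervalIntegrable _ _)
    (Eventually.of_forall fun s hs => by
      rw [uIoc_of_le hR] at hs
      simpa using (h.lim s hs.1).abs)
  simpa using this
lemma ucauchy (h : Seqs n p a C W H) {b : ℝ} (hb : Tendsto (fun j => H j 0) atTop (𝓝 b)) {R : ℝ} (hR : 0 ≤ R) :
    UniformCauchySeqOn H atTop (Icc 0 R) := by
  rw [Metric.uniformCauchySeqOn_iff]
  intro ε hε
  have hp := h.hp
  have ha := h.ha
  have hC := h.hC
  set K := p * C ^ (p - 1) with hK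
  have hK0 : 0 < K := by positivity
  set X := (2 + 2 * (a * R * K)) * exp (a * R * K * R) with hX
  have hX0 : 0 < X := by positivity
  have hδ : 0 < ε / (2 * X) := by positivity
  obtain ⟨N1, h1⟩ := Metric.tendsto_atTop.1 hb _ hδ
  obtain ⟨N2, h2⟩ := Metric.tendsto_atTop.1 (h.dWH hR) _ hδ
  refine ⟨max N1 N2, fun i hi j hj r hr => ?_⟩
  have a1 := h1 i ((le_max_left _ _).trans hi)
  have a2 := h1 j ((le_max_left _ _).trans hj)
  have a3 := h2 i ((le_max_right _ _).trans hi)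
  have a4 := h2 j ((le_max_right _ _).trans hj)
  rw [dist_eq] at a1 a2 a3 a4 ⊢
  rw [sub_zero] at a3 a4
  have a3 := (le_abs_self _).trans_lt a3
  have a4 := (le_abs_self _).trans_lt a4
  have ci := ((h.Wc i).sub (h.Hc i)).abs
  have cj := ((h.Wc j).sub (h.Hc j)).abs
  have ec : Continuous fun s => K * |W i s - H i s| + K * |W j s - H j s| := (continuous_const.mul ci).add (continuous_const.mul cj)
  have := cmp h.hn (h.Hc i) (h.Hc j) (h.qc i) (h.qc j) ec ha hK0.le (R := R) (fun s => by positivity)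
    (fun r hr => h.eq i 0 r le_rfl hr) (fun r hr => h.eq j 0 r le_rfl hr) (fun s hs => by
      refine (rpow_lip hp (h.W0 i s) ((h.Wb i s hs.1).trans (h.expC hs.1)) (h.W0 j s) ((h.Wb j s hs.1).trans (h.expC hs.1))).trans ?_
      rw [← hK, ← mul_add, ← mul_add]
      refine mul_le_mul_of_nonneg_left ?_ hK0.le
      have b1 := abs_add_le (W i s - H i s + (H i s - H j s)) (H j s - W j s)
      have b2 := abs_add_le (W i s - H i s) (H i s - H j s)
      rw [abs_sub_comm (H j s)] at b1
      rw [show W i s - H i s + (H i s - H j s) + (H j s - W j s) = W i s - W j s by ring] at b1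
      linarith) r hr
  have i1 : IntervalIntegrable (fun s => K * |W i s - H i s|) volume 0 R := (continuous_const.mul ci).intervalIntegrable _ _
  have i2 : IntervalIntegrable (fun s => K * |W j s - H j s|) volume 0 R := (continuous_const.mul cj).intervalIntegrable _ _
  rw [intervalIntegral.integral_add i1 i2, intervalIntegral.integral_const_mul, intervalIntegral.integral_const_mul] at this
  refine this.trans_lt ?_
  have b3 : |H i 0 - H j 0| ≤ 2 * (ε / (2 * X)) := by
    have := abs_add_le (H i 0 - b) (b - H j 0)
    rw [abs_sub_comm b, show H i 0 - b + (b - H j 0) = H i 0 - H j 0 by ring] at this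
    linarith
  calc _ ≤ (2 * (ε / (2 * X)) + a * R * (K * (ε / (2 * X)) + K * (ε / (2 * X)))) * exp (a * R * K * R) := by gcongr
    _ = X * (ε / (2 * X)) := by rw [hX]; ring
    _ = ε / 2 := by field_simp
    _ < ε := by linarith
lemma M_lim (h : Seqs n p a C W H) {v : ℝ → ℝ} (hv : ∀ r > 0, Tendsto (fun j => W j r) atTop (𝓝 (v r))) {r : ℝ} (hr : 0 ≤ r) :
    Tendsto (fun j => Mf n (fun s => W j s ^ p) r) atTop (𝓝 (Mf n (fun s => v s ^ p) r)) := by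
  have hp := h.hp
  refine intervalIntegral.tendsto_integral_filter_of_dominated_convergence (fun s => S n r * C ^ p)
    (Eventually.of_forall fun j => (Mf_cont_int (h.qc j)).aestronglyMeasurable)
    (Eventually.of_forall fun j => Eventually.of_forall fun s hs => ?_)
    (continuous_const.intervalIntegrable _ _)
    (Eventually.of_forall fun s hs => ?_)
  · rw [uIoc_of_le hr] at hs
    have a1 := h.W0 j s
    have a3 := (h.Wb j s hs.1.le).trans (h.expC hs.1.le)
    have := S_nonneg n hs.1.le
    have := S_mono n hs.1.le hs.2
    rw [norm_of_nonneg (by positivity)]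
    have : 0 ≤ S n r := S_nonneg n hr
    have : W j s ^ p ≤ C ^ p := by gcongr
    gcongr
  · rw [uIoc_of_le hr] at hs
    exact ((hv s hs.1).rpow_const (Or.inr (by linarith))).const_mul _
lemma exists_lim (h : Seqs n p a C W H) {b : ℝ} (hb0 : 0 < b) (hb : Tendsto (fun j => H j 0) atTop (𝓝 b)) :
    ∃ v d, Prof n p a v d ∧ Continuous v ∧ (∀ r ≥ 0, v r ≤ C * exp (-(n * r))) ∧ (∀ R ≥ 0, TendstoUniformlyOn H v atTop (Icc 0 R)) ∧
      (∀ r > 0, Tendsto (fun j => W j r) atTop (𝓝 (v r))) ∧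
      (∀ x y, 0 ≤ x → x ≤ y → v x - v y = ∫ r in x..y, a * (Mf n (fun s => v s ^ p) r / S n r)) := by
  have hp := h.hp
  have ha := h.ha
  have hC := h.hC
  have hn := h.hn
  have hn1 : (1:ℝ) ≤ n := by exact_mod_cast hn
  have hL : ∀ r : ℝ, ∃ l, Tendsto (fun j => H j (max r 0)) atTop (𝓝 l) := fun r =>
    cauchySeq_tendsto_of_complete ((h.ucauchy hb (le_max_right r 0)).cauchySeq ⟨le_max_right r 0, le_rfl⟩)
  choose v hv using hL
  have hv' : ∀ r ≥ 0, Tendsto (fun j => H j r) atTop (𝓝 (v r)) := fun r hr => by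
    have := hv r; rwa [max_eq_left hr] at this
  have hun : ∀ R ≥ 0, TendstoUniformlyOn H v atTop (Icc 0 R) := fun R hR =>
    (h.ucauchy hb hR).tendstoUniformlyOn_of_tendsto fun r hr => hv' r hr.1
  have hun2 : ∀ R ≥ 0, TendstoUniformlyOn (fun j r => H j (max r 0)) v atTop (Iic R) := fun R hR => by
    have hh := hun R hR
    rw [Metric.tendstoUniformlyOn_iff] at hh ⊢
    intro ε hε
    filter_upwards [hh ε hε] with j hj r hr
    have e : v r = v (max r 0) := by
      refine tendsto_nhds_unique (hv r) ?_
      have := hv (max r 0)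
      rwa [max_eq_left (le_max_right r 0)] at this
    rw [e]
    exact hj _ ⟨le_max_right _ _, max_le hr hR⟩
  have hvc : Continuous v := by
    rw [continuous_iff_continuousAt]
    intro r
    have := (hun2 (max r 0 + 1) (by positivity)).continuousOn (Eventually.of_forall fun j => ((h.Hc j).comp (continuous_id.max continuous_const)).continuousOn).frequently
    exact this.continuousAt (Iic_mem_nhds (by linarith [le_max_left r 0]))
  have hv0 : ∀ r ≥ 0, 0 ≤ v r := fun r hr => ge_of_tendsto' (hv' r hr) fun j => h.H0 j r hr
  have hvb : ∀ r ≥ 0, v r ≤ C * exp (-(n * r)) := fun r hr => le_of_tendsto' (hv' r hr) fun j => h.Hb j r hr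
  have hW : ∀ r > 0, Tendsto (fun j => W j r) atTop (𝓝 (v r)) := fun r hr => by
    have := (h.lim r hr).add (hv' r hr.le)
    simpa using this
  have hqc : Continuous fun s => v s ^ p := hvc.rpow_const fun _ => Or.inr (by linarith)
  have heq : ∀ x y, 0 ≤ x → x ≤ y → v x - v y = ∫ r in x..y, a * (Mf n (fun s => v s ^ p) r / S n r) := by
    intro x y hx hxy
    have l1 := (hv' x hx).sub (hv' y (hx.trans hxy))
    refine tendsto_nhds_unique l1 ?_
    simp only [fun j => h.eq j x y hx hxy]
    refine intervalIntegral.tendsto_integral_filter_of_dominated_convergence (fun s => a * (C ^ p * y))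
      (Eventually.of_forall fun j => ((Mf_div_int hn (h.qc j) hx (hx.trans hxy)).const_mul a).def'.aestronglyMeasurable)
      (Eventually.of_forall fun j => Eventually.of_forall fun s hs => ?_)
      (continuous_const.intervalIntegrable _ _)
      (Eventually.of_forall fun s hs => ?_)
    · rw [uIoc_of_le hxy] at hs
      have hs0 : 0 < s := hx.trans_lt hs.1
      have hS := S_pos n hs0
      have := Mf_abs_le' (n := n) (h.qc j) hs0.le (C := C ^ p) fun z hz => by
        have a1 := h.W0 j z
        have a3 := (h.Wb j z hz.1).trans (h.expC hz.1)
        rw [abs_of_nonneg (by positivity)]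
        gcongr
      rw [norm_eq_abs, abs_mul, abs_of_pos ha, abs_div, abs_of_pos hS]
      refine mul_le_mul_of_nonneg_left ?_ ha.le
      rw [div_le_iff₀ hS]
      refine this.trans ?_
      have := hs.2
      gcongr
    · rw [uIoc_of_le hxy] at hs
      exact ((h.M_lim hW (hx.trans hs.1.le)).div_const _).const_mul a
  have hvb0 : v 0 = b := tendsto_nhds_unique (hv' 0 le_rfl) hb
  have hder : ∀ r > 0, HasDerivAt v (-(a * (Mf n (fun s => v s ^ p) r / S n r))) r := by
    intro r hr
    have hco : ContinuousOn (fun r => a * (Mf n (fun s => v s ^ p) r / S n r)) (Ici 0) := continuousOn_const.mul (Mf_div_contOn hn hqc)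
    have h1 : HasDerivAt (fun x => ∫ r in (0:ℝ)..x, a * (Mf n (fun s => v s ^ p) r / S n r)) (a * (Mf n (fun s => v s ^ p) r / S n r)) r := by
      refine intervalIntegral.integral_hasDerivAt_right ((Mf_div_int hn hqc le_rfl hr.le).const_mul a) ?_ (hco.continuousAt (Ici_mem_nhds hr))
      exact (hco.mono Ioi_subset_Ici_self).stronglyMeasurableAtFilter isOpen_Ioi r hr
    have h2 := h1.const_sub (v 0)
    refine h2.congr_of_eventuallyEq ?_
    filter_upwards [Ioi_mem_nhds hr] with x hx
    rw [← heq 0 x le_rfl (le_of_lt hx)]; ring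
  have hanti : ∀ x y, 0 ≤ x → x ≤ y → v y ≤ v x := fun x y hx hxy => by
    have := heq x y hx hxy
    have h2 : 0 ≤ ∫ r in x..y, a * (Mf n (fun s => v s ^ p) r / S n r) := intervalIntegral.integral_nonneg hxy fun r hr => by
      have := S_nonneg n (hx.trans hr.1)
      have : 0 ≤ Mf n (fun s => v s ^ p) r := Mf_nonneg (hx.trans hr.1) fun z hz => rpow_nonneg (hv0 z hz.1) _
      positivity
    linarith
  have hMpos : ∀ r > 0, 0 < Mf n (fun s => v s ^ p) r := by
    intro r hr
    obtain ⟨δ, hδ, hh⟩ := Metric.continuousAt_iff.1 (hvc.continuousAt (x := 0)) (b / 2) (by positivity)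
    have hmin : 0 < min (δ / 2) r := by positivity
    refine lt_of_lt_of_le (Mf_pos hqc hmin fun x hx => ?_) (Mf_mono hqc hmin.le (min_le_right _ _) fun z hz => rpow_nonneg (hv0 z (hmin.le.trans hz.1)) _)
    have : dist x 0 < δ := by
      rw [dist_eq, sub_zero, abs_of_nonneg hx.1]
      have := hx.2.trans (min_le_left _ _)
      linarith
    have := hh this
    rw [hvb0, dist_eq, abs_lt] at this
    have : 0 < v x := by linarith [this.1]
    positivity
  have hpos : ∀ r ≥ 0, 0 < v r := by
    intro r hr
    have := heq r (r + 1) hr (by linarith)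
    have h2 : 0 < ∫ s in r..(r+1), a * (Mf n (fun s => v s ^ p) s / S n s) := by
      refine intervalIntegral.intervalIntegral_pos_of_pos_on ((Mf_div_int hn hqc hr (by linarith)).const_mul a) (fun s hs => ?_) (by linarith)
      have hs0 : 0 < s := lt_of_le_of_lt hr hs.1
      have := hMpos s hs0
      have := S_pos n hs0
      positivity
    linarith [hv0 (r + 1) (by linarith)]
  have hqb : ∀ x ≥ 0, v x ^ p ≤ C ^ p * exp (-((p * n) * x)) := fun x hx => by
    have := rpow_le_rpow (hv0 x hx) (hvb x hx) (by linarith : 0 ≤ p)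
    rw [mul_rpow hC.le (exp_pos _).le, ← exp_mul] at this
    rwa [show -((p * n) * x) = -(n * x) * p by ring]
  refine ⟨v, fun r => -(a * (Mf n (fun s => v s ^ p) r / S n r)), ⟨hder, ?_, hpos, hvc.continuousOn, ?_, ?_⟩, hvc, hvb, hun, hW, heq⟩
  · intro r hr
    have hS := S_pos n hr
    have hsinh : 0 < sinh r := sinh_pos_iff.2 hr
    refine (((Mf_hasDerivAt hqc r).div (S_deriv n hr) hS.ne').const_mul a).neg.congr_deriv ?_
    field_simp
    ring
  · refine ⟨a * C ^ p, fun r hr => ?_⟩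
    have hS := S_pos n hr.1
    have := Mf_abs_le' (n := n) hqc hr.1.le (C := C ^ p) fun z hz => by
      have a1 := hv0 z hz.1
      have a3 := (hvb z hz.1).trans (h.expC hz.1)
      rw [abs_of_nonneg (by positivity)]
      gcongr
    rw [abs_neg, abs_mul, abs_of_pos ha, abs_div, abs_of_pos hS, mul_assoc]
    refine mul_le_mul_of_nonneg_left ?_ ha.le
    rwa [div_le_iff₀ hS]
  · have hpn : (n:ℝ) < p * n := by nlinarith
    refine ⟨C + a * (C ^ p / (p * n - n) * 4 ^ n), fun r hr => ?_⟩
    have hr0 : 0 < r := by linarith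
    have hpn' : 0 < p * n - n := by linarith
    have hS := S_pos n hr0
    have hM := Mf_exp_bdd hqc hr0.le (by positivity) hpn fun x hx => hqb x hx.1
    constructor
    · refine (hvb r hr0.le).trans ?_
      gcongr
      have : 0 ≤ a * (C ^ p / (p * n - n) * 4 ^ n) := by positivity
      linarith
    · have hM0 := (hMpos r hr0).le
      rw [abs_neg, abs_of_nonneg (by positivity), div_eq_mul_inv]
      calc _ ≤ a * (C ^ p / (p * n - n) * (4 ^ n * exp (-(n * r)))) := by
            have := inv_S_le (n := n) hr
            gcongr
        _ ≤ _ := by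
            have : 0 ≤ C * exp (-(n * r)) := by positivity
            linarith
end Seqs
lemma Prof.vmc {n : ℕ} {p c : ℝ} {v d : ℝ → ℝ} (h : Prof n p c v d) : Continuous fun r => v (max r 0) :=
  h.cont.comp_continuous (continuous_id.max continuous_const) fun r => mem_Ici.2 (le_max_right _ _)
lemma Prof.ieq {n : ℕ} {p c : ℝ} {v d : ℝ → ℝ} (hn : 1 ≤ n) (hp : 1 < p) (h : Prof n p c v d) {r : ℝ} (hr : 0 ≤ r) :
    v (max 0 0) - v (max r 0) = ∫ s in (0:ℝ)..r, c * (Mf n (fun z => v (max z 0) ^ p) s / S n s) := by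
  have hq : Continuous fun z => v (max z 0) ^ p := h.vmc.rpow_const fun _ => Or.inr (by linarith)
  obtain ⟨C, hC⟩ := h.near
  have hd : ∀ s > 0, -d s = c * (Mf n (fun z => v (max z 0) ^ p) s / S n s) := fun s hs => by
    have := flux hn (d := d) (q := fun z => (-c) * v (max z 0) ^ p) (continuous_const.mul hq) (C := |C|) (fun s hs => (h.hd s hs).congr_deriv (by
      rw [max_eq_left hs.le]; ring)) (fun s hs => (hC s hs).trans (by
        have := le_abs_self C
        have := abs_nonneg C
        nlinarith [hs.1, hs.2])) hs
    rw [this, Mf_const_mul]; ring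
  have := intervalIntegral.integral_eq_sub_of_hasDerivAt_of_le hr (f := fun r => -v r) (f' := fun s => c * (Mf n (fun z => v (max z 0) ^ p) s / S n s))
    (h.cont.mono fun x hx => hx.1).neg (fun s hs => by rw [← hd s hs.1]; exact (h.hv s hs.1).neg) ((Mf_div_int hn hq le_rfl hr).const_mul c)
  rw [this, max_self, max_eq_left hr]; ring
lemma prof_uniq {n : ℕ} {p c : ℝ} {v d v' d' : ℝ → ℝ} (hn : 1 ≤ n) (hp : 1 < p) (hsub : ((n:ℝ) - 1) * p < n + 3) (hc : 0 < c)
    (h : Prof n p c v d) (h' : Prof n p c v' d') : ∀ r ≥ 0, v r = v' r := by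
  have h0 : v 0 = v' 0 := by
    rcases lt_trichotomy (v 0) (v' 0) with hl | he | hl
    · exact (uniq_lt hn hp hsub hc h' h hl).elim
    · exact he
    · exact (uniq_lt hn hp hsub hc h h' hl).elim
  intro r hr
  obtain ⟨K1, hK1⟩ := isCompact_Icc.exists_bound_of_continuousOn (h.vmc.continuousOn (s := Icc 0 r))
  obtain ⟨K2, hK2⟩ := isCompact_Icc.exists_bound_of_continuousOn (h'.vmc.continuousOn (s := Icc 0 r))
  have hKK : 0 ≤ max K1 K2 := (norm_nonneg _).trans ((hK1 r ⟨hr, le_rfl⟩).trans (le_max_left _ _))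
  have q1 : Continuous fun z => v (max z 0) ^ p := h.vmc.rpow_const fun _ => Or.inr (by linarith)
  have q2 : Continuous fun z => v' (max z 0) ^ p := h'.vmc.rpow_const fun _ => Or.inr (by linarith)
  have := cmp hn h.vmc h'.vmc q1 q2 (continuous_const (y := (0:ℝ))) hc (K := p * (max K1 K2) ^ (p - 1)) (R := r) (by positivity) (fun _ => le_rfl) (fun s hs => h.ieq hn hp hs) (fun s hs => h'.ieq hn hp hs)
    (fun s hs => by
      rw [zero_add]
      refine rpow_lip hp (h.pos _ (le_max_right _ _)).le ?_ (h'.pos _ (le_max_right _ _)).le ?_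
      · exact (le_abs_self _).trans ((hK1 s hs).trans (le_max_left _ _))
      · exact (le_abs_self _).trans ((hK2 s hs).trans (le_max_right _ _))) r ⟨hr, le_rfl⟩
  rw [max_self, h0, sub_self, abs_zero, intervalIntegral.integral_zero, mul_zero, add_zero, zero_mul, max_eq_left hr] at this
  exact sub_eq_zero.1 (abs_eq_zero.1 (le_antisymm this (abs_nonneg _)))
namespace Seqs
variable {n : ℕ} {p a C : ℝ} {W H : ℕ → ℝ → ℝ}
lemma M_unif (h : Seqs n p a C W H) {v : ℝ → ℝ} (hvc : Continuous v) (hv0 : ∀ r ≥ 0, 0 ≤ v r) (hvb : ∀ r ≥ 0, v r ≤ C * exp (-(n * r)))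
    (hv : ∀ r > 0, Tendsto (fun j => W j r) atTop (𝓝 (v r))) {δ : ℝ} (hδ : 0 < δ) :
    ∀ᶠ j in atTop, ∀ r ≥ 0, |Mf n (fun s => W j s ^ p) r - Mf n (fun s => v s ^ p) r| ≤ δ := by
  have hp := h.hp
  have hC := h.hC
  have hn1 : (1:ℝ) ≤ n := by exact_mod_cast h.hn
  have hqc : Continuous fun s => v s ^ p := hvc.rpow_const fun _ => Or.inr (by linarith)
  have hF : ∀ j, Continuous fun s => S n s * |W j s ^ p - v s ^ p| := fun j => (S_cont n).mul ((h.qc j).sub hqc).abs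
  have hbd : ∀ x y : ℝ, 0 ≤ x → 0 ≤ y → y ≤ C * exp (-(n * x)) → y ^ p ≤ C ^ p * exp (-((p * n) * x)) := fun x y hx hy hyx => by
    have := rpow_le_rpow hy hyx (by linarith : 0 ≤ p)
    rw [mul_rpow hC.le (exp_pos _).le, ← exp_mul] at this
    rwa [show -((p * n) * x) = -(n * x) * p by ring]
  have hB : ∀ j, ∀ s ∈ Ioi (0:ℝ), ‖S n s * |W j s ^ p - v s ^ p|‖ ≤ C ^ p * exp (-(p * n - n) * s) := fun j s hs => by
    have hs0 : (0:ℝ) ≤ s := le_of_lt hs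
    have hS := S_nonneg n hs0
    rw [norm_of_nonneg (by positivity)]
    have b1 := hbd s _ hs0 (h.W0 j s) (h.Wb j s hs0)
    have b2 := hbd s _ hs0 (hv0 s hs0) (hvb s hs0)
    have b3 := rpow_nonneg (h.W0 j s) p
    have b4 := rpow_nonneg (hv0 s hs0) p
    have : |W j s ^ p - v s ^ p| ≤ C ^ p * exp (-((p * n) * s)) := by rw [abs_le]; constructor <;> linarith
    calc _ ≤ exp (n * s) * (C ^ p * exp (-((p * n) * s))) := by
          have := S_le_exp n hs0
          gcongr
      _ = C ^ p * (exp (n * s) * exp (-((p * n) * s))) := by ring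
      _ = _ := by rw [← exp_add]; ring_nf
  have hgi : IntegrableOn (fun s => C ^ p * exp (-(p * n - n) * s)) (Ioi 0) := (exp_neg_integrableOn_Ioi 0 (by nlinarith)).const_mul _
  have hlim := tendsto_integral_of_dominated_convergence (μ := volume.restrict (Ioi 0)) (F := fun j s => S n s * |W j s ^ p - v s ^ p|) (f := fun _ => (0:ℝ))
    (fun s => C ^ p * exp (-(p * n - n) * s)) (fun j => (hF j).aestronglyMeasurable) hgi
    (fun j => (ae_restrict_iff' measurableSet_Ioi).2 (Eventually.of_forall fun s hs => hB j s hs))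
    ((ae_restrict_iff' measurableSet_Ioi).2 (Eventually.of_forall fun s hs => by
      have := (((((hv s hs).rpow_const (Or.inr (by linarith : 0 ≤ p))).sub_const (v s ^ p)).abs).const_mul (S n s))
      simpa using this))
  rw [integral_zero] at hlim
  filter_upwards [hlim.eventually_lt_const hδ] with j hj r hr
  refine le_trans ?_ hj.le
  have hint : IntegrableOn (fun s => S n s * |W j s ^ p - v s ^ p|) (Ioi 0) :=
    Integrable.mono' hgi (hF j).aestronglyMeasurable ((ae_restrict_iff' measurableSet_Ioi).2 (Eventually.of_forall fun s hs => hB j s hs))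
  rw [Mf_sub (h.qc j) hqc]
  unfold Mf
  have := intervalIntegral.abs_integral_le_integral_abs (f := fun ρ => S n ρ * (W j ρ ^ p - v ρ ^ p)) (μ := volume) hr
  refine this.trans ?_
  rw [intervalIntegral.integral_of_le hr]
  have e : ∫ s in Ioc 0 r, |S n s * (W j s ^ p - v s ^ p)| = ∫ s in Ioc 0 r, S n s * |W j s ^ p - v s ^ p| :=
    setIntegral_congr_fun measurableSet_Ioc fun s hs => by
      simp only [abs_mul, abs_of_nonneg (S_nonneg n hs.1.le)]
  rw [e]
  exact setIntegral_mono_set hint ((ae_restrict_iff' measurableSet_Ioi).2 (Eventually.of_forall fun s hs => mul_nonneg (S_nonneg n (le_of_lt hs)) (abs_nonneg _))) (LE.le.eventuallyLE fun s hs => hs.1)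
lemma close (h : Seqs n p a C W H) (hsub : ((n:ℝ) - 1) * p < n + 3) {c : ℝ} (hc : 0 < c) (hcH : ∀ j, c ≤ H j 0)
    {vs ds : ℝ → ℝ} (hvs : Prof n p a vs ds) {ε : ℝ} (hε : 0 < ε) : ∃ j, ∀ r ≥ 0, |H j r - vs r| ≤ ε * vs r := by
  obtain ⟨b, hb, φ, hφ, hlim⟩ := tendsto_subseq_of_bounded (Metric.isBounded_Icc c C) (x := fun j => H j 0) fun j => ⟨hcH j, (h.Hb j 0 le_rfl).trans (h.expC le_rfl)⟩
  rw [closure_Icc] at hb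
  have h2 := h.sub hφ
  have hb0 : 0 < b := hc.trans_le hb.1
  obtain ⟨v, d, hP, hvc, hvb, hun, hW, heq⟩ := h2.exists_lim hb0 hlim
  have hpos := hP.pos
  have ha := h.ha
  have hun1 := Metric.tendstoUniformlyOn_iff.1 (hun 1 zero_le_one) (ε * v 1) (mul_pos hε (hpos 1 zero_le_one))
  have hqc : Continuous fun s => v s ^ p := hvc.rpow_const fun _ => Or.inr (by linarith [h.hp])
  have hM1 : 0 < Mf n (fun s => v s ^ p) 1 := Mf_pos hqc one_pos fun x hx => rpow_pos_of_pos (hpos x hx.1) _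
  have hMu := h2.M_unif hvc (fun r hr => (hpos r hr).le) hvb hW (mul_pos hε hM1)
  obtain ⟨j, hj1, hj2⟩ := (hun1.and hMu).exists
  have hMm : ∀ x y, 0 ≤ x → x ≤ y → Mf n (fun s => v s ^ p) x ≤ Mf n (fun s => v s ^ p) y := fun x y hx hxy =>
    Mf_mono hqc hx hxy fun z hz => rpow_nonneg (hpos z (hx.trans hz.1)).le _
  refine ⟨φ j, fun r hr => ?_⟩
  rw [← prof_uniq h.hn h.hp hsub ha hP hvs r hr]
  rcases le_total r 1 with h1 | h1
  · have := hj1 r ⟨hr, h1⟩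
    rw [dist_comm, dist_eq] at this
    refine this.le.trans (mul_le_mul_of_nonneg_left ?_ hε.le)
    have e := heq r 1 hr h1
    have : 0 ≤ ∫ s in r..1, a * (Mf n (fun s => v s ^ p) s / S n s) := intervalIntegral.integral_nonneg h1 fun s hs => by
      have := S_nonneg n (hr.trans hs.1)
      have := Mf_nonneg (n := n) (r := s) (f := fun s => v s ^ p) (hr.trans hs.1) fun z hz => rpow_nonneg (hpos z hz.1).le _
      positivity
    linarith
  · have key : ∀ y ≥ r, |(H (φ j) r - H (φ j) y) - (v r - v y)| ≤ ε * (v r - v y) := by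
      intro y hy
      have hy0 := hr.trans hy
      have i1 := (Mf_div_int h.hn (h.qc (φ j)) hr hy0).const_mul a
      have i2 := (Mf_div_int h.hn hqc hr hy0).const_mul a
      rw [← norm_eq_abs, h.eq _ r y hr hy, heq r y hr hy, ← intervalIntegral.integral_sub i1 i2, ← intervalIntegral.integral_const_mul]
      refine intervalIntegral.norm_integral_le_of_norm_le hy (Eventually.of_forall fun s hs => ?_) (i2.const_mul ε)
      have hs0 : 0 < s := by linarith [hs.1]
      have hS := S_pos n hs0
      rw [← mul_sub, ← sub_div, norm_eq_abs, abs_mul, abs_of_pos ha, abs_div, abs_of_pos hS]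
      have b1 := hj2 s hs0.le
      have b2 := hMm 1 s zero_le_one (by linarith [hs.1])
      calc _ ≤ a * (ε * Mf n (fun s => v s ^ p) s / S n s) := by
            have : ε * Mf n (fun s => v s ^ p) 1 ≤ ε * Mf n (fun s => v s ^ p) s := by gcongr
            have := b1.trans this
            gcongr
        _ = _ := by ring
    have hexp : Tendsto (fun y : ℝ => C * exp (-(n * y))) atTop (𝓝 0) := by
      have hn1 : (0:ℝ) < n := by exact_mod_cast h.hn
      have := (tendsto_exp_neg_atTop_nhds_zero.comp (tendsto_id.const_mul_atTop hn1)).const_mul C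
      simpa using this
    have t1 : Tendsto (fun y => H (φ j) y) atTop (𝓝 0) := tendsto_of_tendsto_of_tendsto_of_le_of_le' tendsto_const_nhds hexp
      (eventually_atTop.2 ⟨0, fun y hy => h.H0 _ y hy⟩) (eventually_atTop.2 ⟨0, fun y hy => h.Hb _ y hy⟩)
    have t2 : Tendsto v atTop (𝓝 0) := tendsto_of_tendsto_of_tendsto_of_le_of_le' tendsto_const_nhds hexp
      (eventually_atTop.2 ⟨0, fun y hy => (hpos y hy).le⟩) (eventually_atTop.2 ⟨0, fun y hy => hvb y hy⟩)
    have l1 := ((t1.const_sub (H (φ j) r)).sub (t2.const_sub (v r))).abs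
    have l2 := (t2.const_sub (v r)).const_mul ε
    rw [sub_zero, sub_zero] at l1
    rw [sub_zero] at l2
    exact le_of_tendsto_of_tendsto l1 l2 (eventually_atTop.2 ⟨r, key⟩)
end Seqs
namespace Core
variable {n : ℕ} {m T : ℝ} {U Ut : ℝ → ℝ → ℝ} (h : Core n m T U Ut)
include h
local notation "wU" => wf m U
local notation "gU" => gf m T U
local notation "MU" => Mu n U
local notation "Mt" => Mu n Ut
lemma wkg {x L t κ lam B : ℝ} (hx : 0 < x) (hxL : x ≤ L) (ht : t ∈ Ioo 0 T) (hl : 0 < lam)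
    (hB : ∫ r in x..L, (S n r)⁻¹ ≤ B) :
    |(wU x t - κ * gU x t) - (wU L t - κ * gU L t)| ≤ lam / 2 * Df n U Ut L κ t + 1 / (2 * lam) * B := by
  have hL0 := hx.le.trans hxL
  have c1 : ContinuousOn (fun r => Mt r t / S n r) (Icc 0 L) := (Mf_div_contOn h.hn (h.Utr ht)).mono (fun x hx => hx.1 : Icc 0 L ⊆ Ici 0)
  have c2 : ContinuousOn (fun r => MU r t / S n r) (Icc 0 L) := (Mf_div_contOn h.hn (h.cr t)).mono (fun x hx => hx.1 : Icc 0 L ⊆ Ici 0)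
  have c3 : ContinuousOn (fun r => Mt r t / S n r + κ * (MU r t / S n r)) (Icc 0 L) := c1.add (continuousOn_const.mul c2)
  have c4 : ContinuousOn (fun r => (Mt r t + κ * MU r t) * (Mt r t / S n r + κ * (MU r t / S n r))) (Icc 0 L) :=
    ((h.Pcr ht).add (continuous_const.mul (h.Mcr t))).continuousOn.mul c3
  have hsub : Icc x L ⊆ Icc 0 L := Icc_subset_Icc_left hx.le
  have i3 : IntervalIntegrable (fun r => Mt r t / S n r + κ * (MU r t / S n r)) volume x L := by
    apply ContinuousOn.intervalIntegrable
    rw [uIcc_of_le hxL]; exact c3.mono hsub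
  have e1 := intervalIntegral.integral_eq_sub_of_hasDerivAt_of_le hxL (f := fun r => wU r t - κ * gU r t) (f' := fun r => Mt r t / S n r + κ * (MU r t / S n r))
    ((h.wcr t).sub (continuous_const.mul (h.gcr t))).continuousOn (fun s hs => ((h.dr s (hx.trans hs.1) t ht).sub ((h.g_dr (hx.trans hs.1) ht).const_mul κ)).congr_deriv (by
      unfold Mu; ring)) i3
  rw [abs_sub_comm, ← e1, ← norm_eq_abs]
  have i4 : IntervalIntegrable (fun r => (Mt r t + κ * MU r t) * (Mt r t / S n r + κ * (MU r t / S n r))) volume 0 L := by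
    apply ContinuousOn.intervalIntegrable
    rw [uIcc_of_le hL0]; exact c4
  have i5 : IntervalIntegrable (fun r => lam / 2 * ((Mt r t + κ * MU r t) * (Mt r t / S n r + κ * (MU r t / S n r)))) volume x L := by
    apply ContinuousOn.intervalIntegrable
    rw [uIcc_of_le hxL]; exact continuousOn_const.mul (c4.mono hsub)
  have i6 : IntervalIntegrable (fun r => 1 / (2 * lam) * (S n r)⁻¹) volume x L := by
    apply ContinuousOn.intervalIntegrable
    rw [uIcc_of_le hxL]
    exact continuousOn_const.mul ((S_cont n).continuousOn.inv₀ fun ρ hρ => (S_pos n (by linarith [hρ.1])).ne')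
  have h1 := intervalIntegral.norm_integral_le_of_norm_le (μ := volume) hxL (f := fun r => Mt r t / S n r + κ * (MU r t / S n r))
    (g := fun r => lam / 2 * ((Mt r t + κ * MU r t) * (Mt r t / S n r + κ * (MU r t / S n r))) + 1 / (2 * lam) * (S n r)⁻¹)
    (Eventually.of_forall fun s hs => by
      have hS := S_pos n (hx.trans hs.1)
      set Y := Mt s t + κ * MU s t with hY
      have eY : Mt s t / S n s + κ * (MU s t / S n s) = Y / S n s := by rw [hY]; ring
      rw [eY, norm_eq_abs, abs_div, abs_of_pos hS]
      have : lam / 2 * (Y * Y) + 1 / (2 * lam) - |Y| = (lam * |Y| - 1) ^ 2 / (2 * lam) := by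
        rw [← abs_mul_abs_self Y]; field_simp; ring
      have h0 : 0 ≤ (lam * |Y| - 1) ^ 2 / (2 * lam) := by positivity
      calc |Y| / S n s ≤ (lam / 2 * (Y * Y) + 1 / (2 * lam)) / S n s := by gcongr; linarith
        _ = _ := by ring) (i5.add i6)
  rw [intervalIntegral.integral_add i5 i6, intervalIntegral.integral_const_mul, intervalIntegral.integral_const_mul] at h1
  have h2 : ∫ r in x..L, (Mt r t + κ * MU r t) * (Mt r t / S n r + κ * (MU r t / S n r)) ≤ Df n U Ut L κ t := by
    refine intervalIntegral.integral_mono_interval hx.le hxL le_rfl ((ae_restrict_iff' measurableSet_Ioc).2 (Eventually.of_forall fun r hr => ?_)) i4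
    have hS := S_pos n hr.1
    have : (Mt r t + κ * MU r t) * (Mt r t / S n r + κ * (MU r t / S n r)) = (Mt r t + κ * MU r t) ^ 2 / S n r := by ring
    rw [Pi.zero_apply]
    refine le_of_le_of_eq ?_ this.symm
    positivity
  have h3 := mul_le_mul_of_nonneg_left h2 (by positivity : 0 ≤ lam / 2)
  have h4 := mul_le_mul_of_nonneg_left hB (by positivity : 0 ≤ 1 / (2 * lam))
  linarith
lemma wh {C x L t κ ε B : ℝ} (hC : 0 < C) (hε : 0 < ε) (hx : 0 < x) (hxL : x ≤ L) (ht : t ∈ Ioo 0 T)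
    (hB : ∫ r in x..L, (S n r)⁻¹ ≤ B)
    (hw : ∀ r ≥ 0, wU r t ≤ C * (T - t) ^ (ex m - 1) * exp (-(n * r))) (hg : ∀ r ≥ 0, gU r t ≤ C * (T - t) ^ ex m * exp (-(n * r)))
    (hκ : |κ * (T - t) - ex m| ≤ ε) (hD : Df n U Ut L κ t ≤ ε * (T - t) ^ (2 * ex m - 2)) :
    |wU x t * (T - t) ^ (1 - ex m) - ex m * gU x t * (T - t) ^ (-ex m)| ≤ (1 + ex m + ε) * C * exp (-(n * L)) + (1 + B) / 2 * sqrt ε + ε * C := by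
  have hθ : 0 < T - t := by linarith [ht.2]
  have ha := ex_gt h.hm0 h.hm1
  have hL0 := hx.le.trans hxL
  set θ := T - t with hθd
  set Θ := θ ^ (1 - ex m) with hΘ
  have hΘ0 : 0 < Θ := by positivity
  have e1 : θ ^ (-ex m) = Θ / θ := by rw [hΘ, ← rpow_sub_one hθ.ne']; ring_nf
  have e2 : θ ^ (ex m - 1) = Θ⁻¹ := by rw [hΘ, ← rpow_neg hθ.le]; ring_nf
  have e3 : θ ^ (2 * ex m - 2) = Θ⁻¹ * Θ⁻¹ := by rw [← e2, ← rpow_add hθ]; ring_nf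
  have e4 : θ ^ ex m = Θ⁻¹ * θ := by rw [← e2, ← rpow_add_one hθ.ne', sub_add_cancel]
  have hsq := sqrt_pos.2 hε
  have hss := mul_self_sqrt hε.le
  have k := h.wkg hx hxL ht (κ := κ) (lam := Θ / sqrt ε) (by positivity) hB
  rw [e3] at hD
  rw [e2] at hw
  rw [e4] at hg
  have k2 : |(wU x t - κ * gU x t) - (wU L t - κ * gU L t)| * Θ ≤ (1 + B) / 2 * sqrt ε := by
    calc _ ≤ (Θ / sqrt ε / 2 * ((sqrt ε * sqrt ε) * (Θ⁻¹ * Θ⁻¹)) + 1 / (2 * (Θ / sqrt ε)) * B) * Θ := by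
          refine mul_le_mul_of_nonneg_right (k.trans ?_) hΘ0.le
          rw [hss]; gcongr
      _ = _ := by field_simp
  have gx := h.g_nonneg x ht.2.le
  have gL := h.g_nonneg L ht.2.le
  have wL := h.w_nonneg L t
  have bw : wU L t * Θ ≤ C * exp (-(n * L)) := by
    calc _ ≤ C * Θ⁻¹ * exp (-(n * L)) * Θ := by have := hw L hL0; gcongr
      _ = _ := by field_simp
  have bg : ∀ r ≥ 0, gU r t * (Θ / θ) ≤ C * exp (-(n * r)) := fun r hr => by
    calc _ ≤ C * (Θ⁻¹ * θ) * exp (-(n * r)) * (Θ / θ) := by have := hg r hr; gcongr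
      _ = _ := by field_simp
  have bgx : gU x t * (Θ / θ) ≤ C := (bg x hx.le).trans (by
    have : exp (-(n * x)) ≤ 1 := by
      rw [exp_le_one_iff]
      have : 0 ≤ n * x := by positivity
      linarith
    nlinarith)
  have bgL := bg L hL0
  rw [e1]
  have id : wU x t * Θ - ex m * gU x t * (Θ / θ) = ((wU x t - κ * gU x t) - (wU L t - κ * gU L t)) * Θ
      + wU L t * Θ - (κ * θ) * (gU L t * (Θ / θ)) + (κ * θ - ex m) * (gU x t * (Θ / θ)) := by field_simp; ring
  rw [id]
  have z1 : |(κ * θ) * (gU L t * (Θ / θ))| ≤ (ex m + ε) * (C * exp (-(n * L))) := by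
    rw [abs_mul, abs_of_nonneg (by positivity : 0 ≤ gU L t * (Θ / θ))]
    have : |κ * θ| ≤ ex m + ε := by rw [abs_le] at hκ ⊢; constructor <;> linarith [hκ.1, hκ.2]
    gcongr
  have z2 : |(κ * θ - ex m) * (gU x t * (Θ / θ))| ≤ ε * C := by
    rw [abs_mul, abs_of_nonneg (by positivity : 0 ≤ gU x t * (Θ / θ))]
    gcongr
  have z3 : |((wU x t - κ * gU x t) - (wU L t - κ * gU L t)) * Θ| ≤ (1 + B) / 2 * sqrt ε := by rw [abs_mul, abs_of_pos hΘ0]; exact k2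
  have z4 : |wU L t * Θ| ≤ C * exp (-(n * L)) := by rw [abs_of_nonneg (by positivity)]; exact bw
  rw [abs_le] at z1 z2 z3 z4 ⊢
  constructor <;> linarith [z1.1, z1.2, z2.1, z2.2, z3.1, z3.2, z4.1, z4.2]
lemma good_close {vs ds : ℝ → ℝ} (hvs : Prof n (1 / m) (ex m) vs ds) {ε η : ℝ} (hε : 0 < ε) (hη : 0 < η) (hη1 : η < 1) :
    ∃ τ, 5 * T / 8 ≤ τ ∧ τ < T ∧ ∀ t, τ ≤ t → t < T → ∃ t', t ≤ t' ∧ t' ≤ t + η * (T - t) ∧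
      ∀ r ≥ 0, |ex m * gU r t' * (T - t') ^ (-ex m) - vs r| ≤ ε * vs r := by
  by_contra hcon
  push Not at hcon
  have hT := h.hT
  have hm0 := h.hm0
  have hm1 := h.hm1
  have ha := ex_gt hm0 hm1
  have hn1 : (1:ℝ) ≤ n := by exact_mod_cast h.hn
  obtain ⟨C, hC, τ1, h1, h1', H1⟩ := h.upper
  obtain ⟨c, hc, τ2, h2, h2', H2⟩ := h.g0_low
  have hj : ∀ j : ℕ, ∃ t κ, τ1 ≤ t ∧ τ2 ≤ t ∧ t < T ∧ |κ * (T - t) - ex m| ≤ 1 / ((j:ℝ) + 1) ∧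
      Df n U Ut j κ t ≤ 1 / ((j:ℝ) + 1) * (T - t) ^ (2 * ex m - 2) ∧ ∃ r ≥ 0, ε * vs r < |ex m * gU r t * (T - t) ^ (-ex m) - vs r| := by
    intro j
    obtain ⟨τ, g1, g2, G⟩ := h.good_times hη hη1 (Nat.cast_nonneg j) (ε := 1 / ((j:ℝ) + 1)) (by positivity)
    obtain ⟨t, b1, b2, b3⟩ := hcon (max τ (max τ1 τ2)) (h1.trans ((le_max_left _ _).trans (le_max_right _ _))) (max_lt g2 (max_lt h1' h2'))
    obtain ⟨t', c1, c2, κ, c3, c4⟩ := G t ((le_max_left _ _).trans b1) b2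
    have hτ1 : τ1 ≤ t := ((le_max_left _ _).trans (le_max_right _ _)).trans b1
    have hτ2 : τ2 ≤ t := ((le_max_right _ _).trans (le_max_right _ _)).trans b1
    exact ⟨t', κ, hτ1.trans c1, hτ2.trans c1, by nlinarith, c3, c4, b3 t' c1 c2⟩
  choose t κ q1 q2 q3 q4 q5 q6 using hj
  have ht : ∀ j, t j ∈ Ioo 0 T := fun j => ⟨by linarith [q1 j], q3 j⟩
  have hθ : ∀ j, 0 < T - t j := fun j => by linarith [q3 j]
  have em : ∀ j, (T - t j) ^ ex m * (T - t j) ^ (-ex m) = 1 := fun j => by rw [← rpow_add (hθ j), add_neg_cancel, rpow_zero]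
  have ep : ∀ j s, (wU s (t j) * (T - t j) ^ (1 - ex m)) ^ (1 / m) = (T - t j) ^ (-ex m) * U s (t j) := fun j s => by
    have := (hθ j).le
    rw [mul_rpow (h.w_nonneg _ _) (by positivity), ← h.u_eq, ← rpow_mul this, mul_comm,
      show (1 - ex m) * (1 / m) = -ex m by linarith [ex_p hm0 hm1]]
  have hseq : Seqs n (1 / m) (ex m) (ex m * C) (fun j r => wU r (t j) * (T - t j) ^ (1 - ex m)) (fun j r => ex m * gU r (t j) * (T - t j) ^ (-ex m)) := by
    refine ⟨h.hn, ?_, by linarith, by positivity, fun j => (h.wcr _).mul continuous_const, fun j => (continuous_const.mul (h.gcr _)).mul continuous_const, ?_, ?_, ?_, ?_, ?_, ?_⟩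
    · rw [lt_div_iff₀ hm0]; linarith
    · intro j r
      have := h.w_nonneg r (t j)
      have := hθ j
      positivity
    · intro j r _
      have := h.g_nonneg r (q3 j).le
      have := hθ j
      positivity
    · intro j r hr
      have := hθ j
      have e : (T - t j) ^ (ex m - 1) * (T - t j) ^ (1 - ex m) = 1 := by rw [← rpow_add (hθ j)]; simp
      calc _ ≤ C * (T - t j) ^ (ex m - 1) * exp (-(n * r)) * (T - t j) ^ (1 - ex m) := by
            have := (H1 r hr (t j) (q1 j) (q3 j)).1
            gcongr
        _ = C * exp (-(n * r)) * ((T - t j) ^ (ex m - 1) * (T - t j) ^ (1 - ex m)) := by ring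
        _ ≤ _ := by
          rw [e, mul_one]
          gcongr
          nlinarith
    · intro j r hr
      have := hθ j
      calc _ ≤ ex m * (C * (T - t j) ^ ex m * exp (-(n * r))) * (T - t j) ^ (-ex m) := by
            have := (H1 r hr (t j) (q1 j) (q3 j)).2.2
            gcongr
        _ = ex m * C * exp (-(n * r)) * ((T - t j) ^ ex m * (T - t j) ^ (-ex m)) := by ring
        _ = _ := by rw [em, mul_one]
    · intro j x y hx hxy
      simp only [ep j]
      rw [intervalIntegral.integral_const_mul, ← sub_mul, ← mul_sub, h.g_diff hx hxy (ht j), mul_assoc]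
      congr 1
      rw [← intervalIntegral.integral_mul_const]
      congr 1
      ext r
      rw [Mf_const_mul]; unfold Mu; ring
    · intro r hr
      set B := 4 ^ n / ((n:ℝ) * 2 - 1) * r ^ (-((n:ℝ) * 2 - 1)) with hB
      have hz : Tendsto (fun j : ℕ => 1 / ((j:ℝ) + 1)) atTop (𝓝 0) := tendsto_one_div_add_atTop_nhds_zero_nat
      have hz2 : Tendsto (fun j : ℕ => sqrt (1 / ((j:ℝ) + 1))) atTop (𝓝 0) := by
        have := (continuous_sqrt.tendsto 0).comp hz
        rw [sqrt_zero] at this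
        exact this
      have hz3 : Tendsto (fun j : ℕ => exp (-(n * (j:ℝ)))) atTop (𝓝 0) :=
        tendsto_exp_neg_atTop_nhds_zero.comp (tendsto_natCast_atTop_atTop.const_mul_atTop (by linarith : (0:ℝ) < n))
      have hz4 : Tendsto (fun j : ℕ => (1 + ex m + 1 / ((j:ℝ) + 1)) * C * exp (-(n * (j:ℝ))) + (1 + B) / 2 * sqrt (1 / ((j:ℝ) + 1)) + 1 / ((j:ℝ) + 1) * C) atTop (𝓝 0) := by
        have := ((((hz.const_add (1 + ex m)).mul_const C).mul hz3).add (hz2.const_mul ((1 + B) / 2))).add (hz.mul_const C)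
        simpa using this
      refine squeeze_zero_norm' ?_ hz4
      filter_upwards [eventually_ge_atTop ⌈r⌉₊] with j hj
      have hrj : r ≤ j := (Nat.le_ceil r).trans (by exact_mod_cast hj)
      exact h.wh hC (by positivity) hr hrj (ht j) (G_near (by norm_num) le_rfl (by linarith) hr hrj)
        (fun r hr => (H1 r hr (t j) (q1 j) (q3 j)).1) (fun r hr => (H1 r hr (t j) (q1 j) (q3 j)).2.2) (q4 j) (q5 j)
  have hsub : ((n:ℝ) - 1) * (1 / m) < n + 3 := by
    rw [mul_one_div, div_lt_iff₀ hm0]; linarith [h.hsub]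
  obtain ⟨j, hj⟩ := hseq.close hsub (c := ex m * c) (by positivity) (fun j => by
    have := hθ j
    calc ex m * c = ex m * (c * (T - t j) ^ ex m) * (T - t j) ^ (-ex m) := by
          rw [← mul_assoc, mul_assoc _ ((T - t j) ^ ex m), em, mul_one]
      _ ≤ _ := by
          have := H2 (t j) (q2 j) (q3 j)
          gcongr) hvs hε
  obtain ⟨r, hr, hb⟩ := q6 j
  exact absurd (hj r hr) (not_le.2 hb)
lemma good_close' {vs ds : ℝ → ℝ} (hvs : Prof n (1 / m) (ex m) vs ds) {ε η : ℝ} (hε : 0 < ε) (hη : 0 < η) (hη1 : η < 1) :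
    ∃ τ, 5 * T / 8 ≤ τ ∧ τ < T ∧ ∀ t, τ ≤ t → t < T → ∃ t', t ≤ t' ∧ t' ≤ t + η * (T - t) ∧
      ∀ r ≥ 0, (1 - ε) * vs r * (T - t') ^ ex m ≤ ex m * gU r t' ∧ ex m * gU r t' ≤ (1 + ε) * vs r * (T - t') ^ ex m := by
  obtain ⟨τ, h1, h2, H⟩ := h.good_close hvs hε hη hη1
  refine ⟨τ, h1, h2, fun t ht ht' => ?_⟩
  obtain ⟨t', a1, a2, a3⟩ := H t ht ht'
  refine ⟨t', a1, a2, fun r hr => ?_⟩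
  have hθ : 0 < T - t' := by linarith [mul_lt_mul_of_pos_right hη1 (sub_pos.2 ht')]
  have hp : 0 < (T - t') ^ ex m := by positivity
  have := a3 r hr
  rw [rpow_neg hθ.le, ← div_eq_mul_inv, abs_le] at this
  have b1 : (1 - ε) * vs r ≤ ex m * gU r t' / (T - t') ^ ex m := by linarith [this.1]
  have b2 : ex m * gU r t' / (T - t') ^ ex m ≤ (1 + ε) * vs r := by linarith [this.2]
  exact ⟨(le_div_iff₀ hp).1 b1, (div_le_iff₀ hp).1 b2⟩
lemma g_all {vs ds : ℝ → ℝ} (hvs : Prof n (1 / m) (ex m) vs ds) {ε : ℝ} (hε : 0 < ε) :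
    ∃ τ, 5 * T / 8 ≤ τ ∧ τ < T ∧ ∀ t, τ ≤ t → t < T →
      ∀ r ≥ 0, (1 - ε) * vs r * (T - t) ^ ex m ≤ ex m * gU r t ∧ ex m * gU r t ≤ (1 + ε) * vs r * (T - t) ^ ex m := by
  have ha := ex_gt h.hm0 h.hm1
  have hη : ∃ η : ℝ, 0 < η ∧ η < 1 ∧ 1 - ε < (1 - η) * (1 - η) ^ ex m ∧ (1 + η) * ((1 - η) ^ ex m)⁻¹ < 1 + ε := by
    have c0 : ContinuousAt (fun η : ℝ => (1 - η) ^ ex m) 0 := (continuousAt_const.sub continuousAt_id).rpow_const (Or.inr (by linarith))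
    have c1 : ContinuousAt (fun η : ℝ => (1 - η) * (1 - η) ^ ex m) 0 := (continuousAt_const.sub continuousAt_id).mul c0
    have c2 : ContinuousAt (fun η : ℝ => (1 + η) * ((1 - η) ^ ex m)⁻¹) 0 := (continuousAt_const.add continuousAt_id).mul (c0.inv₀ (by simp))
    have e1 := c1.eventually (lt_mem_nhds (a := 1 - ε) (by simp [hε]))
    have e2 := c2.tendsto.eventually_lt_const (u := 1 + ε) (by simp [hε])
    have e3 : ∀ᶠ η : ℝ in 𝓝 0, η < 1 := gt_mem_nhds one_pos
    have := ((e1.and (e2.and e3)).filter_mono nhdsWithin_le_nhds).and (self_mem_nhdsWithin (a := (0:ℝ)) (s := Ioi 0))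
    obtain ⟨η, ⟨b1, b2, b3⟩, b4⟩ := this.exists
    exact ⟨η, b4, b3, b1, b2⟩
  obtain ⟨η, hη0, hη1, k1, k2⟩ := hη
  obtain ⟨τ, h1, h2, H⟩ := h.good_close' hvs hη0 hη0 hη1
  have h1η : 0 < 1 - η := by linarith
  have hT := h.hT
  have hτT : 0 < T - τ := by linarith
  have z1 := mul_pos hη0 hτT
  have z2 := mul_pos h1η hτT
  refine ⟨T - (1 - η) * (T - τ), by linarith, by linarith, fun t ht ht' r hr => ?_⟩
  have htτ : τ ≤ t := by linarith
  have hθ : 0 < T - t := by linarith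
  have hv := hvs.pos r hr
  have hP : 0 < (T - t) ^ ex m := by positivity
  constructor
  · obtain ⟨t', b1, b2, b3⟩ := H t htτ ht'
    have g1 := h.g_anti r b1
    have g2 := (b3 r hr).1
    have k3 : (1 - η) ^ ex m * (T - t) ^ ex m ≤ (T - t') ^ ex m := by
      rw [← mul_rpow h1η.le hθ.le]
      exact rpow_le_rpow (by positivity) (by linarith) (by linarith)
    calc _ ≤ (1 - η) * (1 - η) ^ ex m * vs r * (T - t) ^ ex m := by gcongr
      _ = (1 - η) * vs r * ((1 - η) ^ ex m * (T - t) ^ ex m) := by ring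
      _ ≤ (1 - η) * vs r * (T - t') ^ ex m := by gcongr
      _ ≤ _ := g2
      _ ≤ _ := by gcongr
  · set s := T - (T - t) / (1 - η) with hs
    have hTs : T - s = (T - t) / (1 - η) := by rw [hs]; ring
    have e0 : (1 - η) * (T - s) = T - t := by rw [hTs]; field_simp
    have hs1 : τ ≤ s := by
      have : (T - t) / (1 - η) ≤ T - τ := by rw [div_le_iff₀ h1η]; linarith
      linarith
    have hs2 : s < T := by have : 0 < (T - t) / (1 - η) := by positivity
                           linarith
    obtain ⟨t', b1, b2, b3⟩ := H s hs1 hs2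
    have b4 : t' ≤ t := by linarith
    have g1 := h.g_anti r b4
    have g2 := (b3 r hr).2
    have k3 : (T - t') ^ ex m ≤ ((1 - η) ^ ex m)⁻¹ * (T - t) ^ ex m := by
      rw [← inv_rpow h1η.le, ← mul_rpow (by positivity) hθ.le]
      refine rpow_le_rpow (by linarith) ?_ (by linarith)
      rw [inv_mul_eq_div, ← hTs]; linarith
    calc _ ≤ ex m * gU r t' := by gcongr
      _ ≤ _ := g2
      _ ≤ (1 + η) * vs r * (((1 - η) ^ ex m)⁻¹ * (T - t) ^ ex m) := by gcongr
      _ = (1 + η) * ((1 - η) ^ ex m)⁻¹ * vs r * (T - t) ^ ex m := by ring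
      _ ≤ _ := by gcongr
set_option maxHeartbeats 2000000 in
lemma w_all {vs ds : ℝ → ℝ} (hvs : Prof n (1 / m) (ex m) vs ds) {ε : ℝ} (hε : 0 < ε) :
    ∃ τ, 5 * T / 8 ≤ τ ∧ τ < T ∧ ∀ t, τ ≤ t → t < T →
      ∀ r ≥ 0, (1 - ε) * (vs r * (T - t) ^ (ex m - 1)) ≤ wU r t ∧ wU r t ≤ (1 + ε) * (vs r * (T - t) ^ (ex m - 1)) := by
  have ha := ex_gt h.hm0 h.hm1
  have hT := h.hT
  set a := ex m with had
  have hh : ∃ k : ℝ, 0 < k ∧ k < 1 / 2 ∧ ((1 + k) ^ a - 1) / (a * k) < 1 + ε ∧ 1 - ε < (1 - (1 - k) ^ a) / (a * k) := by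
    have d1 : HasDerivAt (fun x : ℝ => x ^ a) a 1 := by
      have := hasDerivAt_rpow_const (x := 1) (p := a) (Or.inl one_ne_zero)
      simpa using this
    have t1 := hasDerivAt_iff_tendsto_slope_zero.1 d1
    have t2 : Tendsto (fun k : ℝ => ((1 + k) ^ a - 1) / (a * k)) (𝓝[≠] 0) (𝓝 1) := by
      have := t1.const_mul a⁻¹
      rw [inv_mul_cancel₀ (by linarith)] at this
      refine this.congr fun k => ?_
      simp only [smul_eq_mul, one_rpow]
      rw [div_eq_mul_inv, mul_inv]; ring
    have p1 := (t2.mono_left (nhdsWithin_mono 0 (fun x hx => ne_of_gt hx : Ioi (0:ℝ) ⊆ {0}ᶜ))).eventually_lt_const (u := 1 + ε) (by linarith)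
    have t3 : Tendsto (fun k : ℝ => -k) (𝓝[>] 0) (𝓝[≠] 0) := by
      refine tendsto_nhdsWithin_iff.2 ⟨?_, ?_⟩
      · have := (continuous_neg (G := ℝ)).tendsto 0
        rw [neg_zero] at this
        exact this.mono_left nhdsWithin_le_nhds
      · filter_upwards [self_mem_nhdsWithin] with k hk
        have : (0:ℝ) < k := hk
        simp only [mem_compl_iff, mem_singleton_iff]; linarith
    have p2 := (t2.comp t3).eventually (lt_mem_nhds (a := 1 - ε) (by linarith))
    have p3 : ∀ᶠ k : ℝ in 𝓝[>] 0, k < 1 / 2 := (gt_mem_nhds (by norm_num : (0:ℝ) < 1 / 2) : ∀ᶠ k : ℝ in 𝓝 0, k < 1 / 2).filter_mono nhdsWithin_le_nhds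
    obtain ⟨k, ⟨b1, b2, b3⟩, b4⟩ := ((p1.and (p2.and p3)).and (self_mem_nhdsWithin (a := (0:ℝ)) (s := Ioi 0))).exists
    refine ⟨k, b4, b3, b1, ?_⟩
    have b2' : 1 - ε < ((1 + -k) ^ a - 1) / (a * -k) := b2
    rw [mul_neg, div_neg, ← neg_div, neg_sub, ← sub_eq_add_neg] at b2'
    exact b2'
  obtain ⟨k, hk0, hk1, k1, k2⟩ := hh
  have hx : ∃ x : ℝ, 0 < x ∧ x < 1 ∧ ((1 - x) ^ (a - 1))⁻¹ * (((1 + x) * (1 + k) ^ a - (1 - x)) / (a * k) + x * ((1 + x) * (1 + k) ^ a)) < 1 + ε ∧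
      1 - ε < ((1 + x) ^ (a - 1))⁻¹ * (((1 - x) - (1 + x) * (1 - k) ^ a) / (a * k)) - x * (1 + x) := by
    have i := continuousAt_id (x := (0:ℝ))
    have cp : ContinuousAt (fun x : ℝ => 1 + x) 0 := continuousAt_const.add i
    have cm : ContinuousAt (fun x : ℝ => 1 - x) 0 := continuousAt_const.sub i
    have c1 : ContinuousAt (fun x : ℝ => ((1 - x) ^ (a - 1))⁻¹ * (((1 + x) * (1 + k) ^ a - (1 - x)) / (a * k) + x * ((1 + x) * (1 + k) ^ a))) 0 :=
      ((cm.rpow_const (Or.inr (by linarith))).inv₀ (by simp)).mul ((((cp.mul continuousAt_const).sub cm).div_const _).add (i.mul (cp.mul continuousAt_const)))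
    have c2 : ContinuousAt (fun x : ℝ => ((1 + x) ^ (a - 1))⁻¹ * (((1 - x) - (1 + x) * (1 - k) ^ a) / (a * k)) - x * (1 + x)) 0 :=
      (((cp.rpow_const (Or.inr (by linarith))).inv₀ (by simp)).mul ((cm.sub (cp.mul continuousAt_const)).div_const _)).sub (i.mul cp)
    have e1 := c1.tendsto.eventually_lt_const (u := 1 + ε) (by simpa using k1)
    have e2 := c2.eventually (lt_mem_nhds (a := 1 - ε) (by simpa using k2))
    have e3 : ∀ᶠ η : ℝ in 𝓝 0, η < 1 := gt_mem_nhds one_pos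
    obtain ⟨η, ⟨b1, b2, b3⟩, b4⟩ := (((e1.and (e2.and e3)).filter_mono nhdsWithin_le_nhds).and (self_mem_nhdsWithin (a := (0:ℝ)) (s := Ioi 0))).exists
    exact ⟨η, b4, b3, b1, b2⟩
  obtain ⟨x, hx0, hx1, x1, x2⟩ := hx
  obtain ⟨τ, h1, h2, H⟩ := h.g_all hvs hx0
  have hz : 0 < min (x * T / 8) ((T - τ) / 2) := by have : 0 < T - τ := by linarith
                                                    positivity
  refine ⟨T - min (x * T / 8) ((T - τ) / 2), by linarith [min_le_right (x * T / 8) ((T - τ) / 2)], by linarith, fun t ht ht' r hr => ?_⟩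
  have hθ1 : T - t ≤ x * T / 8 := by linarith [min_le_left (x * T / 8) ((T - τ) / 2)]
  have hθ2 : T - t ≤ (T - τ) / 2 := by linarith [min_le_right (x * T / 8) ((T - τ) / 2)]
  have htτ : τ ≤ t := by linarith
  have hθ : 0 < T - t := by linarith
  have hv := hvs.pos r hr
  have hw := h.w_nonneg r t
  set θ := T - t with hθd
  have hkθ : 0 < k * θ := by positivity
  have hkθ' : k * θ ≤ θ / 2 := by linarith [mul_le_mul_of_nonneg_right hk1.le hθ.le]
  set Θ := θ ^ (a - 1) with hΘ
  have hΘ0 : 0 < Θ := by positivity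
  have eΘ : θ ^ a = Θ * θ := by rw [hΘ, ← rpow_add_one hθ.ne', sub_add_cancel]
  obtain ⟨g1, g2⟩ := H t htτ ht' r hr
  rw [← hθd, eΘ] at g1 g2
  have hg0 := h.g_nonneg r ht'.le
  constructor
  · have ht2 : t + k * θ < T := by linarith
    obtain ⟨_, g4⟩ := H (t + k * θ) (by linarith) ht2 r hr
    rw [show T - (t + k * θ) = (1 - k) * θ by rw [hθd]; ring, mul_rpow (by linarith) hθ.le, eΘ] at g4
    have lb := h.LB hr (by linarith : T / 2 < t) (by linarith : t ≤ t + k * θ) ht2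
    rw [← had, show t + k * θ - t = k * θ by ring] at lb
    have z : x * (T / 8) ≤ x * (t - T / 2) := mul_le_mul_of_nonneg_left (by linarith) hx0.le
    have q : ((t + k * θ - T / 2) / (t - T / 2)) ^ (a - 1) ≤ (1 + x) ^ (a - 1) := by
      refine rpow_le_rpow (div_nonneg (by linarith) (by linarith)) ?_ (by linarith)
      rw [div_le_iff₀ (by linarith)]
      linarith
    have ag : a * gU r t / (t - T / 2) ≤ x * (1 + x) * (vs r * Θ) := by
      rw [div_le_iff₀ (by linarith)]
      refine g2.trans ?_
      have : θ ≤ x * (t - T / 2) := by linarith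
      calc (1 + x) * vs r * (Θ * θ) ≤ (1 + x) * vs r * (Θ * (x * (t - T / 2))) := by gcongr
        _ = _ := by ring
    have hX : 0 < (1 + x) ^ (a - 1) := by positivity
    have m1 : a * (gU r t - gU r (t + k * θ)) ≤ a * (k * θ * ((1 + x) ^ (a - 1) * (wU r t + x * (1 + x) * (vs r * Θ)))) := by
      refine mul_le_mul_of_nonneg_left (lb.trans ?_) (by linarith)
      refine mul_le_mul_of_nonneg_left ?_ hkθ.le
      have : 0 ≤ wU r t + a * gU r t / (t - T / 2) := add_nonneg hw (div_nonneg (by positivity) (by linarith))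
      gcongr
    have m2 : ((1 - x) - (1 + x) * (1 - k) ^ a) * (vs r * Θ) * θ ≤ a * (k * θ * ((1 + x) ^ (a - 1) * (wU r t + x * (1 + x) * (vs r * Θ)))) := by linarith
    have m3 : ((1 + x) ^ (a - 1))⁻¹ * (((1 - x) - (1 + x) * (1 - k) ^ a) / (a * k)) * (vs r * Θ) ≤ wU r t + x * (1 + x) * (vs r * Θ) := by
      have : 0 < ((1 + x) ^ (a - 1) * (a * k) * θ)⁻¹ := by positivity
      have := mul_le_mul_of_nonneg_left m2 this.le
      refine le_trans (le_of_eq ?_) (this.trans (le_of_eq ?_)) <;> field_simp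
    have m4 := mul_le_mul_of_nonneg_right x2.le (by positivity : 0 ≤ vs r * Θ)
    linarith
  · have hs1 : τ ≤ t - k * θ := by linarith
    have hs2 : t - k * θ < T := by linarith
    obtain ⟨_, g4⟩ := H (t - k * θ) hs1 hs2 r hr
    rw [show T - (t - k * θ) = (1 + k) * θ by rw [hθd]; ring, mul_rpow (by linarith) hθ.le, eΘ] at g4
    have ub := h.UB hr (by linarith : T / 2 < t - k * θ) (by linarith : t - k * θ ≤ t) ht'
    rw [← had, show t - (t - k * θ) = k * θ by ring] at ub
    have q : (1 - x) ^ (a - 1) ≤ ((t - k * θ - T / 2) / (t - T / 2)) ^ (a - 1) := by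
      refine rpow_le_rpow (by linarith) ?_ (by linarith)
      rw [le_div_iff₀ (by linarith)]
      have : x * (T / 8) ≤ x * (t - T / 2) := mul_le_mul_of_nonneg_left (by linarith) hx0.le
      linarith
    have ag : a * gU r (t - k * θ) / (t - k * θ - T / 2) ≤ x * ((1 + x) * (1 + k) ^ a) * (vs r * Θ) := by
      rw [div_le_iff₀ (by linarith)]
      refine g4.trans ?_
      have : θ ≤ x * (t - k * θ - T / 2) := by
        have : x * (T / 8) ≤ x * (t - k * θ - T / 2) := mul_le_mul_of_nonneg_left (by linarith) hx0.le
        linarith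
      calc (1 + x) * vs r * ((1 + k) ^ a * (Θ * θ)) ≤ (1 + x) * vs r * ((1 + k) ^ a * (Θ * (x * (t - k * θ - T / 2)))) := by gcongr
        _ = _ := by ring
    have hX : 0 < (1 - x) ^ (a - 1) := by have : 0 < 1 - x := by linarith
                                          positivity
    have m1 : a * (k * θ * ((1 - x) ^ (a - 1) * wU r t)) ≤ a * (gU r (t - k * θ) - gU r t + k * θ * (x * ((1 + x) * (1 + k) ^ a) * (vs r * Θ))) := by
      refine mul_le_mul_of_nonneg_left (le_trans ?_ (ub.trans ?_)) (by linarith)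
      · exact mul_le_mul_of_nonneg_left (mul_le_mul_of_nonneg_right q hw) hkθ.le
      · exact add_le_add le_rfl (mul_le_mul_of_nonneg_left ag hkθ.le)
    have m2 : a * (k * θ * ((1 - x) ^ (a - 1) * wU r t)) ≤ (((1 + x) * (1 + k) ^ a - (1 - x)) + a * k * (x * ((1 + x) * (1 + k) ^ a))) * (vs r * Θ) * θ := by linarith
    have m3 : wU r t ≤ ((1 - x) ^ (a - 1))⁻¹ * (((1 + x) * (1 + k) ^ a - (1 - x)) / (a * k) + x * ((1 + x) * (1 + k) ^ a)) * (vs r * Θ) := by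
      have : 0 < ((1 - x) ^ (a - 1) * (a * k) * θ)⁻¹ := by positivity
      have := mul_le_mul_of_nonneg_left m2 this.le
      refine le_trans (le_of_eq ?_) (this.trans (le_of_eq ?_)) <;> field_simp
    have m4 := mul_le_mul_of_nonneg_right x1.le (by positivity : 0 ≤ vs r * Θ)
    linarith
end Core
lemma prof_scale {n : ℕ} {m T : ℝ} (h0 : 0 < m) (h1 : m < 1) (hT : 0 < T) {V D : ℝ → ℝ}
    (H : Prof n (1 / m) (1 / ((1 - m) * T)) V D) :
    Prof n (1 / m) (ex m) (fun r => V r / T ^ (ex m - 1)) (fun r => D r / T ^ (ex m - 1)) := by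
  have hν : 0 < T ^ (ex m - 1) := by positivity
  have hνp : (T ^ (ex m - 1)) ^ (1 / m) = T ^ (ex m - 1) * T := by
    rw [← rpow_mul hT.le, ex_p h0 h1, ← rpow_add_one hT.ne', sub_add_cancel]
  set ν := T ^ (ex m - 1) with hνd
  have h1m : 1 - m ≠ 0 := by linarith
  refine ⟨fun r hr => (H.hv r hr).div_const ν, fun r hr => ?_, fun r hr => div_pos (H.pos r hr) hν,
    H.cont.div_const ν, ?_, ?_⟩
  · refine ((H.hd r hr).div_const ν).congr_deriv ?_
    rw [div_rpow (H.pos r hr.le).le hν.le, hνp, ex]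
    have : sinh r ≠ 0 := (sinh_pos_iff.2 hr).ne'
    generalize V r ^ (1 / m) = X
    field_simp
  · obtain ⟨C, hC⟩ := H.near
    refine ⟨C / ν, fun r hr => ?_⟩
    have := hC r hr
    rw [abs_div, abs_of_pos hν, div_mul_eq_mul_div]
    exact div_le_div_of_nonneg_right this hν.le
  · obtain ⟨C, hC⟩ := H.inf
    refine ⟨C / ν, fun r hr => ?_⟩
    have := hC r hr
    rw [abs_div, abs_of_pos hν, div_mul_eq_mul_div]
    exact ⟨div_le_div_of_nonneg_right this.1 hν.le, div_le_div_of_nonneg_right this.2 hν.le⟩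
lemma pick_eps {p ε : ℝ} (hp : 0 ≤ p) (hε : 0 < ε) :
    ∃ η : ℝ, 0 < η ∧ η < 1 ∧ 1 - ε < (1 - η) ^ p ∧ (1 + η) ^ p < 1 + ε := by
  have c1 : ContinuousAt (fun η : ℝ => (1 - η) ^ p) 0 := (continuousAt_const.sub continuousAt_id).rpow_const (Or.inr hp)
  have c2 : ContinuousAt (fun η : ℝ => (1 + η) ^ p) 0 := (continuousAt_const.add continuousAt_id).rpow_const (Or.inr hp)
  have e1 := c1.tendsto.eventually_const_lt (u := 1 - ε) (by simp [hε])
  have e2 := c2.tendsto.eventually_lt_const (u := 1 + ε) (by simp [hε])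
  have e3 : ∀ᶠ η : ℝ in 𝓝 0, η < 1 := gt_mem_nhds one_pos
  have := ((e1.and (e2.and e3)).filter_mono nhdsWithin_le_nhds).and (self_mem_nhdsWithin (a := (0:ℝ)) (s := Ioi 0))
  obtain ⟨η, ⟨b1, b2, b3⟩, b4⟩ := this.exists
  exact ⟨η, b4, b3, b1, b2⟩
end FDE

/-- Uniform convergence in relative error near the extinction time. -/
theorem convergence_in_relative_error
    (N : ℕ) (hN : 2 ≤ N) (m T : ℝ)
    (hm : m ∈ Set.Ioo (((N : ℝ) - 2) / ((N : ℝ) + 2)) 1) (hT : 0 < T)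
    (u : ℝ → ℝ → ℝ) (hu : IsRadialEnergySolution N m T u)
    (V : ℝ → ℝ) (hV : IsStationaryProfile N m T V) :
    ∀ ε > (0:ℝ), ∃ t₀ ∈ Set.Ioo 0 T, ∀ t ∈ Set.Ico t₀ T, ∀ r ∈ Set.Ici (0:ℝ),
      |u r t / ((1 - t / T) ^ (1 / (1 - m)) * V r ^ (1 / m)) - 1| ≤ ε := by
  intro ε hε
  obtain ⟨U, Ut, h, hU⟩ := FDE.core_of_solution hN hm hT hu
  have h0 := h.hm0
  have h1 := h.hm1
  have hP := FDE.prof_of_stationary hN h0 hV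
  obtain ⟨η, hη0, hη1, k1, k2⟩ := FDE.pick_eps (p := 1 / m) (by positivity) hε
  obtain ⟨τ, a1, a2, H⟩ := h.w_all (FDE.prof_scale h0 h1 hT hP) hη0
  refine ⟨τ, ⟨by linarith, a2⟩, fun t ht r hr => ?_⟩
  obtain ⟨b1, b2⟩ := H t ht.1 ht.2 r hr
  have htT := ht.2
  have hθ : 0 < T - t := by linarith
  have hVr : 0 < V r := hP.pos r hr
  have hp : 0 ≤ 1 / m := by positivity
  have hq : V r / T ^ (FDE.ex m - 1) * (T - t) ^ (FDE.ex m - 1) = V r * (1 - t / T) ^ (FDE.ex m - 1) := by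
    rw [show 1 - t / T = (T - t) / T by field_simp, Real.div_rpow hθ.le hT.le]; ring
  have hs : 0 < 1 - t / T := by
    rw [show 1 - t / T = (T - t) / T by field_simp]; positivity
  have hpow : (V r * (1 - t / T) ^ (FDE.ex m - 1)) ^ (1 / m) = (1 - t / T) ^ (1 / (1 - m)) * V r ^ (1 / m) := by
    rw [Real.mul_rpow hVr.le (by positivity), ← Real.rpow_mul hs.le, FDE.ex_p h0 h1, FDE.ex, mul_comm]
  simp only [hq] at b1 b2
  have hQ : 0 ≤ V r * (1 - t / T) ^ (FDE.ex m - 1) := by positivity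
  have hA : 0 < (1 - t / T) ^ (1 / (1 - m)) * V r ^ (1 / m) := by positivity
  rw [← hU r hr t ⟨by linarith [ht.1], htT⟩, h.u_eq r t]
  have c1 := Real.rpow_le_rpow (mul_nonneg (by linarith) hQ) b1 hp
  have c2 := Real.rpow_le_rpow (h.w_nonneg r t) b2 hp
  rw [Real.mul_rpow (by linarith) hQ, hpow] at c1 c2
  rw [abs_le]
  constructor
  · have := (le_div_iff₀ hA).2 c1
    linarith
  · have := (div_le_iff₀ hA).2 c2
    linarith
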